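/- arXiv:1711.03382 — 3 statements merged into one kernel-verified Lean document; each statement's English description precedes it below -/
import Mathlib

section
/- For each r ≥ 4, every graph G with minimum degree at least (1 − 1/(100r))·|V(G)| has a fractional K_r-decomposition. -/
open Finset
open scoped Classical

noncomputable def fracCliqueDecomp {V : Type*} [Fintype V] (G : SimpleGraph V) (r : ℕ) : Prop :=
  ∃ w : Finset V → ℝ, (∀ s, 0 ≤ w s) ∧
    ∀ u v : V, G.Adj u v →
      ∑ s ∈ univ.filter (fun s : Finset V => G.IsNClique r s ∧ u ∈ s ∧ v ∈ s), w s = 1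

noncomputable def ZZ {V : Type*} [Fintype V] (y : V → V → ℝ) : ℕ → (V → ℝ) → ℝ
  | 0, _ => 1
  | k + 1, φ => ∑ a, φ a * ZZ y k (fun x => φ x * y a x)

section part1
variable {V : Type*} [Fintype V]

theorem ZZ_succ (y : V → V → ℝ) (k : ℕ) (φ : V → ℝ) :
    ZZ y (k + 1) φ = ∑ a, φ a * ZZ y k (fun x => φ x * y a x) := rfl

theorem ZZ_nonneg (y : V → V → ℝ) (hy0 : ∀ u v, 0 ≤ y u v) (k : ℕ) :
    ∀ φ : V → ℝ, (∀ a, 0 ≤ φ a) → 0 ≤ ZZ y k φ := by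
  induction k with
  | zero => intro φ _; simp [ZZ]
  | succ k ih =>
    intro φ h
    rw [ZZ_succ]
    exact sum_nonneg fun a _ => mul_nonneg (h a) (ih _ fun x => mul_nonneg (h x) (hy0 a x))

theorem ZZ_mono (y : V → V → ℝ) (hy0 : ∀ u v, 0 ≤ y u v) (k : ℕ) :
    ∀ φ ψ : V → ℝ, (∀ a, 0 ≤ φ a) → (∀ a, φ a ≤ ψ a) → ZZ y k φ ≤ ZZ y k ψ := by
  induction k with
  | zero => intro φ ψ _ _; simp [ZZ]
  | succ k ih =>
    intro φ ψ h h'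
    rw [ZZ_succ, ZZ_succ]
    refine sum_le_sum fun a _ => ?_
    refine mul_le_mul (h' a) (ih _ _ (fun x => mul_nonneg (h x) (hy0 a x))
      (fun x => mul_le_mul_of_nonneg_right (h' x) (hy0 a x)))
      (ZZ_nonneg y hy0 k _ fun x => mul_nonneg (h x) (hy0 a x)) ((h a).trans (h' a))

/-- admissible field after `j` pins -/
def FF (P g : ℝ) (j : ℕ) (φ : V → ℝ) : Prop :=
  (∀ a, 0 ≤ φ a ∧ φ a ≤ P) ∧ (Fintype.card V : ℝ) - j * (P * g) ≤ ∑ a, φ a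

theorem FF_pin (y : V → V → ℝ) (hy0 : ∀ u v, 0 ≤ y u v) (hy1 : ∀ u v, y u v ≤ 1)
    (P g : ℝ) (hP : 0 ≤ P) (hg : ∀ w, ∑ a, (1 - y w a) ≤ g) (j : ℕ) (φ : V → ℝ)
    (h : FF P g j φ) (w : V) : FF P g (j + 1) (fun x => φ x * y w x) := by
  refine ⟨fun a => ⟨mul_nonneg (h.1 a).1 (hy0 w a), ?_⟩, ?_⟩
  · have := mul_le_mul (h.1 a).2 (hy1 w a) (hy0 w a) hP
    linarith
  · have h1 : ∑ a, φ a * (1 - y w a) ≤ P * g := by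
      calc ∑ a, φ a * (1 - y w a) ≤ ∑ a, P * (1 - y w a) :=
            sum_le_sum fun a _ => mul_le_mul_of_nonneg_right (h.1 a).2 (by linarith [hy1 w a])
        _ = P * ∑ a, (1 - y w a) := by rw [mul_sum]
        _ ≤ P * g := mul_le_mul_of_nonneg_left (hg w) hP
    have h2 : ∑ a, φ a * y w a = ∑ a, φ a - ∑ a, φ a * (1 - y w a) := by
      rw [← sum_sub_distrib]; exact sum_congr rfl fun a _ => by ring
    have h3 := h.2
    push_cast
    rw [h2]; linarith

theorem lem1 (y : V → V → ℝ) (hy0 : ∀ u v, 0 ≤ y u v) (hy1 : ∀ u v, y u v ≤ 1)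
    (P g n0 ζ c : ℝ) (J : ℕ) (hP : 0 ≤ P) (hg0 : 0 ≤ g) (hg : ∀ w, ∑ a, (1 - y w a) ≤ g)
    (hn0 : 0 < n0) (hn : n0 ≤ (Fintype.card V : ℝ) - J * (P * g))
    (hc0 : 0 ≤ c) (hc : P * g ≤ c * ((1 - ζ) * n0)) (hcζ : J * c ≤ ζ) (hζ : ζ < 1) (k : ℕ) :
    ∀ (j : ℕ) (φ : V → ℝ), FF P g j φ → j + k ≤ J →
      0 < ZZ y k φ ∧ (∀ w, (1 - ζ) * ZZ y k φ ≤ ZZ y k (fun x => φ x * y w x)) ∧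
      (∀ w, (1 - c) ^ k * ZZ y k φ ≤ ZZ y k (fun x => φ x * y w x)) ∧
      (j + k + 1 ≤ J → (1 - ζ) * n0 * ZZ y k φ ≤ ZZ y (k + 1) φ) := by
  have hPg : 0 ≤ P * g := mul_nonneg hP hg0
  have key : ∀ k : ℕ, k ≤ J → (1 - ζ) ≤ (1 - c) ^ k := by
    intro k hk
    by_cases hJ : J = 0
    · have : k = 0 := by omega
      subst this; simp
      subst hJ
      simpa using hcζ
    · have hJ1 : (1 : ℝ) ≤ J := by exact_mod_cast Nat.one_le_iff_ne_zero.mpr hJ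
      have hc1 : c ≤ 1 := by nlinarith
      have h1 : 1 + (k : ℝ) * (-c) ≤ (1 + (-c)) ^ k := one_add_mul_le_pow (by linarith) k
      have h2 : (k : ℝ) * c ≤ J * c := mul_le_mul_of_nonneg_right (by exact_mod_cast hk) hc0
      have : (1 + -c) = 1 - c := by ring
      rw [this] at h1
      linarith
  have hsum : ∀ (j k : ℕ) (φ : V → ℝ), FF P g j φ → j + k ≤ J →
      0 < ZZ y k φ → (∀ w, (1 - ζ) * ZZ y k φ ≤ ZZ y k (fun x => φ x * y w x)) →
      (1 - ζ) * n0 * ZZ y k φ ≤ ZZ y (k + 1) φ := by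
    intro j k φ hF hj hpos hw
    rw [ZZ_succ]
    have h1 : n0 ≤ ∑ a, φ a := by
      have := hF.2
      have h3 : (j : ℝ) * (P * g) ≤ J * (P * g) :=
        mul_le_mul_of_nonneg_right (by exact_mod_cast (by omega : j ≤ J)) hPg
      linarith
    calc (1 - ζ) * n0 * ZZ y k φ ≤ (1 - ζ) * (∑ a, φ a) * ZZ y k φ := by
          apply mul_le_mul_of_nonneg_right _ hpos.le
          exact mul_le_mul_of_nonneg_left h1 (by linarith)
      _ = ∑ a, φ a * ((1 - ζ) * ZZ y k φ) := by rw [← sum_mul]; ring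
      _ ≤ _ := sum_le_sum fun a _ => mul_le_mul_of_nonneg_left (hw a) (hF.1 a).1
  induction k with
  | zero =>
    intro j φ hF hj
    have hw : ∀ w, (1 - ζ) * ZZ y 0 φ ≤ ZZ y 0 (fun x => φ x * y w x) := by
      intro w
      have := key 0 (by omega)
      simpa [ZZ] using this
    refine ⟨by simp [ZZ], hw, fun w => by simp [ZZ], fun h => hsum j 0 φ hF (by omega) (by simp [ZZ]) hw⟩
  | succ k ih =>
    intro j φ hF hj
    obtain ⟨hpos, hw, -, hs⟩ := ih j φ hF (by omega)
    have hs := hs (by omega)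
    have hposS : 0 < ZZ y (k + 1) φ :=
      lt_of_lt_of_le (mul_pos (mul_pos (by linarith) hn0) hpos) hs
    have hc1 : 0 ≤ 1 - c := by
      have hJ1 : (1 : ℝ) ≤ J := by exact_mod_cast (by omega : 1 ≤ J)
      nlinarith
    have hW : ∀ w, (1 - c) ^ (k + 1) * ZZ y (k + 1) φ ≤ ZZ y (k + 1) (fun x => φ x * y w x) := by
      intro w
      have e1 : (1 - c) ^ k * ∑ a, φ a * y w a * ZZ y k (fun x => φ x * y a x)
          ≤ ZZ y (k + 1) (fun x => φ x * y w x) := by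
        rw [ZZ_succ, mul_sum]
        refine sum_le_sum fun a _ => ?_
        have := (ih (j + 1) _ (FF_pin y hy0 hy1 P g hP hg j φ hF a) (by omega)).2.2.1 w
        have e : (fun x => φ x * y w x * y a x) = (fun x => φ x * y a x * y w x) := by
          funext x; ring
        rw [e]
        calc _ = φ a * y w a * ((1 - c) ^ k * ZZ y k (fun x => φ x * y a x)) := by ring
          _ ≤ _ := mul_le_mul_of_nonneg_left this (mul_nonneg (hF.1 a).1 (hy0 w a))
      have e2 : ∑ a, φ a * (1 - y w a) * ZZ y k (fun x => φ x * y a x) ≤ P * g * ZZ y k φ := by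
        calc _ ≤ ∑ a, P * (1 - y w a) * ZZ y k φ := by
              refine sum_le_sum fun a _ => ?_
              have h1 := hy1 w a
              refine mul_le_mul (mul_le_mul_of_nonneg_right (hF.1 a).2 (by linarith))
                (ZZ_mono y hy0 k _ _ (fun x => mul_nonneg (hF.1 x).1 (hy0 a x)) (fun x => ?_))
                (ZZ_nonneg y hy0 k _ (fun x => mul_nonneg (hF.1 x).1 (hy0 a x)))
                (mul_nonneg hP (by linarith))
              exact mul_le_of_le_one_right (hF.1 x).1 (hy1 a x)
          _ = P * (∑ a, (1 - y w a)) * ZZ y k φ := by rw [← sum_mul, mul_sum]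
          _ ≤ _ := mul_le_mul_of_nonneg_right (mul_le_mul_of_nonneg_left (hg w) hP) hpos.le
      have e3 : ∑ a, φ a * y w a * ZZ y k (fun x => φ x * y a x) =
          ZZ y (k + 1) φ - ∑ a, φ a * (1 - y w a) * ZZ y k (fun x => φ x * y a x) := by
        rw [ZZ_succ, ← sum_sub_distrib]; exact sum_congr rfl fun a _ => by ring
      have e4 : P * g * ZZ y k φ ≤ c * ZZ y (k + 1) φ := by
        calc P * g * ZZ y k φ ≤ c * ((1 - ζ) * n0) * ZZ y k φ :=
              mul_le_mul_of_nonneg_right hc hpos.le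
          _ = c * ((1 - ζ) * n0 * ZZ y k φ) := by ring
          _ ≤ _ := mul_le_mul_of_nonneg_left hs hc0
      calc _ = (1 - c) ^ k * ((1 - c) * ZZ y (k + 1) φ) := by ring
        _ ≤ (1 - c) ^ k * ∑ a, φ a * y w a * ZZ y k (fun x => φ x * y a x) := by
            apply mul_le_mul_of_nonneg_left _ (pow_nonneg hc1 k)
            rw [e3]; linarith
        _ ≤ _ := e1
    have hW' : ∀ w, (1 - ζ) * ZZ y (k + 1) φ ≤ ZZ y (k + 1) (fun x => φ x * y w x) := fun w =>
      (mul_le_mul_of_nonneg_right (key (k + 1) (by omega)) hposS.le).trans (hW w)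
    exact ⟨hposS, hW', hW, fun h => hsum j (k + 1) φ hF (by omega) hposS hW'⟩

theorem cov_lem (ω A B a b : V → ℝ) (hω : ∀ x, 0 ≤ ω x) (hA : ∀ x, |A x - 1| ≤ a x)
    (hB : ∀ x, |B x - 1| ≤ b x) (e1 e2 ε : ℝ) (h1 : ∑ x, ω x * (a x * b x) ≤ e1 * ∑ x, ω x)
    (ha : ∑ x, ω x * a x ≤ e2 * ∑ x, ω x) (hb : ∑ x, ω x * b x ≤ e2 * ∑ x, ω x)
    (he2 : e2 ≤ 1) (he20 : 0 ≤ e2)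
    (hε0 : 0 ≤ ε) (hε : e1 + e2 ^ 2 ≤ ε * (1 - e2) ^ 2) :
    |(∑ x, ω x * (A x * B x)) * (∑ x, ω x) - (∑ x, ω x * A x) * (∑ x, ω x * B x)|
      ≤ ε * ((∑ x, ω x * A x) * (∑ x, ω x * B x)) := by
  set Ω := ∑ x, ω x with hΩ
  have hΩ0 : 0 ≤ Ω := sum_nonneg fun x _ => hω x
  have sA : ∑ x, ω x * A x = Ω + ∑ x, ω x * (A x - 1) := by
    rw [hΩ, ← sum_add_distrib]; exact sum_congr rfl fun x _ => by ring
  have sB : ∑ x, ω x * B x = Ω + ∑ x, ω x * (B x - 1) := by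
    rw [hΩ, ← sum_add_distrib]; exact sum_congr rfl fun x _ => by ring
  have sAB : ∑ x, ω x * (A x * B x) = Ω + ∑ x, ω x * (A x - 1) + ∑ x, ω x * (B x - 1)
      + ∑ x, ω x * ((A x - 1) * (B x - 1)) := by
    rw [hΩ, ← sum_add_distrib, ← sum_add_distrib, ← sum_add_distrib]
    exact sum_congr rfl fun x _ => by ring
  have bA : |∑ x, ω x * (A x - 1)| ≤ e2 * Ω := by
    refine (abs_sum_le_sum_abs _ _).trans (le_trans (sum_le_sum fun x _ => ?_) ha)
    rw [abs_mul, abs_of_nonneg (hω x)]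
    exact mul_le_mul_of_nonneg_left (hA x) (hω x)
  have bB : |∑ x, ω x * (B x - 1)| ≤ e2 * Ω := by
    refine (abs_sum_le_sum_abs _ _).trans (le_trans (sum_le_sum fun x _ => ?_) hb)
    rw [abs_mul, abs_of_nonneg (hω x)]
    exact mul_le_mul_of_nonneg_left (hB x) (hω x)
  have bAB : |∑ x, ω x * ((A x - 1) * (B x - 1))| ≤ e1 * Ω := by
    refine (abs_sum_le_sum_abs _ _).trans (le_trans (sum_le_sum fun x _ => ?_) h1)
    rw [abs_mul, abs_of_nonneg (hω x), abs_mul]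
    exact mul_le_mul_of_nonneg_left
      (mul_le_mul (hA x) (hB x) (abs_nonneg _) ((abs_nonneg _).trans (hA x))) (hω x)
  set α := ∑ x, ω x * (A x - 1)
  set β := ∑ x, ω x * (B x - 1)
  set γ := ∑ x, ω x * ((A x - 1) * (B x - 1))
  rw [sA, sB, sAB]
  have l1 : (Ω + α + β + γ) * Ω - (Ω + α) * (Ω + β) = γ * Ω - α * β := by ring
  rw [l1]
  have l2 : |γ * Ω - α * β| ≤ (e1 + e2 ^ 2) * Ω ^ 2 := by
    calc |γ * Ω - α * β| ≤ |γ * Ω| + |α * β| := abs_sub _ _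
      _ = |γ| * Ω + |α| * |β| := by rw [abs_mul, abs_mul, abs_of_nonneg hΩ0]
      _ ≤ (e1 * Ω) * Ω + (e2 * Ω) * (e2 * Ω) := by
          refine add_le_add (mul_le_mul_of_nonneg_right bAB hΩ0)
            (mul_le_mul bA bB (abs_nonneg _) ((abs_nonneg _).trans bA))
      _ = _ := by ring
  have l3 : (1 - e2) * Ω ≤ Ω + α := by have := (abs_le.mp bA).1; linarith
  have l4 : (1 - e2) * Ω ≤ Ω + β := by have := (abs_le.mp bB).1; linarith
  have l5 : 0 ≤ (1 - e2) * Ω := mul_nonneg (by linarith) hΩ0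
  calc _ ≤ (e1 + e2 ^ 2) * Ω ^ 2 := l2
    _ ≤ (ε * (1 - e2) ^ 2) * Ω ^ 2 := mul_le_mul_of_nonneg_right hε (sq_nonneg _)
    _ = ε * (((1 - e2) * Ω) * ((1 - e2) * Ω)) := by ring
    _ ≤ _ := mul_le_mul_of_nonneg_left (mul_le_mul l3 l4 l5 (l5.trans l3)) hε0

end part1

section part1b
variable {V : Type*} [Fintype V]

theorem lem2 (y : V → V → ℝ) (hy0 : ∀ u v, 0 ≤ y u v) (hy1 : ∀ u v, y u v ≤ 1)
    (P g n0 ζ c : ℝ) (J : ℕ) (hP : 0 ≤ P) (hg0 : 0 ≤ g) (hg : ∀ w, ∑ a, (1 - y w a) ≤ g)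
    (hn0 : 0 < n0) (hn : n0 ≤ (Fintype.card V : ℝ) - J * (P * g))
    (hc0 : 0 ≤ c) (hc : P * g ≤ c * ((1 - ζ) * n0)) (hcζ : J * c ≤ ζ) (hζ : ζ < 1)
    (M E ε e1 : V → V → ℝ) (e2 : ℝ) (hM0 : ∀ u v, 0 ≤ M u v)
    (hM1 : ∀ u a, 1 - M u a ≤ y u a * (1 - E u a))
    (hM2 : ∀ u a, y u a * (1 + E u a) ≤ 1 + M u a)
    (hMg : ∀ u, ∑ a, M u a ≤ g) (hε0 : ∀ u v, 0 ≤ ε u v) (hε1 : ∀ u v, ε u v ≤ 1)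
    (hεE : ∀ u v, (1 + ε u v) ^ J ≤ 1 + E u v) (hεE' : ∀ u v, 1 - E u v ≤ (1 - ε u v) ^ J)
    (he2 : e2 ≤ 1) (he20 : 0 ≤ e2) (he2g : P * g ≤ e2 * ((1 - ζ) * n0))
    (he1 : ∀ u v, P * ∑ a, M u a * M v a ≤ e1 u v * ((1 - ζ) * n0))
    (hee : ∀ u v, e1 u v + e2 ^ 2 ≤ ε u v * (1 - e2) ^ 2) (k : ℕ) :
    ∀ (j : ℕ) (φ : V → ℝ), FF P g j φ → j + k + 1 ≤ J → ∀ u v,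
      (1 - ε u v) ^ k * (ZZ y k (fun x => φ x * y u x) * ZZ y k (fun x => φ x * y v x))
        ≤ ZZ y k (fun x => φ x * y u x * y v x) * ZZ y k φ ∧
      ZZ y k (fun x => φ x * y u x * y v x) * ZZ y k φ ≤
      (1 + ε u v) ^ k * (ZZ y k (fun x => φ x * y u x) * ZZ y k (fun x => φ x * y v x)) := by
  have L1 := lem1 y hy0 hy1 P g n0 ζ c J hP hg0 hg hn0 hn hc0 hc hcζ hζ
  have Fp := FF_pin y hy0 hy1 P g hP hg
  induction k with
  | zero => intro j φ _ _ u v; simp [ZZ]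
  | succ k ih =>
    intro j φ hF hj u v
    have hX : 0 < ZZ y k φ := (L1 k j φ hF (by omega)).1
    have hXa : ∀ a, 0 < ZZ y k (fun x => φ x * y a x) := fun a =>
      (L1 k (j + 1) _ (Fp j φ hF a) (by omega)).1
    have hΩl := (L1 k j φ hF (by omega)).2.2.2 (by omega)
    have hφ0 : ∀ a, 0 ≤ φ a := fun a => (hF.1 a).1
    have hXle : ∀ a, ZZ y k (fun x => φ x * y a x) ≤ ZZ y k φ := fun a =>
      ZZ_mono y hy0 k _ _ (fun x => mul_nonneg (hφ0 x) (hy0 a x))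
        (fun x => mul_le_of_le_one_right (hφ0 x) (hy1 a x))
    have ihφ := ih j φ hF (by omega)
    have iha := fun a => ih (j + 1) _ (Fp j φ hF a) (by omega) u v
    set X := ZZ y k φ with hXdef
    set Xa : V → ℝ := fun a => ZZ y k (fun x => φ x * y a x) with hXadef
    set W : V → V → ℝ := fun u a => ZZ y k (fun x => φ x * y a x * y u x) with hWdef
    have hW0 : ∀ u a, 0 ≤ W u a := fun u a => ZZ_nonneg y hy0 k _ fun x =>
      mul_nonneg (mul_nonneg (hφ0 x) (hy0 a x)) (hy0 u x)
    have hWb : ∀ u a, (1 - E u a) * (Xa u * Xa a) ≤ W u a * X ∧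
        W u a * X ≤ (1 + E u a) * (Xa u * Xa a) := by
      intro u a
      have h := ihφ u a
      have e : (fun x => φ x * y u x * y a x) = (fun x => φ x * y a x * y u x) := by
        funext x; ring
      rw [e] at h
      have hp : 0 ≤ Xa u * Xa a := (mul_pos (hXa u) (hXa a)).le
      have q1 : 1 - E u a ≤ (1 - ε u a) ^ k := (hεE' u a).trans
        (pow_le_pow_of_le_one (by linarith [hε1 u a]) (by linarith [hε0 u a]) (by omega))
      have q2 : (1 + ε u a) ^ k ≤ 1 + E u a := le_trans
        (pow_le_pow_right₀ (by linarith [hε0 u a]) (by omega)) (hεE u a)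
      exact ⟨(mul_le_mul_of_nonneg_right q1 hp).trans h.1,
        h.2.trans (mul_le_mul_of_nonneg_right q2 hp)⟩
    set AA : V → V → ℝ := fun u a => y u a * (W u a * X / (Xa u * Xa a)) with hAA
    have hAb : ∀ u a, |AA u a - 1| ≤ M u a := by
      intro u a
      have hp : 0 < Xa u * Xa a := mul_pos (hXa u) (hXa a)
      have h1 : 1 - E u a ≤ W u a * X / (Xa u * Xa a) := by
        rw [le_div_iff₀ hp]; exact (hWb u a).1
      have h2 : W u a * X / (Xa u * Xa a) ≤ 1 + E u a := by
        rw [div_le_iff₀ hp]; exact (hWb u a).2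
      have h3 := mul_le_mul_of_nonneg_left h1 (hy0 u a)
      have h4 := mul_le_mul_of_nonneg_left h2 (hy0 u a)
      rw [abs_le]
      constructor
      · have := hM1 u a; simp only [hAA]; linarith
      · have := hM2 u a; simp only [hAA]; linarith
    have hωF : ∀ F : V → ℝ, (∀ a, 0 ≤ F a) →
        ∑ a, (φ a * Xa a) * F a ≤ (P * ∑ a, F a) * X := by
      intro F hF0
      rw [mul_sum, sum_mul]
      refine sum_le_sum fun a _ => ?_
      calc φ a * Xa a * F a ≤ P * X * F a := by
            apply mul_le_mul_of_nonneg_right _ (hF0 a)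
            exact mul_le_mul (hF.1 a).2 (hXle a) (hXa a).le hP
        _ = _ := by ring
    have hΩ : ZZ y (k + 1) φ = ∑ a, φ a * Xa a := rfl
    have hbig : ∀ (t e : ℝ), 0 ≤ t → t ≤ e * ((1 - ζ) * n0) → t * X ≤ e * ∑ a, φ a * Xa a := by
      intro t e ht0 ht
      have hpp : 0 < (1 - ζ) * n0 := mul_pos (by linarith) hn0
      have he : 0 ≤ e := by
        by_contra hh
        push Not at hh
        nlinarith
      calc t * X ≤ e * ((1 - ζ) * n0) * X := mul_le_mul_of_nonneg_right ht hX.le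
        _ = e * ((1 - ζ) * n0 * X) := by ring
        _ ≤ _ := mul_le_mul_of_nonneg_left (by rw [← hΩ]; exact hΩl) he
    have hrow : ∀ u, ∑ a, (φ a * Xa a) * M u a ≤ e2 * ∑ a, φ a * Xa a := by
      intro u
      refine (hωF (M u) (hM0 u)).trans (hbig _ _ (mul_nonneg hP (sum_nonneg fun a _ => hM0 u a)) ?_)
      exact (mul_le_mul_of_nonneg_left (hMg u) hP).trans he2g
    have cov := cov_lem (fun a => φ a * Xa a) (AA u) (AA v) (M u) (M v)
      (fun a => mul_nonneg (hφ0 a) (hXa a).le) (hAb u) (hAb v) (e1 u v) e2 (ε u v)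
      ((hωF _ (fun a => mul_nonneg (hM0 u a) (hM0 v a))).trans (hbig _ _
        (mul_nonneg hP (sum_nonneg fun a _ => mul_nonneg (hM0 u a) (hM0 v a))) (he1 u v)))
      (hrow u) (hrow v) he2 he20 (hε0 u v) (hee u v)
    have hU : ∀ u, ∑ a, (φ a * Xa a) * AA u a = ZZ y (k + 1) (fun x => φ x * y u x) * (X / Xa u) := by
      intro u
      rw [ZZ_succ, sum_mul]
      refine sum_congr rfl fun a _ => ?_
      have e : (fun x => φ x * y u x * y a x) = (fun x => φ x * y a x * y u x) := by
        funext x; ring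
      rw [e]
      have h1 := (hXa u).ne'
      have h2 := (hXa a).ne'
      change _ = φ a * y u a * W u a * (X / Xa u)
      simp only [hAA]
      change Xa u ≠ 0 at h1
      change Xa a ≠ 0 at h2
      field_simp
    set S : ℝ := ∑ a, φ a * (y u a * y v a) * (W u a * W v a / Xa a) with hS
    have hUV : ∑ a, (φ a * Xa a) * (AA u a * AA v a) = S * (X / Xa u) * (X / Xa v) := by
      rw [hS, sum_mul, sum_mul]
      refine sum_congr rfl fun a _ => ?_
      have h1 : Xa u ≠ 0 := (hXa u).ne'
      have h2 : Xa a ≠ 0 := (hXa a).ne'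
      have h3 : Xa v ≠ 0 := (hXa v).ne'
      simp only [hAA]
      field_simp
    rw [hU, hU, hUV, ← hΩ] at cov
    set U := ZZ y (k + 1) (fun x => φ x * y u x)
    set T := ZZ y (k + 1) (fun x => φ x * y v x)
    set Ω := ZZ y (k + 1) φ
    have hq : 0 < (X / Xa u) * (X / Xa v) := mul_pos (div_pos hX (hXa u)) (div_pos hX (hXa v))
    have hΩ0 : 0 ≤ Ω := ZZ_nonneg y hy0 _ _ hφ0
    have cov1 : (1 - ε u v) * (U * T) ≤ S * Ω ∧ S * Ω ≤ (1 + ε u v) * (U * T) := by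
      have h := abs_le.mp cov
      constructor
      · refine le_of_mul_le_mul_right ?_ hq
        have := h.1; nlinarith
      · refine le_of_mul_le_mul_right ?_ hq
        have := h.2; nlinarith
    have hZ : ZZ y (k + 1) (fun x => φ x * y u x * y v x) =
        ∑ a, φ a * (y u a * y v a) * ZZ y k (fun x => φ x * y a x * y u x * y v x) := by
      rw [ZZ_succ]
      refine sum_congr rfl fun a _ => ?_
      have e : (fun x => φ x * y u x * y v x * y a x) = (fun x => φ x * y a x * y u x * y v x) := by
        funext x; ring
      rw [e]; ring
    have hlo : (1 - ε u v) ^ k * S ≤ ZZ y (k + 1) (fun x => φ x * y u x * y v x) := by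
      rw [hZ, hS, mul_sum]
      refine sum_le_sum fun a _ => ?_
      have h1 : (1 - ε u v) ^ k * (W u a * W v a) ≤ _ * Xa a := (iha a).1
      calc _ = φ a * (y u a * y v a) * ((1 - ε u v) ^ k * (W u a * W v a) / Xa a) := by ring
        _ ≤ _ := by
          apply mul_le_mul_of_nonneg_left _ (mul_nonneg (hφ0 a) (mul_nonneg (hy0 u a) (hy0 v a)))
          rw [div_le_iff₀ (hXa a)]; exact h1
    have hhi : ZZ y (k + 1) (fun x => φ x * y u x * y v x) ≤ (1 + ε u v) ^ k * S := by
      rw [hZ, hS, mul_sum]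
      refine sum_le_sum fun a _ => ?_
      have h1 : _ * Xa a ≤ (1 + ε u v) ^ k * (W u a * W v a) := (iha a).2
      calc _ ≤ φ a * (y u a * y v a) * ((1 + ε u v) ^ k * (W u a * W v a) / Xa a) := by
            apply mul_le_mul_of_nonneg_left _ (mul_nonneg (hφ0 a) (mul_nonneg (hy0 u a) (hy0 v a)))
            rw [le_div_iff₀ (hXa a)]; exact h1
        _ = _ := by ring
    constructor
    · calc _ = (1 - ε u v) ^ k * ((1 - ε u v) * (U * T)) := by ring
        _ ≤ (1 - ε u v) ^ k * (S * Ω) :=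
          mul_le_mul_of_nonneg_left cov1.1 (pow_nonneg (by linarith [hε1 u v]) k)
        _ = (1 - ε u v) ^ k * S * Ω := by ring
        _ ≤ _ := mul_le_mul_of_nonneg_right hlo hΩ0
    · calc _ ≤ (1 + ε u v) ^ k * S * Ω := mul_le_mul_of_nonneg_right hhi hΩ0
        _ = (1 + ε u v) ^ k * (S * Ω) := by ring
        _ ≤ (1 + ε u v) ^ k * ((1 + ε u v) * (U * T)) :=
          mul_le_mul_of_nonneg_left cov1.2 (pow_nonneg (by linarith [hε0 u v]) k)
        _ = _ := by ring
end part1b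

section part2
set_option linter.unusedSectionVars false
variable {V : Type*} [Fintype V]

noncomputable def Phi (Y : Sym2 V → ℝ) (φ : V → ℝ) (K : Finset V) : ℝ :=
  (∏ u ∈ K, φ u) * ∏ e ∈ K.sym2.filter (fun e => ¬ e.IsDiag), Y e

theorem Phi_insert (Y : Sym2 V → ℝ) (φ : V → ℝ) (K : Finset V) (a : V) (ha : a ∉ K) :
    Phi Y φ (insert a K) = φ a * Phi Y (fun x => φ x * Y s(a, x)) K := by
  have h1 : (insert a K).sym2.filter (fun e => ¬ e.IsDiag) =
      (K.image (fun x => s(a, x))) ∪ K.sym2.filter (fun e => ¬ e.IsDiag) := by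
    ext e
    induction e with
    | _ x y =>
      simp only [mem_filter, mem_union, mem_image, Finset.mk_mem_sym2_iff, mem_insert,
        Sym2.mk_isDiag_iff, Sym2.eq_iff]
      constructor
      · rintro ⟨⟨h1, h2⟩, h3⟩
        rcases h1 with rfl | h1 <;> rcases h2 with rfl | h2
        · exact absurd rfl h3
        · exact Or.inl ⟨y, h2, by simp⟩
        · exact Or.inl ⟨x, h1, by simp⟩
        · exact Or.inr ⟨⟨h1, h2⟩, h3⟩
      · rintro (⟨z, hz, h⟩ | ⟨⟨h1, h2⟩, h3⟩)
        · rcases h with ⟨rfl, rfl⟩ | ⟨rfl, rfl⟩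
          · exact ⟨⟨Or.inl rfl, Or.inr hz⟩, fun h => ha (h ▸ hz)⟩
          · exact ⟨⟨Or.inr hz, Or.inl rfl⟩, fun h => ha (h ▸ hz)⟩
        · exact ⟨⟨Or.inr h1, Or.inr h2⟩, h3⟩
  have hd : Disjoint (K.image (fun x => s(a, x))) (K.sym2.filter (fun e => ¬ e.IsDiag)) := by
    rw [disjoint_left]
    intro e he he'
    obtain ⟨x, hx, rfl⟩ := mem_image.mp he
    have := (mem_filter.mp he').1
    rw [Finset.mk_mem_sym2_iff] at this
    exact ha this.1
  unfold Phi
  rw [h1, prod_union hd, prod_insert ha, prod_image, prod_mul_distrib]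
  · ring
  · intro x _ x' _ h
    rcases Sym2.eq_iff.mp h with h | h
    · exact h.2
    · exact h.2.trans h.1

theorem Phi_pin_zero (Y : Sym2 V → ℝ) (hY : ∀ a, Y s(a, a) = 0) (φ : V → ℝ) (K : Finset V) (a : V)
    (ha : a ∈ K) : Phi Y (fun x => φ x * Y s(a, x)) K = 0 := by
  unfold Phi
  rw [prod_eq_zero ha (by rw [hY]; ring), zero_mul]

theorem sum_ins (f : Finset V → ℝ) (k : ℕ) (a : V) :
    ∑ K ∈ (powersetCard (k + 1) univ).filter (fun K => a ∈ K), f K =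
    ∑ K ∈ (powersetCard k univ).filter (fun K => a ∉ K), f (insert a K) := by
  symm
  refine sum_bij' (fun K _ => insert a K) (fun K _ => K.erase a) ?_ ?_ ?_ ?_ ?_
  · intro K hK
    simp only [mem_filter, mem_powersetCard_univ] at hK ⊢
    exact ⟨by rw [card_insert_of_notMem hK.2, hK.1], mem_insert_self _ _⟩
  · intro K hK
    simp only [mem_filter, mem_powersetCard_univ] at hK ⊢
    exact ⟨by rw [card_erase_of_mem hK.2, hK.1]; rfl, notMem_erase _ _⟩
  · intro K hK
    exact erase_insert (mem_filter.mp hK).2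
  · intro K hK
    exact insert_erase (mem_filter.mp hK).2
  · intro K _; rfl

theorem sum_pin (Y : Sym2 V → ℝ) (hY : ∀ a, Y s(a, a) = 0) (φ : V → ℝ) (k : ℕ) (a : V) :
    ∑ K ∈ (powersetCard (k + 1) univ).filter (fun K => a ∈ K), Phi Y φ K =
    φ a * ∑ K ∈ powersetCard k univ, Phi Y (fun x => φ x * Y s(a, x)) K := by
  rw [sum_ins, mul_sum, sum_filter]
  refine sum_congr rfl fun K _ => ?_
  split_ifs with h
  · rw [Phi_pin_zero Y hY φ K a h, mul_zero]
  · exact Phi_insert Y φ K a h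

theorem sum_pin_pair (Y : Sym2 V → ℝ) (hY : ∀ a, Y s(a, a) = 0) (φ : V → ℝ) (k : ℕ) (a b : V)
    (hab : a ≠ b) :
    ∑ K ∈ (powersetCard (k + 1) univ).filter (fun K => a ∈ K ∧ b ∈ K), Phi Y φ K =
    φ a * ∑ K ∈ (powersetCard k univ).filter (fun K => b ∈ K),
      Phi Y (fun x => φ x * Y s(a, x)) K := by
  have h := sum_ins (fun K => if b ∈ K then Phi Y φ K else 0) k a
  rw [← sum_filter, filter_filter] at h
  rw [h, mul_sum, sum_filter, sum_filter]
  refine sum_congr rfl fun K _ => ?_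
  by_cases hb : b ∈ K
  · simp only [hb, mem_insert, or_true, if_true]
    split_ifs with h
    · rw [Phi_pin_zero Y hY φ K a h, mul_zero]
    · exact Phi_insert Y φ K a h
  · have : b ∉ insert a K := by simp [hb, hab.symm]
    simp [hb, this]

theorem sum_count (f : Finset V → ℝ) (k : ℕ) :
    ∑ a, ∑ K ∈ (powersetCard k univ).filter (fun K : Finset V => a ∈ K), f K =
      k * ∑ K ∈ powersetCard k univ, f K := by
  simp_rw [sum_filter]
  rw [sum_comm, mul_sum]
  refine sum_congr rfl fun K hK => ?_
  rw [← sum_filter, sum_const, filter_mem_eq_inter, univ_inter, (mem_powersetCard_univ.mp hK)]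
  simp

theorem sum_count2 (f : Finset V → ℝ) (k : ℕ) (a : V) :
    ∑ b ∈ univ.filter (fun b => b ≠ a),
      ∑ K ∈ (powersetCard (k + 1) univ).filter (fun K : Finset V => a ∈ K ∧ b ∈ K), f K =
      k * ∑ K ∈ (powersetCard (k + 1) univ).filter (fun K : Finset V => a ∈ K), f K := by
  have : ∀ b, ∑ K ∈ (powersetCard (k + 1) univ).filter (fun K : Finset V => a ∈ K ∧ b ∈ K), f K
    = ∑ K ∈ (powersetCard (k + 1) univ).filter (fun K : Finset V => a ∈ K),
      if b ∈ K then f K else 0 := by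
    intro b
    rw [← sum_filter, filter_filter]
  simp_rw [this]
  rw [sum_comm, mul_sum]
  refine sum_congr rfl fun K hK => ?_
  rw [← sum_filter, sum_const, filter_filter]
  have h2 : univ.filter (fun b => b ≠ a ∧ b ∈ K) = K.erase a := by
    ext x; simp
  simp only [mem_filter, mem_powersetCard_univ] at hK
  rw [h2, card_erase_of_mem hK.2, hK.1]
  simp

theorem ZZ_eq (Y : Sym2 V → ℝ) (hY : ∀ a, Y s(a, a) = 0) (k : ℕ) : ∀ φ : V → ℝ,
    ZZ (fun u v => Y s(u, v)) k φ = (k.factorial : ℝ) * ∑ K ∈ powersetCard k univ, Phi Y φ K := by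
  induction k with
  | zero => intro φ; simp [ZZ, Phi]
  | succ k ih =>
    intro φ
    rw [ZZ_succ]
    have h := sum_count (Phi Y φ) (k + 1)
    simp_rw [sum_pin Y hY φ k] at h
    simp_rw [ih]
    rw [Nat.factorial_succ]
    push_cast at h ⊢
    have : ∀ a, φ a * ((k.factorial : ℝ) * ∑ K ∈ powersetCard k univ, Phi Y (fun x => φ x * Y s(a, x)) K)
      = (k.factorial : ℝ) * (φ a * ∑ K ∈ powersetCard k univ, Phi Y (fun x => φ x * Y s(a, x)) K) := by
      intro a; ring
    simp_rw [this]
    rw [← mul_sum, h]; ring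

theorem N1_eq (Y : Sym2 V → ℝ) (hY : ∀ a, Y s(a, a) = 0) (φ : V → ℝ) (k : ℕ) (a : V) :
    (k.factorial : ℝ) * ∑ K ∈ (powersetCard (k + 1) univ).filter (fun K => a ∈ K), Phi Y φ K =
    φ a * ZZ (fun u v => Y s(u, v)) k (fun x => φ x * Y s(a, x)) := by
  rw [sum_pin Y hY, ZZ_eq Y hY]; ring

theorem N2_eq (Y : Sym2 V → ℝ) (hY : ∀ a, Y s(a, a) = 0) (φ : V → ℝ) (k : ℕ) (a b : V)
    (hab : a ≠ b) :
    (k.factorial : ℝ) *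
      ∑ K ∈ (powersetCard (k + 2) univ).filter (fun K => a ∈ K ∧ b ∈ K), Phi Y φ K =
    φ a * φ b * Y s(a, b) *
      ZZ (fun u v => Y s(u, v)) k (fun x => φ x * Y s(a, x) * Y s(b, x)) := by
  rw [sum_pin_pair Y hY φ (k + 1) a b hab, sum_pin Y hY, ZZ_eq Y hY]; ring

theorem Phi_nonneg (Y : Sym2 V → ℝ) (hY : ∀ e, 0 ≤ Y e) (φ : V → ℝ) (hφ : ∀ a, 0 ≤ φ a)
    (K : Finset V) : 0 ≤ Phi Y φ K :=
  mul_nonneg (prod_nonneg fun a _ => hφ a) (prod_nonneg fun e _ => hY e)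

theorem Phi_clique (G : SimpleGraph V) (Y : Sym2 V → ℝ) (hY : ∀ u v, ¬ G.Adj u v → Y s(u, v) = 0)
    (φ : V → ℝ) (K : Finset V) (h : ¬ G.IsClique (K : Set V)) : Phi Y φ K = 0 := by
  rw [SimpleGraph.isClique_iff, Set.Pairwise] at h
  push Not at h
  obtain ⟨u, hu, v, hv, huv, hna⟩ := h
  unfold Phi
  have : ∏ e ∈ K.sym2.filter (fun e => ¬ e.IsDiag), Y e = 0 := by
    refine prod_eq_zero (i := s(u, v)) ?_ (hY u v hna)
    rw [mem_filter, Finset.mk_mem_sym2_iff]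
    exact ⟨⟨hu, hv⟩, by simpa using huv⟩
  rw [this, mul_zero]

theorem Phi_scale_vertex (Y : Sym2 V → ℝ) (φ : V → ℝ) (a : V) (s : ℝ) (K : Finset V) :
    Phi Y (Function.update φ a (s * φ a)) K = Phi Y φ K * (if a ∈ K then s else 1) := by
  unfold Phi
  split_ifs with h
  · rw [prod_update_of_mem h, ← mul_prod_erase K φ h, sdiff_singleton_eq_erase]; ring
  · rw [prod_update_of_notMem h]; ring

theorem Phi_scale_edge (Y : Sym2 V → ℝ) (φ : V → ℝ) (u v : V) (huv : u ≠ v) (s : ℝ)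
    (K : Finset V) :
    Phi (Function.update Y s(u, v) (s * Y s(u, v))) φ K =
      Phi Y φ K * (if u ∈ K ∧ v ∈ K then s else 1) := by
  unfold Phi
  split_ifs with h
  · have : s(u, v) ∈ K.sym2.filter (fun e => ¬ e.IsDiag) := by
      rw [mem_filter, Finset.mk_mem_sym2_iff]
      exact ⟨h, by simpa using huv⟩
    rw [prod_update_of_mem this, ← mul_prod_erase _ Y this, sdiff_singleton_eq_erase]; ring
  · have : s(u, v) ∉ K.sym2.filter (fun e => ¬ e.IsDiag) := by
      rw [mem_filter, Finset.mk_mem_sym2_iff]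
      exact fun h' => h h'.1
    rw [prod_update_of_notMem this]; ring

theorem sum_scale (f : Finset V → ℝ) (S : Finset (Finset V)) (p : Finset V → Prop) [DecidablePred p] (s : ℝ) :
    ∑ K ∈ S, f K * (if p K then s else 1) =
      ∑ K ∈ S, f K + (s - 1) * ∑ K ∈ S.filter p, f K := by
  rw [sum_filter, mul_sum, ← sum_add_distrib]
  refine sum_congr rfl fun K _ => ?_
  split_ifs <;> ring

end part2

section part3a

theorem kkt_up (x T η : ℝ) (hη : 0 < η) (hx : 0 ≤ x) (hT : 0 ≤ T)
    (h : ∀ s, 1 < s → s < 1 + η → T * Real.log s ≤ Real.log (1 + (s - 1) * x)) : T ≤ x := by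
  by_contra hc
  push Not at hc
  have key : ∀ s, 1 < s → s < 1 + η → T ≤ s * x := by
    intro s h1 h2
    have a1 : Real.log (1 + (s - 1) * x) ≤ (s - 1) * x := by
      have := Real.log_le_sub_one_of_pos (x := 1 + (s - 1) * x) (by nlinarith)
      linarith
    have a2 : 1 - s⁻¹ ≤ Real.log s := Real.one_sub_inv_le_log_of_pos (by linarith)
    have a3 : T * (1 - s⁻¹) ≤ (s - 1) * x :=
      (mul_le_mul_of_nonneg_left a2 hT).trans ((h s h1 h2).trans a1)
    have a4 : T * (1 - s⁻¹) * s = T * (s - 1) := by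
      have : s ≠ 0 := by linarith
      field_simp
    have a5 : T * (s - 1) ≤ (s - 1) * x * s := by
      rw [← a4]; exact mul_le_mul_of_nonneg_right a3 (by linarith)
    refine le_of_mul_le_mul_right (a := s - 1) ?_ (by linarith)
    linarith
  -- choose s close to 1
  set t := min (η / 2) ((T - x) / (2 * (x + 1))) with ht
  have t0 : 0 < t := lt_min (by linarith) (div_pos (by linarith) (by linarith))
  have t1 : t ≤ η / 2 := min_le_left _ _
  have t2 : t * (2 * (x + 1)) ≤ T - x := by
    have : t ≤ (T - x) / (2 * (x + 1)) := min_le_right _ _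
    rwa [le_div_iff₀ (by linarith)] at this
  have := key (1 + t) (by linarith) (by linarith)
  nlinarith

theorem kkt_down (x T η : ℝ) (hη : 0 < η) (hη1 : η ≤ 1) (hx : 0 ≤ x) (hx1 : x ≤ 1) (hT : 0 ≤ T)
    (h : ∀ s, 1 - η < s → s < 1 → T * Real.log s ≤ Real.log (1 + (s - 1) * x)) : x ≤ T := by
  by_contra hc
  push Not at hc
  have key : ∀ s, 1 - η < s → s < 1 → s * x ≤ T := by
    intro s h1 h2
    have hs : 0 < s := by linarith
    have a1 : Real.log (1 + (s - 1) * x) ≤ (s - 1) * x := by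
      have := Real.log_le_sub_one_of_pos (x := 1 + (s - 1) * x) (by nlinarith)
      linarith
    have a2 : 1 - s⁻¹ ≤ Real.log s := Real.one_sub_inv_le_log_of_pos (by linarith)
    have a3 : T * (1 - s⁻¹) ≤ (s - 1) * x :=
      (mul_le_mul_of_nonneg_left a2 hT).trans ((h s h1 h2).trans a1)
    have a4 : T * (1 - s⁻¹) * s = T * (s - 1) := by
      have : s ≠ 0 := by linarith
      field_simp
    have a5 : T * (s - 1) ≤ (s - 1) * x * s := by
      rw [← a4]; exact mul_le_mul_of_nonneg_right a3 (by linarith)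
    refine le_of_mul_le_mul_right (a := 1 - s) ?_ (by linarith)
    linarith
  set t := min (η / 2) ((x - T) / 2) with ht
  have t0 : 0 < t := lt_min (by linarith) (by linarith)
  have t1 : t ≤ η / 2 := min_le_left _ _
  have t2 : t ≤ (x - T) / 2 := min_le_right _ _
  have := key (1 - t) (by linarith) (by linarith)
  nlinarith

theorem sum_log_update {ι : Type*} [DecidableEq ι] (S : Finset ι) (T z : ι → ℝ) (a : ι) (ha : a ∈ S)
    (s : ℝ) (hs : 0 < s) (hz : 0 < z a) :
    ∑ u ∈ S, T u * Real.log (Function.update z a (s * z a) u) =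
      ∑ u ∈ S, T u * Real.log (z u) + T a * Real.log s := by
  rw [← add_sum_erase S _ ha, ← add_sum_erase S (fun u => T u * Real.log (z u)) ha]
  have : ∑ x ∈ S.erase a, T x * Real.log (Function.update z a (s * z a) x) =
      ∑ x ∈ S.erase a, T x * Real.log (z x) := by
    refine sum_congr rfl fun x hx => ?_
    rw [Function.update_of_ne (ne_of_mem_erase hx)]
  rw [this, Function.update_self, Real.log_mul hs.ne' hz.ne']
  ring

variable {V : Type*} [Fintype V]

set_option maxHeartbeats 1000000 in
theorem exists_min (G : SimpleGraph V) (r : ℕ) (lo hi : V → ℝ) (ylo yhi : Sym2 V → ℝ)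
    (hlo : ∀ u, 0 < lo u) (hlohi : ∀ u, lo u ≤ hi u)
    (hylohi : ∀ e, ylo e ≤ yhi e) (hypos : ∀ e ∈ G.edgeSet, 0 < ylo e)
    (hy0 : ∀ e, 0 ≤ ylo e)
    (T1 : V → ℝ) (T2 : Sym2 V → ℝ) (hT1 : ∀ u, 0 ≤ T1 u) (hT2 : ∀ e, 0 ≤ T2 e)
    (hpos : ∀ z Y, (∀ u, lo u ≤ z u ∧ z u ≤ hi u) → (∀ e, ylo e ≤ Y e ∧ Y e ≤ yhi e) →
      0 < ∑ K ∈ powersetCard r univ, Phi Y z K) :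
    ∃ (z : V → ℝ) (Y : Sym2 V → ℝ), (∀ u, lo u ≤ z u ∧ z u ≤ hi u) ∧
      (∀ e, ylo e ≤ Y e ∧ Y e ≤ yhi e) ∧
      (∀ u, z u < hi u → T1 u * (∑ K ∈ powersetCard r univ, Phi Y z K) ≤
        ∑ K ∈ (powersetCard r univ).filter (fun K => u ∈ K), Phi Y z K) ∧
      (∀ u, lo u < z u → ∑ K ∈ (powersetCard r univ).filter (fun K => u ∈ K), Phi Y z K ≤
        T1 u * (∑ K ∈ powersetCard r univ, Phi Y z K)) ∧
      (∀ u v, G.Adj u v → Y s(u, v) < yhi s(u, v) →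
        T2 s(u, v) * (∑ K ∈ powersetCard r univ, Phi Y z K) ≤
        ∑ K ∈ (powersetCard r univ).filter (fun K => u ∈ K ∧ v ∈ K), Phi Y z K) ∧
      (∀ u v, G.Adj u v → ylo s(u, v) < Y s(u, v) →
        ∑ K ∈ (powersetCard r univ).filter (fun K => u ∈ K ∧ v ∈ K), Phi Y z K ≤
        T2 s(u, v) * (∑ K ∈ powersetCard r univ, Phi Y z K)) := by
  set Z : (V → ℝ) × (Sym2 V → ℝ) → ℝ := fun p => ∑ K ∈ powersetCard r univ, Phi p.2 p.1 K with hZ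
  set Psi : (V → ℝ) × (Sym2 V → ℝ) → ℝ := fun p => Real.log (Z p) - ∑ u, T1 u * Real.log (p.1 u)
    - ∑ e ∈ G.edgeFinset, T2 e * Real.log (p.2 e) with hPsi
  have hcomp : IsCompact ((Set.Icc lo hi) ×ˢ (Set.Icc ylo yhi)) :=
    isCompact_Icc.prod isCompact_Icc
  have hbox : ∀ z Y, (z, Y) ∈ ((Set.Icc lo hi) ×ˢ (Set.Icc ylo yhi)) ↔
      (∀ u, lo u ≤ z u ∧ z u ≤ hi u) ∧ (∀ e, ylo e ≤ Y e ∧ Y e ≤ yhi e) := by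
    intro z Y
    simp only [Set.mem_prod, Set.mem_Icc, Pi.le_def, forall_and]
  have hne : ((Set.Icc lo hi) ×ˢ (Set.Icc ylo yhi)).Nonempty :=
    ⟨(lo, ylo), (hbox _ _).mpr ⟨fun u => ⟨le_rfl, hlohi u⟩, fun e => ⟨le_rfl, hylohi e⟩⟩⟩
  have hZc : Continuous Z := by
    simp only [hZ, Phi]
    fun_prop
  have hcont : ContinuousOn Psi ((Set.Icc lo hi) ×ˢ (Set.Icc ylo yhi)) := by
    refine ContinuousOn.sub (ContinuousOn.sub ?_ ?_) ?_
    · refine hZc.continuousOn.log ?_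
      rintro ⟨z, Y⟩ hp
      exact (hpos z Y ((hbox z Y).mp hp).1 ((hbox z Y).mp hp).2).ne.symm
    · refine continuousOn_finsetSum _ fun u _ => ContinuousOn.mul continuousOn_const ?_
      refine ContinuousOn.log (by fun_prop) ?_
      rintro ⟨z, Y⟩ hp
      exact ((hlo u).trans_le (((hbox z Y).mp hp).1 u).1).ne'
    · refine continuousOn_finsetSum _ fun e he => ContinuousOn.mul continuousOn_const ?_
      refine ContinuousOn.log (by fun_prop) ?_
      rintro ⟨z, Y⟩ hp
      exact ((hypos e (SimpleGraph.mem_edgeFinset.mp he)).trans_le (((hbox z Y).mp hp).2 e).1).ne'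
  obtain ⟨⟨z, Y⟩, hmem, hmin⟩ := hcomp.exists_isMinOn hne hcont
  obtain ⟨hz, hY⟩ := (hbox z Y).mp hmem
  have hzpos : ∀ u, 0 < z u := fun u => (hlo u).trans_le (hz u).1
  have hYpos : ∀ e ∈ G.edgeSet, 0 < Y e := fun e he => (hypos e he).trans_le (hY e).1
  have hY0 : ∀ e, 0 ≤ Y e := fun e => (hy0 e).trans (hY e).1
  have hZ0 : 0 < Z (z, Y) := hpos z Y hz hY
  have hPhi0 : ∀ K, 0 ≤ Phi Y z K := fun K => Phi_nonneg Y hY0 z (fun u => (hzpos u).le) K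
  -- vertex perturbation
  have hvert : ∀ u s, 0 < s → lo u ≤ s * z u → s * z u ≤ hi u →
      T1 u * Real.log s ≤ Real.log (1 + (s - 1) *
        ((∑ K ∈ (powersetCard r univ).filter (fun K => u ∈ K), Phi Y z K) / Z (z, Y))) := by
    intro u s hs h1 h2
    have hb1 : ∀ x, lo x ≤ Function.update z u (s * z u) x ∧
        Function.update z u (s * z u) x ≤ hi x := by
      intro x
      by_cases hx : x = u
      · subst hx; simp [h1, h2]
      · simp only [Function.update_of_ne hx]; exact hz x
    have hm := hmin ((hbox _ _).mpr ⟨hb1, hY⟩)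
    have hZn : 0 < Z (Function.update z u (s * z u), Y) := hpos _ _ hb1 hY
    have hZe : Z (Function.update z u (s * z u), Y) = Z (z, Y) + (s - 1) *
        ∑ K ∈ (powersetCard r univ).filter (fun K => u ∈ K), Phi Y z K := by
      simp only [hZ, Phi_scale_vertex]
      exact sum_scale _ _ _ _
    have hlogd : Real.log (1 + (s - 1) *
        ((∑ K ∈ (powersetCard r univ).filter (fun K => u ∈ K), Phi Y z K) / Z (z, Y))) =
        Real.log (Z (Function.update z u (s * z u), Y)) - Real.log (Z (z, Y)) := by
      rw [← Real.log_div hZn.ne' hZ0.ne', hZe]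
      congr 1
      field_simp
    rw [hlogd]
    change Psi (z, Y) ≤ Psi (Function.update z u (s * z u), Y) at hm
    simp only [hPsi] at hm
    rw [sum_log_update univ T1 z u (mem_univ u) s hs (hzpos u)] at hm
    linarith
  have hedge : ∀ u v s, G.Adj u v → 0 < s → ylo s(u, v) ≤ s * Y s(u, v) →
      s * Y s(u, v) ≤ yhi s(u, v) →
      T2 s(u, v) * Real.log s ≤ Real.log (1 + (s - 1) *
        ((∑ K ∈ (powersetCard r univ).filter (fun K => u ∈ K ∧ v ∈ K), Phi Y z K) / Z (z, Y))) := by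
    intro u v s huv hs h1 h2
    have hb1 : ∀ x, ylo x ≤ Function.update Y s(u, v) (s * Y s(u, v)) x ∧
        Function.update Y s(u, v) (s * Y s(u, v)) x ≤ yhi x := by
      intro x
      by_cases hx : x = s(u, v)
      · subst hx; simp [h1, h2]
      · simp only [Function.update_of_ne hx]; exact hY x
    have hm := hmin ((hbox _ _).mpr ⟨hz, hb1⟩)
    have hZn : 0 < Z (z, Function.update Y s(u, v) (s * Y s(u, v))) := hpos _ _ hz hb1
    have hZe : Z (z, Function.update Y s(u, v) (s * Y s(u, v))) = Z (z, Y) + (s - 1) *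
        ∑ K ∈ (powersetCard r univ).filter (fun K => u ∈ K ∧ v ∈ K), Phi Y z K := by
      simp only [hZ, Phi_scale_edge Y z u v huv.ne]
      exact sum_scale _ _ _ _
    have hlogd : Real.log (1 + (s - 1) *
        ((∑ K ∈ (powersetCard r univ).filter (fun K => u ∈ K ∧ v ∈ K), Phi Y z K) / Z (z, Y))) =
        Real.log (Z (z, Function.update Y s(u, v) (s * Y s(u, v)))) - Real.log (Z (z, Y)) := by
      rw [← Real.log_div hZn.ne' hZ0.ne', hZe]
      congr 1
      field_simp
    rw [hlogd]
    have hme : s(u, v) ∈ G.edgeFinset := by simpa using huv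
    change Psi (z, Y) ≤ Psi (z, Function.update Y s(u, v) (s * Y s(u, v))) at hm
    simp only [hPsi] at hm
    rw [sum_log_update G.edgeFinset T2 Y s(u, v) hme s hs (hYpos _ (by simpa using huv))] at hm
    linarith
  have hsub : ∀ (p : Finset V → Prop) [DecidablePred p],
      0 ≤ (∑ K ∈ (powersetCard r univ).filter p, Phi Y z K) / Z (z, Y) ∧
      (∑ K ∈ (powersetCard r univ).filter p, Phi Y z K) / Z (z, Y) ≤ 1 := by
    intro p _
    refine ⟨div_nonneg (sum_nonneg fun K _ => hPhi0 K) hZ0.le, ?_⟩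
    rw [div_le_one hZ0]
    exact sum_le_sum_of_subset_of_nonneg (filter_subset _ _) fun K _ _ => hPhi0 K
  -- generic scaling facts
  have up : ∀ (x hh : ℝ), 0 < x → x < hh → ∀ s, 1 < s → s < 1 + (hh - x) / x →
      x ≤ s * x ∧ s * x ≤ hh := by
    intro x hh hx hxh s h1 h2
    refine ⟨le_mul_of_one_le_left hx.le h1.le, ?_⟩
    have : s - 1 < (hh - x) / x := by linarith
    rw [lt_div_iff₀ hx] at this
    linarith
  have dn : ∀ (x ll : ℝ), 0 < x → ll < x → 0 < ll → ∀ s, 1 - (x - ll) / x < s → s < 1 →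
      0 < s ∧ ll ≤ s * x ∧ s * x ≤ x := by
    intro x ll hx hxh hl s h1 h2
    have h3 : 1 - s < (x - ll) / x := by linarith
    rw [lt_div_iff₀ hx] at h3
    have h4 : ll < s * x := by linarith
    have h5 : 0 < s := by
      by_contra hh
      push Not at hh
      have := mul_nonpos_of_nonpos_of_nonneg hh hx.le
      linarith
    exact ⟨h5, h4.le, mul_le_of_le_one_left hx.le h2.le⟩
  refine ⟨z, Y, hz, hY, ?_, ?_, ?_, ?_⟩
  · intro u hu
    rw [← le_div_iff₀ hZ0]
    refine kkt_up _ _ ((hi u - z u) / z u) (div_pos (by linarith) (hzpos u)) (hsub (fun K => u ∈ K)).1 (hT1 u) ?_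
    intro s h1 h2
    have := up (z u) (hi u) (hzpos u) hu s h1 h2
    exact hvert u s (by linarith) ((hz u).1.trans this.1) this.2
  · intro u hu
    rw [← div_le_iff₀ hZ0]
    refine kkt_down _ _ ((z u - lo u) / z u) (div_pos (by linarith) (hzpos u)) ?_ (hsub (fun K => u ∈ K)).1
      (hsub (fun K => u ∈ K)).2 (hT1 u) ?_
    · rw [div_le_one (hzpos u)]; linarith [hlo u]
    intro s h1 h2
    have := dn (z u) (lo u) (hzpos u) hu (hlo u) s h1 h2
    exact hvert u s this.1 this.2.1 (this.2.2.trans (hz u).2)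
  · intro u v huv hu
    rw [← le_div_iff₀ hZ0]
    have hyp := hYpos s(u, v) (by simpa using huv)
    refine kkt_up _ _ ((yhi s(u, v) - Y s(u, v)) / Y s(u, v)) (div_pos (by linarith) hyp)
      (hsub (fun K => u ∈ K ∧ v ∈ K)).1 (hT2 _) ?_
    intro s h1 h2
    have := up _ _ hyp hu s h1 h2
    exact hedge u v s huv (by linarith) ((hY _).1.trans this.1) this.2
  · intro u v huv hu
    rw [← div_le_iff₀ hZ0]
    have hyp := hYpos s(u, v) (by simpa using huv)
    have hlp := hypos s(u, v) (by simpa using huv)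
    refine kkt_down _ _ ((Y s(u, v) - ylo s(u, v)) / Y s(u, v)) (div_pos (by linarith) hyp) ?_
      (hsub (fun K => u ∈ K ∧ v ∈ K)).1 (hsub (fun K => u ∈ K ∧ v ∈ K)).2 (hT2 _) ?_
    · rw [div_le_one hyp]; linarith
    intro s h1 h2
    have := dn _ _ hyp hu hlp s h1 h2
    exact hedge u v s huv this.1 this.2.1 (this.2.2.trans (hY _).2)

end part3a

section part3b
variable {V : Type*} [Fintype V]

theorem vertex_step (N T z lam q τ : V → ℝ) (Λ ζ θ Q L : ℝ)
    (hsum : ∑ u, N u = ∑ u, T u) (hlam : ∀ u, 0 < lam u)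
    (hz : ∀ u, lam u ≤ z u ∧ z u ≤ Λ * lam u)
    (hup : ∀ u, z u < Λ * lam u → T u ≤ N u) (hlo : ∀ u, lam u < z u → N u ≤ T u)
    (hN : ∀ u, N u = z u * q u) (hq : ∀ u, (1 - ζ) * Q ≤ q u ∧ q u ≤ Q)
    (hT : ∀ u, T u = lam u * τ u) (hτ : ∀ u, (1 - θ) * L ≤ τ u ∧ τ u ≤ L)
    (hL : 0 ≤ L) (hΛ0 : 0 < Λ * (1 - ζ))
    (hΛ : 1 ≤ Λ * (1 - ζ) * (1 - θ)) : ∀ u, N u = T u := by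
  by_contra hcon
  push Not at hcon
  obtain ⟨u0, hu0⟩ := hcon
  have hex1 : ∃ u, N u < T u := by
    by_contra h
    push Not at h
    have := (sum_eq_sum_iff_of_le (fun i _ => h i)).mp hsum.symm u0 (mem_univ _)
    exact hu0 this.symm
  have hex2 : ∃ u, T u < N u := by
    by_contra h
    push Not at h
    exact hu0 ((sum_eq_sum_iff_of_le (fun i _ => h i)).mp hsum u0 (mem_univ _))
  obtain ⟨u, hu⟩ := hex1
  obtain ⟨v, hv⟩ := hex2
  have hzu : z u = Λ * lam u := by
    by_contra h
    have := hup u (lt_of_le_of_ne (hz u).2 h)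
    linarith
  have hzv : z v = lam v := by
    by_contra h
    have := hlo v (lt_of_le_of_ne (hz v).1 (Ne.symm h))
    linarith
  rw [hN, hT, hzu] at hu
  rw [hN, hT, hzv] at hv
  have h1 : Λ * q u < L := by
    have : lam u * (Λ * q u) < lam u * L := by
      calc _ = Λ * lam u * q u := by ring
        _ < lam u * τ u := hu
        _ ≤ _ := mul_le_mul_of_nonneg_left (hτ u).2 (hlam u).le
    exact lt_of_mul_lt_mul_left this (hlam u).le
  have h2 : (1 - θ) * L < Q := by
    have : lam v * ((1 - θ) * L) < lam v * Q :=
      calc _ ≤ lam v * τ v := mul_le_mul_of_nonneg_left (hτ v).1 (hlam v).le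
        _ < lam v * q v := hv
        _ ≤ _ := mul_le_mul_of_nonneg_left (hq v).2 (hlam v).le
    exact lt_of_mul_lt_mul_left this (hlam v).le
  have hΛ1 : 0 < Λ := by
    have := (hlam u).trans_le ((hz u).1.trans (hz u).2)
    by_contra hh
    push Not at hh
    have := mul_nonpos_of_nonpos_of_nonneg hh (hlam u).le
    linarith
  have h3 : Λ * ((1 - ζ) * Q) ≤ Λ * q u := mul_le_mul_of_nonneg_left (hq u).1 hΛ1.le
  have h4 : Λ * (1 - ζ) * ((1 - θ) * L) < Λ * (1 - ζ) * Q := mul_lt_mul_of_pos_left h2 hΛ0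
  nlinarith

theorem edge_step (G : SimpleGraph V) (N T y E ℓ b R : V → V → ℝ) (β lam : V → ℝ) (τ E0 : ℝ)
    (hNs : ∀ u v, N u v = N v u) (hTs : ∀ u v, T u v = T v u)
    (hsum : ∀ u, ∑ v ∈ univ.filter (fun v => G.Adj u v), N u v =
      ∑ v ∈ univ.filter (fun v => G.Adj u v), T u v)
    (hβ : ∀ u, 0 < β u) (hlam : ∀ u, 0 < lam u) (hE0 : E0 < 1)
    (hN : ∀ u v, G.Adj u v → N u v = y u v * (β u * β v) * R u v)
    (hR : ∀ u v, G.Adj u v → 1 - E u v ≤ R u v ∧ R u v ≤ 1 + E u v)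
    (hT : ∀ u v, G.Adj u v → T u v = τ * (lam u * lam v / b u v))
    (hb : ∀ u v, G.Adj u v → 0 < b u v)
    (hy : ∀ u v, G.Adj u v → 1 - ℓ u v ≤ y u v ∧ y u v ≤ 1)
    (hℓ : ∀ u v, G.Adj u v → ℓ u v ≤ 1)
    (hup : ∀ u v, G.Adj u v → y u v < 1 → T u v ≤ N u v)
    (hlo : ∀ u v, G.Adj u v → 1 - ℓ u v < y u v → N u v ≤ T u v)
    (h1 : ∀ u v, G.Adj u v → (1 - ℓ u v) * (1 + E u v) * b u v ≤ 1 - E0)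
    (h2 : ∀ u v, G.Adj u v → 1 - E0 ≤ (1 - E u v) * b u v) :
    ∀ u v, G.Adj u v → N u v = T u v := by
  have exlow : ∀ u v, G.Adj u v → N u v ≠ T u v → ∃ w, G.Adj u w ∧ N u w < T u w := by
    intro u v huv hne
    by_contra h
    push Not at h
    have := (sum_eq_sum_iff_of_le (fun i hi => h i (mem_filter.mp hi).2)).mp (hsum u).symm v
      (by simp [huv])
    exact hne this.symm
  have exhigh : ∀ u v, G.Adj u v → N u v ≠ T u v → ∃ w, G.Adj u w ∧ T u w < N u w := by
    intro u v huv hne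
    by_contra h
    push Not at h
    exact hne ((sum_eq_sum_iff_of_le (fun i hi => h i (mem_filter.mp hi).2)).mp (hsum u) v
      (by simp [huv]))
  by_contra hcon
  push Not at hcon
  obtain ⟨u0, v0, huv0, hne0⟩ := hcon
  obtain ⟨w0, hw0, hlt0⟩ := exlow u0 v0 huv0 hne0
  set Bad := univ.filter (fun u => ∃ w, G.Adj u w ∧ N u w < T u w) with hBad
  have hBne : Bad.Nonempty := ⟨u0, by simp [hBad]; exact ⟨w0, hw0, hlt0⟩⟩
  obtain ⟨v, hv, hmin⟩ := exists_min_image Bad (fun u => β u / lam u) hBne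
  obtain ⟨x, hx, hxlt⟩ := (mem_filter.mp hv).2
  obtain ⟨w, hvw, hwlt⟩ := exhigh v x hx hxlt.ne
  have hwv : G.Adj w v := hvw.symm
  obtain ⟨v2, hwv2, hv2lt⟩ := exlow w v hwv (by rw [hNs w v, hTs w v]; exact hwlt.ne')
  have hv2B : v2 ∈ Bad := by
    rw [hBad, mem_filter]
    exact ⟨mem_univ _, w, hwv2.symm, by rw [hNs v2 w, hTs v2 w]; exact hv2lt⟩
  have hm := hmin v2 hv2B
  have yvw : y v w = 1 - ℓ v w := by
    by_contra h
    have := hlo v w hvw (lt_of_le_of_ne (hy v w hvw).1 (Ne.symm h))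
    linarith
  have ywv2 : y w v2 = 1 := by
    by_contra h
    have := hup w v2 hwv2 (lt_of_le_of_ne (hy w v2 hwv2).2 h)
    linarith
  have A1 : τ * (lam v * lam w) < (1 - E0) * (β v * β w) := by
    rw [hN v w hvw, hT v w hvw, yvw] at hwlt
    have hbp := hb v w hvw
    have hbb : 0 < β v * β w := mul_pos (hβ v) (hβ w)
    calc τ * (lam v * lam w) = τ * (lam v * lam w / b v w) * b v w := by field_simp
      _ < (1 - ℓ v w) * (β v * β w) * R v w * b v w := mul_lt_mul_of_pos_right hwlt hbp
      _ ≤ (1 - ℓ v w) * (β v * β w) * (1 + E v w) * b v w := by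
          apply mul_le_mul_of_nonneg_right _ hbp.le
          apply mul_le_mul_of_nonneg_left (hR v w hvw).2
          exact mul_nonneg (by linarith [hℓ v w hvw]) hbb.le
      _ = (1 - ℓ v w) * (1 + E v w) * b v w * (β v * β w) := by ring
      _ ≤ _ := mul_le_mul_of_nonneg_right (h1 v w hvw) hbb.le
  have A2 : (1 - E0) * (β w * β v2) < τ * (lam w * lam v2) := by
    rw [hN w v2 hwv2, hT w v2 hwv2, ywv2] at hv2lt
    have hbp := hb w v2 hwv2
    have hbb : 0 < β w * β v2 := mul_pos (hβ w) (hβ v2)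
    calc (1 - E0) * (β w * β v2) ≤ (1 - E w v2) * b w v2 * (β w * β v2) :=
          mul_le_mul_of_nonneg_right (h2 w v2 hwv2) hbb.le
      _ = (β w * β v2) * (1 - E w v2) * b w v2 := by ring
      _ ≤ (β w * β v2) * R w v2 * b w v2 := by
          apply mul_le_mul_of_nonneg_right _ hbp.le
          exact mul_le_mul_of_nonneg_left (hR w v2 hwv2).1 hbb.le
      _ < τ * (lam w * lam v2 / b w v2) * b w v2 := by
          apply mul_lt_mul_of_pos_right _ hbp
          linarith
      _ = _ := by field_simp
  rw [div_le_div_iff₀ (hlam v) (hlam v2)] at hm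
  -- β v * lam v2 ≤ β v2 * lam v
  have B1 : τ * (lam v * lam w) * lam v2 < (1 - E0) * (β v * β w) * lam v2 :=
    mul_lt_mul_of_pos_right A1 (hlam v2)
  have B2 : (1 - E0) * (β w * β v2) * lam v < τ * (lam w * lam v2) * lam v :=
    mul_lt_mul_of_pos_right A2 (hlam v)
  have B3 : (1 - E0) * β w * (β v * lam v2) ≤ (1 - E0) * β w * (β v2 * lam v) :=
    mul_le_mul_of_nonneg_left hm (mul_nonneg (by linarith) (hβ w).le)
  nlinarith

set_option maxHeartbeats 1000000 in
theorem gibbs (G : SimpleGraph V) [Nonempty V] (k : ℕ) (lam : V → ℝ) (A1 Λ : ℝ)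
    (hlam1 : ∀ u, 1 ≤ lam u) (hlamA : ∀ u, lam u ≤ A1) (hΛ1 : 1 ≤ Λ)
    (b ℓ : V → V → ℝ) (hbs : ∀ u v, b u v = b v u) (hℓs : ∀ u v, ℓ u v = ℓ v u)
    (hℓ0 : ∀ u v, 0 ≤ ℓ u v) (hℓ1 : ∀ u v, ℓ u v < 1)
    (hb : ∀ u v, 0 < b u v)
    (g n0 ζ c : ℝ) (hg0 : 0 ≤ g)
    (hn0 : 0 < n0) (hn : n0 ≤ (Fintype.card V : ℝ) - ((k + 2 : ℕ) : ℝ) * (Λ * A1 * g))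
    (hc0 : 0 ≤ c) (hc : Λ * A1 * g ≤ c * ((1 - ζ) * n0)) (hcζ : ((k + 2 : ℕ) : ℝ) * c ≤ ζ)
    (hζ : ζ < 1)
    (M E ε e1 : V → V → ℝ) (e2 E0 : ℝ) (hE : ∀ u v, 0 ≤ E u v)
    (hM : ∀ u v, G.Adj u v → ℓ u v + E u v ≤ M u v)
    (hMn : ∀ u v, ¬ G.Adj u v → 1 ≤ M u v) (hM0 : ∀ u v, 0 ≤ M u v)
    (hMg : ∀ u, ∑ a, M u a ≤ g) (hε0 : ∀ u v, 0 ≤ ε u v) (hε1 : ∀ u v, ε u v ≤ 1)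
    (hεE : ∀ u v, (1 + ε u v) ^ (k + 2) ≤ 1 + E u v)
    (hεE' : ∀ u v, 1 - E u v ≤ (1 - ε u v) ^ (k + 2))
    (he2 : e2 ≤ 1) (he20 : 0 ≤ e2) (he2g : Λ * A1 * g ≤ e2 * ((1 - ζ) * n0))
    (he1 : ∀ u v, Λ * A1 * ∑ a, M u a * M v a ≤ e1 u v * ((1 - ζ) * n0))
    (hee : ∀ u v, e1 u v + e2 ^ 2 ≤ ε u v * (1 - e2) ^ 2)
    (θ : ℝ) (hΛ : 1 ≤ Λ * (1 - ζ) * (1 - θ))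
    (hτ : ∀ u, (1 - θ) * ∑ v, lam v ≤ ∑ v ∈ univ.filter (fun v => G.Adj u v), lam v / b u v ∧
      ∑ v ∈ univ.filter (fun v => G.Adj u v), lam v / b u v ≤ ∑ v, lam v)
    (hE01 : E0 < 1)
    (h1 : ∀ u v, G.Adj u v → (1 - ℓ u v) * (1 + E u v) * b u v ≤ 1 - E0)
    (h2 : ∀ u v, G.Adj u v → 1 - E0 ≤ (1 - E u v) * b u v) :
    ∃ w : Finset V → ℝ, (∀ s, 0 ≤ w s) ∧ ∀ u v : V, G.Adj u v →
      ∑ s ∈ univ.filter (fun s : Finset V => G.IsNClique (k + 2) s ∧ u ∈ s ∧ v ∈ s), w s =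
        lam u * lam v / b u v := by
  have hlam0 : ∀ u, 0 < lam u := fun u => by linarith [hlam1 u]
  obtain ⟨x0⟩ := ‹Nonempty V›
  have hA1 : 0 ≤ A1 := by linarith [hlam1 x0, hlamA x0]
  have hP : 0 ≤ Λ * A1 := mul_nonneg (by linarith) hA1
  -- lift
  set yloS : Sym2 V → ℝ := Sym2.lift ⟨fun u v => if G.Adj u v then 1 - ℓ u v else 0, by
    intro u v; simp only [G.adj_comm u v, hℓs u v]⟩ with hyloS
  set yhiS : Sym2 V → ℝ := Sym2.lift ⟨fun u v => if G.Adj u v then 1 else 0, by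
    intro u v; simp only [G.adj_comm u v]⟩ with hyhiS
  have ylo_mk : ∀ u v, yloS s(u, v) = if G.Adj u v then 1 - ℓ u v else 0 := fun u v => rfl
  have yhi_mk : ∀ u v, yhiS s(u, v) = if G.Adj u v then 1 else 0 := fun u v => rfl
  set L := ∑ v, lam v with hL
  set τ0 : V → ℝ := fun u => ∑ v ∈ univ.filter (fun v => G.Adj u v), lam v / b u v with hτ0
  have hL0 : 0 < L := sum_pos (fun u _ => hlam0 u) ⟨x0, mem_univ _⟩
  have hΛζ : 0 < Λ * (1 - ζ) := mul_pos (by linarith) (by linarith)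
  have hθ : 0 < 1 - θ := by
    by_contra h
    push Not at h
    have := mul_nonpos_of_nonneg_of_nonpos hΛζ.le h
    linarith
  have hτpos : ∀ u, 0 < τ0 u := fun u => lt_of_lt_of_le (mul_pos hθ hL0) (hτ u).1
  set D := ∑ u, lam u * τ0 u with hD
  have hD0 : 0 < D := sum_pos (fun u _ => mul_pos (hlam0 u) (hτpos u)) ⟨x0, mem_univ _⟩
  set σ : ℝ := ((k : ℝ) + 2) * (k + 1) / D with hσ
  have hσ0 : 0 < σ := div_pos (by positivity) hD0
  set T2 : Sym2 V → ℝ := Sym2.lift ⟨fun u v => σ * (lam u * lam v / b u v), by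
    intro u v; simp only [hbs u v, mul_comm (lam u)]⟩ with hT2
  have T2_mk : ∀ u v, T2 s(u, v) = σ * (lam u * lam v / b u v) := fun u v => rfl
  set T1 : V → ℝ := fun u => lam u * (σ * τ0 u / (k + 1)) with hT1
  -- facts on the box
  have facts : ∀ (z : V → ℝ) (Y : Sym2 V → ℝ), (∀ u, lam u ≤ z u ∧ z u ≤ Λ * lam u) →
      (∀ e, yloS e ≤ Y e ∧ Y e ≤ yhiS e) →
      (∀ a, Y s(a, a) = 0) ∧ (∀ u v, ¬ G.Adj u v → Y s(u, v) = 0) ∧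
      (∀ u v, 0 ≤ Y s(u, v)) ∧ (∀ u v, Y s(u, v) ≤ 1) ∧
      (∀ u v, G.Adj u v → 1 - ℓ u v ≤ Y s(u, v)) ∧
      (∀ w, ∑ a, (1 - Y s(w, a)) ≤ g) ∧ FF (Λ * A1) g 0 z := by
    intro z Y hz hY
    have c1 : ∀ u v, ¬ G.Adj u v → Y s(u, v) = 0 := by
      intro u v h
      have := hY s(u, v)
      rw [ylo_mk, yhi_mk, if_neg h, if_neg h] at this
      exact le_antisymm this.2 this.1
    have c2 : ∀ u v, G.Adj u v → 1 - ℓ u v ≤ Y s(u, v) ∧ Y s(u, v) ≤ 1 := by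
      intro u v h
      have := hY s(u, v)
      rwa [ylo_mk, yhi_mk, if_pos h, if_pos h] at this
    have c3 : ∀ u v, 0 ≤ Y s(u, v) := by
      intro u v
      by_cases h : G.Adj u v
      · linarith [(c2 u v h).1, hℓ1 u v]
      · rw [c1 u v h]
    have c4 : ∀ u v, Y s(u, v) ≤ 1 := by
      intro u v
      by_cases h : G.Adj u v
      · exact (c2 u v h).2
      · rw [c1 u v h]; norm_num
    refine ⟨fun a => c1 a a (G.loopless.irrefl a), c1, c3, c4, fun u v h => (c2 u v h).1, ?_, ?_⟩
    · intro w
      refine le_trans (sum_le_sum fun a _ => ?_) (hMg w)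
      by_cases h : G.Adj w a
      · linarith [(c2 w a h).1, hM w a h, hE w a]
      · rw [c1 w a h]; linarith [hMn w a h]
    · refine ⟨fun a => ⟨(hlam0 a).le.trans (hz a).1, (hz a).2.trans ?_⟩, ?_⟩
      · exact mul_le_mul_of_nonneg_left (hlamA a) (by linarith)
      · have : ∑ a : V, (1 : ℝ) ≤ ∑ a, z a := sum_le_sum fun a _ => (hlam1 a).trans (hz a).1
        simpa using this
  have hpos : ∀ z Y, (∀ u, lam u ≤ z u ∧ z u ≤ Λ * lam u) → (∀ e, yloS e ≤ Y e ∧ Y e ≤ yhiS e) →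
      0 < ∑ K ∈ powersetCard (k + 2) univ, Phi Y z K := by
    intro z Y hz hY
    obtain ⟨f1, f2, f3, f4, f5, f6, f7⟩ := facts z Y hz hY
    have := (lem1 (fun u v => Y s(u, v)) f3 f4 (Λ * A1) g n0 ζ c (k + 2) hP hg0 f6 hn0 hn hc0 hc
      hcζ hζ (k + 2) 0 z f7 (by omega)).1
    rw [ZZ_eq Y f1] at this
    exact pos_of_mul_pos_right this (by positivity)
  obtain ⟨z, Y, hz, hY, kv1, kv2, ke1, ke2⟩ := exists_min G (k + 2) lam (fun u => Λ * lam u)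
    yloS yhiS hlam0 (fun u => by nlinarith [hlam0 u])
    (by
      intro e
      induction e with
      | _ u v =>
        rw [ylo_mk, yhi_mk]
        split_ifs
        · linarith [hℓ0 u v]
        · exact le_rfl)
    (by
      intro e
      induction e with
      | _ u v =>
        intro h
        have h : G.Adj u v := h
        rw [ylo_mk, if_pos h]
        linarith [hℓ1 u v])
    (by
      intro e
      induction e with
      | _ u v =>
        rw [ylo_mk]
        split_ifs
        · linarith [hℓ1 u v]
        · exact le_rfl)
    T1 T2 (fun u => mul_nonneg (hlam0 u).le (div_nonneg (mul_nonneg hσ0.le (hτpos u).le) (by positivity)))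
    (by
      intro e
      induction e with
      | _ u v =>
        rw [T2_mk]
        exact mul_nonneg hσ0.le (div_nonneg (mul_nonneg (hlam0 u).le (hlam0 v).le) (hb u v).le))
    hpos
  obtain ⟨f1, f2, f3, f4, f5, f6, f7⟩ := facts z Y hz hY
  have Zp := hpos z Y hz hY
  set Z := ∑ K ∈ powersetCard (k + 2) univ, Phi Y z K with hZ
  set N1 : V → ℝ := fun u => ∑ K ∈ (powersetCard (k + 2) univ).filter (fun K => u ∈ K), Phi Y z K
    with hN1
  set N2 : V → V → ℝ := fun u v =>
    ∑ K ∈ (powersetCard (k + 2) univ).filter (fun K => u ∈ K ∧ v ∈ K), Phi Y z K with hN2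
  set y : V → V → ℝ := fun u v => Y s(u, v) with hy
  have L1 := lem1 y f3 f4 (Λ * A1) g n0 ζ c (k + 2) hP hg0 f6 hn0 hn hc0 hc hcζ hζ
  have L2 := lem2 y f3 f4 (Λ * A1) g n0 ζ c (k + 2) hP hg0 f6 hn0 hn hc0 hc hcζ hζ M E ε e1 e2 hM0
    (by
      intro u a
      by_cases h : G.Adj u a
      · have q1 : 1 - ℓ u a ≤ y u a := f5 u a h
        have q2 := hM u a h
        have q3 := hE u a
        have q4 := f4 u a
        change y u a ≤ 1 at q4
        nlinarith
      · have : y u a = 0 := f2 u a h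
        rw [this]; linarith [hMn u a h])
    (by
      intro u a
      by_cases h : G.Adj u a
      · have q2 := hM u a h
        have q3 := hE u a
        have q4 : y u a ≤ 1 := f4 u a
        have q5 := hℓ0 u a
        nlinarith
      · have : y u a = 0 := f2 u a h
        rw [this]; linarith [hMn u a h])
    hMg hε0 hε1 hεE hεE' he2 he20 he2g he1 hee k 0 z f7 (by omega)
  -- vertex step
  have hN1e : ∀ u, N1 u = z u * (ZZ y (k + 1) (fun x => z x * y u x) / ((k + 1).factorial : ℝ)) := by
    intro u
    have hf : ((k + 1).factorial : ℝ) ≠ 0 := by positivity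
    have := N1_eq Y f1 z (k + 1) u
    rw [mul_div_assoc', eq_div_iff hf, ← this]; ring
  have hsumN : ∑ u, N1 u = ((k : ℝ) + 2) * Z := by
    have := sum_count (Phi Y z) (k + 2)
    rw [hN1, this]; push_cast; ring
  have hsumT : ∑ u, T1 u * Z = ((k : ℝ) + 2) * Z := by
    rw [← sum_mul]
    congr 1
    have : ∀ u, T1 u = (σ / (k + 1)) * (lam u * τ0 u) := by intro u; simp only [hT1]; ring
    simp_rw [this]
    rw [← mul_sum, ← hD, hσ]
    field_simp
  have hV := vertex_step N1 (fun u => T1 u * Z) z lam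
    (fun u => ZZ y (k + 1) (fun x => z x * y u x) / ((k + 1).factorial : ℝ))
    (fun u => σ * τ0 u / (k + 1) * Z) Λ ζ θ (ZZ y (k + 1) z / ((k + 1).factorial : ℝ))
    (σ * L / (k + 1) * Z) (by rw [hsumN, hsumT]) hlam0 hz kv1 kv2 hN1e
    (by
      intro u
      have hf : (0 : ℝ) < ((k + 1).factorial : ℝ) := by positivity
      constructor
      · rw [mul_div_assoc', div_le_div_iff_of_pos_right hf]
        exact (L1 (k + 1) 0 z f7 (by omega)).2.1 u
      · rw [div_le_div_iff_of_pos_right hf]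
        exact ZZ_mono y f3 (k + 1) _ _ (fun x => mul_nonneg (f7.1 x).1 (f3 u x))
          (fun x => mul_le_of_le_one_right (f7.1 x).1 (f4 u x)))
    (by intro u; simp only [hT1]; ring)
    (by
      intro u
      have hc : 0 ≤ σ / (k + 1) * Z := by positivity
      have q1 := mul_le_mul_of_nonneg_left (hτ u).1 hc
      have q2 := mul_le_mul_of_nonneg_left (hτ u).2 hc
      constructor
      · calc _ = σ / (k + 1) * Z * ((1 - θ) * L) := by ring
          _ ≤ _ := q1
          _ = _ := by simp only [hτ0]; ring
      · calc _ = σ / (k + 1) * Z * τ0 u := by ring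
          _ ≤ _ := q2
          _ = _ := by ring)
    (by positivity) hΛζ hΛ
  -- edge step
  have hX : 0 < ZZ y k z := (L1 k 0 z f7 (by omega)).1
  have hBp : ∀ u, 0 < ZZ y k (fun x => z x * y u x) := fun u =>
    (L1 k 1 _ (FF_pin y f3 f4 (Λ * A1) g hP f6 0 z f7 u) (by omega)).1
  have hzp : ∀ u, 0 < z u := fun u => (hlam0 u).trans_le (hz u).1
  set B : V → ℝ := fun u => ZZ y k (fun x => z x * y u x) with hB
  have hkf : (0 : ℝ) < (k.factorial : ℝ) := by positivity
  set ρ : ℝ := Real.sqrt (1 / (ZZ y k z * k.factorial)) with hρ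
  have hρ2 : ρ * ρ = 1 / (ZZ y k z * k.factorial) := Real.mul_self_sqrt (by positivity)
  have hρ0 : 0 < ρ := Real.sqrt_pos.mpr (by positivity)
  have hEs := edge_step G N2 (fun u v => T2 s(u, v) * Z) y E ℓ b
    (fun u v => ZZ y k (fun x => z x * y u x * y v x) * ZZ y k z / (B u * B v))
    (fun u => ρ * (z u * B u)) lam (σ * Z) E0
    (by intro u v; simp only [hN2]; congr 1; ext K; simp only [mem_filter, and_comm (a := u ∈ K)])
    (by intro u v; simp only [Sym2.eq_swap])
    (by
      intro u
      have q1 : ∑ v ∈ univ.filter (fun v => G.Adj u v), N2 u v =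
          ∑ v ∈ univ.filter (fun v => v ≠ u), N2 u v := by
        refine sum_subset ?_ ?_
        · intro v hv
          simp only [mem_filter, mem_univ, true_and] at hv ⊢
          exact hv.ne'
        · intro v hv hv'
          simp only [mem_filter, mem_univ, true_and] at hv hv'
          refine sum_eq_zero fun K hK => ?_
          refine Phi_clique G Y f2 z K ?_
          intro hcl
          have := (mem_filter.mp hK).2
          exact hv' (hcl (by simpa using this.1) (by simpa using this.2) (Ne.symm hv))
      have q2 := sum_count2 (Phi Y z) (k + 1) u
      have q3 := hV u
      rw [q1]
      refine q2.trans ?_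
      change ((k + 1 : ℕ) : ℝ) * N1 u = _
      rw [q3]
      simp only [hT1, T2_mk, hτ0]
      have : ∀ v, σ * (lam u * lam v / b u v) * Z = σ * lam u * Z * (lam v / b u v) := by
        intro v; ring
      simp_rw [this]
      rw [← mul_sum]
      have hk : ((k : ℝ) + 1) ≠ 0 := by positivity
      push_cast
      field_simp)
    (fun u => mul_pos hρ0 (mul_pos (hzp u) (hBp u))) hlam0 hE01
    (by
      intro u v huv
      have q := N2_eq Y f1 z k u v huv.ne
      have hBu := (hBp u).ne'
      have hBv := (hBp v).ne'
      have q' : N2 u v = z u * z v * y u v * ZZ y k (fun x => z x * y u x * y v x) / k.factorial := by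
        rw [eq_div_iff hkf.ne', ← q]; ring
      rw [q']
      have : y u v * (ρ * (z u * B u) * (ρ * (z v * B v))) *
          (ZZ y k (fun x => z x * y u x * y v x) * ZZ y k z / (B u * B v)) =
          (ρ * ρ) * (y u v * ((z u * B u) * ((z v * B v))) *
          (ZZ y k (fun x => z x * y u x * y v x) * ZZ y k z / (B u * B v))) := by ring
      rw [this, hρ2]
      change B u ≠ 0 at hBu
      change B v ≠ 0 at hBv
      have hX' := hX.ne'
      field_simp)
    (by
      intro u v huv
      have hp : 0 < B u * B v := mul_pos (hBp u) (hBp v)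
      obtain ⟨q1, q2⟩ := L2 u v
      have hpl := hp.le
      constructor
      · rw [le_div_iff₀ hp]
        refine le_trans (mul_le_mul_of_nonneg_right ?_ hp.le) q1
        exact (hεE' u v).trans
          (pow_le_pow_of_le_one (by linarith [hε1 u v]) (by linarith [hε0 u v]) (by omega))
      · rw [div_le_iff₀ hp]
        refine le_trans q2 (mul_le_mul_of_nonneg_right ?_ hp.le)
        exact le_trans (pow_le_pow_right₀ (by linarith [hε0 u v]) (by omega)) (hεE u v))
    (by intro u v _; rw [T2_mk]; ring)
    (fun u v _ => hb u v)
    (fun u v h => ⟨f5 u v h, f4 u v⟩) (fun u v _ => (hℓ1 u v).le)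
    (by
      intro u v h hlt
      refine ke1 u v h ?_
      rw [yhi_mk, if_pos h]; exact hlt)
    (by
      intro u v h hlt
      refine ke2 u v h ?_
      rw [ylo_mk, if_pos h]; exact hlt)
    h1 h2
  have hY0 : ∀ e, 0 ≤ Y e := by
    intro e
    induction e with
    | _ u v => exact f3 u v
  refine ⟨fun K => Phi Y z K / (σ * Z), fun K => div_nonneg
    (Phi_nonneg Y hY0 z (fun u => (hzp u).le) K) (by positivity), ?_⟩
  intro u v huv
  have q1 := hEs u v huv
  rw [← sum_div, div_eq_iff (by positivity)]
  have q2 : ∑ s ∈ univ.filter (fun s : Finset V => G.IsNClique (k + 2) s ∧ u ∈ s ∧ v ∈ s),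
      Phi Y z s = N2 u v := by
    refine sum_subset ?_ ?_
    · intro K hK
      simp only [mem_filter, mem_univ, true_and, mem_powersetCard_univ] at hK ⊢
      exact ⟨hK.1.card_eq, hK.2⟩
    · intro K hK hK'
      simp only [mem_filter, mem_univ, true_and, mem_powersetCard_univ] at hK hK'
      refine Phi_clique G Y f2 z K ?_
      intro hcl
      exact hK' ⟨⟨hcl, hK.1⟩, hK.2⟩
  rw [q2, q1, T2_mk]; ring

end part3b

section part4
variable {V : Type*} [Fintype V]

noncomputable def kerStep (G : SimpleGraph V) (a c : ℝ) (M : V → V → ℝ) : V → V → ℝ :=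
  fun u v => if G.Adj u v then a * ∑ x, M u x * M v x + c else 1

theorem kernel (G : SimpleGraph V) (a c d m : ℝ) (ha : 0 ≤ a) (hc : 0 ≤ c) (hm : 0 ≤ m)
    (hd : ∀ u, ∑ v, (if G.Adj u v then (0 : ℝ) else 1) ≤ d)
    (h1 : a * m + c ≤ 1) (h2 : d + a * m ^ 2 + c * Fintype.card V ≤ m) :
    ∃ M : V → V → ℝ, (∀ u v, M u v = M v u) ∧ (∀ u v, 0 ≤ M u v) ∧ (∀ u v, M u v ≤ 1) ∧
      (∀ u, ∑ v, M u v ≤ m) ∧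
      ∀ u v, M u v = if G.Adj u v then a * ∑ x, M u x * M v x + c else 1 := by
  set It : ℕ → V → V → ℝ := fun i => (kerStep G a c)^[i] (fun _ _ => 0) with hIt
  have It0 : It 0 = fun _ _ => 0 := rfl
  have ItS : ∀ i, It (i + 1) = kerStep G a c (It i) := fun i => by
    simp only [hIt, Function.iterate_succ', Function.comp]
  have inv : ∀ i, (∀ u v, It i u v = It i v u) ∧ (∀ u v, 0 ≤ It i u v) ∧ (∀ u v, It i u v ≤ 1) ∧
      (∀ u, ∑ v, It i u v ≤ m) := by
    intro i
    induction i with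
    | zero => simp [It0, hm]
    | succ i ih =>
      obtain ⟨i1, i2, i3, i4⟩ := ih
      have hs0 : ∀ u v, 0 ≤ ∑ x, It i u x * It i v x := fun u v =>
        sum_nonneg fun x _ => mul_nonneg (i2 u x) (i2 v x)
      have hs1 : ∀ u v, ∑ x, It i u x * It i v x ≤ m := fun u v =>
        le_trans (sum_le_sum fun x _ => mul_le_of_le_one_right (i2 u x) (i3 v x)) (i4 u)
      rw [ItS]
      refine ⟨?_, ?_, ?_, ?_⟩
      · intro u v
        simp only [kerStep, G.adj_comm u v, mul_comm (It i u _)]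
      · intro u v
        simp only [kerStep]
        split_ifs
        · have := mul_nonneg ha (hs0 u v); linarith
        · norm_num
      · intro u v
        simp only [kerStep]
        split_ifs
        · have := mul_le_mul_of_nonneg_left (hs1 u v) ha; linarith
        · exact le_rfl
      · intro u
        have e1 : ∑ v, kerStep G a c (It i) u v ≤
            ∑ v, ((if G.Adj u v then (0 : ℝ) else 1) + (a * ∑ x, It i u x * It i v x + c)) := by
          refine sum_le_sum fun v _ => ?_
          simp only [kerStep]
          have := mul_nonneg ha (hs0 u v)
          split_ifs <;> linarith
        have e2 : ∑ v, ∑ x, It i u x * It i v x ≤ m ^ 2 := by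
          rw [sum_comm]
          calc ∑ x, ∑ v, It i u x * It i v x = ∑ x, It i u x * ∑ v, It i x v := by
                refine sum_congr rfl fun x _ => ?_
                rw [mul_sum]
                exact sum_congr rfl fun v _ => by rw [i1 v x]
            _ ≤ ∑ x, It i u x * m := sum_le_sum fun x _ => mul_le_mul_of_nonneg_left (i4 x) (i2 u x)
            _ = (∑ x, It i u x) * m := by rw [sum_mul]
            _ ≤ m * m := mul_le_mul_of_nonneg_right (i4 u) hm
            _ = m ^ 2 := by ring
        rw [sum_add_distrib, sum_add_distrib, ← mul_sum, sum_const, card_univ, nsmul_eq_mul] at e1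
        have := mul_le_mul_of_nonneg_left e2 ha
        have := hd u
        linarith [mul_comm c (Fintype.card V : ℝ)]
  have mono1 : ∀ i u v, It i u v ≤ It (i + 1) u v := by
    intro i
    induction i with
    | zero => intro u v; rw [It0]; exact (inv 1).2.1 u v
    | succ i ih =>
      intro u v
      rw [ItS (i + 1)]
      conv_lhs => rw [ItS i]
      simp only [kerStep]
      split_ifs
      · have : ∑ x, It i u x * It i v x ≤ ∑ x, It (i + 1) u x * It (i + 1) v x :=
          sum_le_sum fun x _ => mul_le_mul (ih u x) (ih v x) ((inv i).2.1 v x) ((inv (i+1)).2.1 u x)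
        have := mul_le_mul_of_nonneg_left this ha
        linarith
      · exact le_rfl
  have hlim : ∀ u v, ∃ L, Filter.Tendsto (fun i => It i u v) Filter.atTop (nhds L) := by
    intro u v
    refine ⟨_, tendsto_atTop_ciSup (monotone_nat_of_le_succ fun i => mono1 i u v) ?_⟩
    exact ⟨1, by rintro _ ⟨i, rfl⟩; exact (inv i).2.2.1 u v⟩
  choose M hMl using hlim
  refine ⟨M, ?_, ?_, ?_, ?_, ?_⟩
  · intro u v
    refine tendsto_nhds_unique (hMl u v) ?_
    have := hMl v u
    simp_rw [fun i => (inv i).1 v u] at this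
    exact this
  · intro u v
    exact ge_of_tendsto' (hMl u v) fun i => (inv i).2.1 u v
  · intro u v
    exact le_of_tendsto' (hMl u v) fun i => (inv i).2.2.1 u v
  · intro u
    exact le_of_tendsto' (tendsto_finsetSum _ fun v _ => hMl u v) fun i => (inv i).2.2.2 u
  · intro u v
    refine tendsto_nhds_unique ((Filter.tendsto_add_atTop_iff_nat 1).mpr (hMl u v)) ?_
    simp_rw [ItS]
    simp only [kerStep]
    split_ifs
    · refine Filter.Tendsto.add (Filter.Tendsto.const_mul a ?_) tendsto_const_nhds
      exact tendsto_finsetSum _ fun x _ => (hMl u x).mul (hMl v x)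
    · exact tendsto_const_nhds

end part4

section part5
variable {V : Type*} [Fintype V]

theorem prod_one_sub_ge (s : Finset V) (f : V → ℝ) (h0 : ∀ x, 0 ≤ f x) (h1 : ∀ x, f x ≤ 1) :
    1 - ∑ x ∈ s, f x ≤ ∏ x ∈ s, (1 - f x) := by
  induction s using Finset.induction_on with
  | empty => simp
  | insert a s ha ih =>
    rw [sum_insert ha, prod_insert ha]
    have hp : ∏ x ∈ s, (1 - f x) ≤ 1 := prod_le_one (fun x _ => by linarith [h1 x])
      (fun x _ => by linarith [h0 x])
    nlinarith [h0 a]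

theorem prod_one_add_ge (s : Finset V) (f : V → ℝ) (h0 : ∀ x, 0 ≤ f x) :
    1 + ∑ x ∈ s, f x ≤ ∏ x ∈ s, (1 + f x) := by
  induction s using Finset.induction_on with
  | empty => simp
  | insert a s ha ih =>
    rw [sum_insert ha, prod_insert ha]
    have : 0 ≤ ∑ x ∈ s, f x := sum_nonneg fun x _ => h0 x
    nlinarith [h0 a]

/-- relative covariance factor -/
noncomputable def PiF (M : V → V → ℝ) (q : ℝ) (u v : V) : ℝ :=
  ∏ x, (1 + q * (1 - q) * (M u x * M v x) / ((1 - q * M u x) * (1 - q * M v x)))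

theorem PiF_symm (M : V → V → ℝ) (q : ℝ) (u v : V) : PiF M q u v = PiF M q v u := by
  unfold PiF
  refine prod_congr rfl fun x _ => ?_
  rw [mul_comm (M u x), mul_comm (1 - q * M u x)]

theorem PiF_ge (M : V → V → ℝ) (q : ℝ) (h0 : ∀ u v, 0 ≤ M u v) (h1 : ∀ u v, M u v ≤ 1)
    (hq0 : 0 ≤ q) (hq1 : q < 1) (u v : V) :
    1 + q * (1 - q) * ∑ x, M u x * M v x ≤ PiF M q u v := by
  have hpos : ∀ u x, 0 < 1 - q * M u x := fun u x => by nlinarith [h0 u x, h1 u x]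
  have hle : ∀ u x, 1 - q * M u x ≤ 1 := fun u x => by nlinarith [h0 u x, h1 u x]
  have hn : ∀ x, 0 ≤ q * (1 - q) * (M u x * M v x) := fun x =>
    mul_nonneg (mul_nonneg hq0 (by linarith)) (mul_nonneg (h0 u x) (h0 v x))
  rw [mul_sum]
  refine (prod_one_add_ge univ _ hn).trans ?_
  refine prod_le_prod (fun x _ => by linarith [hn x]) fun x _ => ?_
  have hd : 0 < (1 - q * M u x) * (1 - q * M v x) := mul_pos (hpos u x) (hpos v x)
  have hd1 : (1 - q * M u x) * (1 - q * M v x) ≤ 1 := mul_le_one₀ (hle u x) (hpos v x).le (hle v x)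
  have : q * (1 - q) * (M u x * M v x) ≤
      q * (1 - q) * (M u x * M v x) / ((1 - q * M u x) * (1 - q * M v x)) := by
    rw [le_div_iff₀ hd]; nlinarith [hn x]
  linarith

theorem PiF_le (M : V → V → ℝ) (q : ℝ) (h0 : ∀ u v, 0 ≤ M u v) (h1 : ∀ u v, M u v ≤ 1)
    (hq0 : 0 ≤ q) (hq1 : q < 1) (u v : V) (hX : q / (1 - q) * ∑ x, M u x * M v x ≤ 1) :
    PiF M q u v ≤ 1 + q / (1 - q) * ∑ x, M u x * M v x
      + (q / (1 - q) * ∑ x, M u x * M v x) ^ 2 := by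
  have hpos : ∀ u x, 1 - q ≤ 1 - q * M u x := fun u x => by nlinarith [h0 u x, h1 u x]
  have hq : 0 < 1 - q := by linarith
  have hn : ∀ x, 0 ≤ M u x * M v x := fun x => mul_nonneg (h0 u x) (h0 v x)
  set X := q / (1 - q) * ∑ x, M u x * M v x with hXd
  have hX0 : 0 ≤ X := mul_nonneg (div_nonneg hq0 hq.le) (sum_nonneg fun x _ => hn x)
  have e1 : PiF M q u v ≤ Real.exp X := by
    have : PiF M q u v ≤ ∏ x, (1 + q / (1 - q) * (M u x * M v x)) := by
      unfold PiF
      have hd : ∀ x, (1 - q) * (1 - q) ≤ (1 - q * M u x) * (1 - q * M v x) := fun x =>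
        mul_le_mul (hpos u x) (hpos v x) hq.le (hq.le.trans (hpos u x))
      have hq2 : 0 < (1 - q) * (1 - q) := mul_pos hq hq
      refine prod_le_prod (fun x _ => ?_) fun x _ => ?_
      · have := div_nonneg (mul_nonneg (mul_nonneg hq0 hq.le) (hn x)) (hq2.le.trans (hd x))
        linarith
      · have : q * (1 - q) * (M u x * M v x) / ((1 - q * M u x) * (1 - q * M v x)) ≤
          q / (1 - q) * (M u x * M v x) := by
          calc _ ≤ q * (1 - q) * (M u x * M v x) / ((1 - q) * (1 - q)) :=
                div_le_div_of_nonneg_left (mul_nonneg (mul_nonneg hq0 hq.le) (hn x)) hq2 (hd x)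
            _ = _ := by field_simp
        linarith
    refine this.trans ?_
    calc _ ≤ ∏ x, Real.exp (q / (1 - q) * (M u x * M v x)) := by
          refine prod_le_prod (fun x _ => ?_) fun x _ => ?_
          · have := mul_nonneg (div_nonneg hq0 hq.le) (hn x); linarith
          · have := Real.add_one_le_exp (q / (1 - q) * (M u x * M v x)); linarith
      _ = _ := by rw [← Real.exp_sum, ← mul_sum]
  have e2 := Real.abs_exp_sub_one_sub_id_le (x := X) (by rw [abs_of_nonneg hX0]; exact hX)
  have := (abs_le.mp e2).2
  linarith

theorem mixture (M : V → V → ℝ) (q A ξ : ℝ) (h0 : ∀ u v, 0 ≤ M u v) (h1 : ∀ u v, M u v ≤ 1)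
    (hq0 : 0 ≤ q) (hq1 : q < 1) (hA : 0 ≤ A) (hξ0 : 0 ≤ ξ) (hξ : ∀ u, q * ∑ x, M u x ≤ 1 - ξ) :
    ∃ (p : Finset V → ℝ) (lam : Finset V → V → ℝ), (∀ S, 0 ≤ p S) ∧
      (∀ S u, 1 ≤ lam S u) ∧ (∀ S u, lam S u ≤ 1 + A) ∧
      ∀ u v, ∑ S, p S * (lam S u * lam S v) =
        (1 + A - A * ξ) ^ 2 + A ^ 2 * ξ ^ 2 * (PiF M q u v - 1) := by
  have hpos : ∀ u x, 0 < 1 - q * M u x := fun u x => by nlinarith [h0 u x, h1 u x]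
  set π : V → ℝ := fun u => ∏ x, (1 - q * M u x) with hπ
  have hπ0 : ∀ u, 0 < π u := fun u => prod_pos fun x _ => hpos u x
  have hπξ : ∀ u, ξ ≤ π u := by
    intro u
    have := prod_one_sub_ge univ (fun x => q * M u x) (fun x => mul_nonneg hq0 (h0 u x))
      (fun x => by linarith [hpos u x])
    rw [← mul_sum] at this
    linarith [hξ u]
  set p : Finset V → ℝ := fun S => (∏ _x ∈ S, q) * ∏ _x ∈ Sᶜ, (1 - q) with hp
  have hE : ∀ h : V → ℝ, ∑ S, p S * ∏ x ∈ S, h x = ∏ x, (q * h x + (1 - q)) := by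
    intro h
    rw [Fintype.prod_add]
    refine sum_congr rfl fun S _ => ?_
    simp only [hp]
    rw [prod_mul_distrib]; ring
  set hh : Finset V → V → ℝ := fun S u => ξ / π u * ∏ x ∈ S, (1 - M u x) with hhh
  have hh0 : ∀ S u, 0 ≤ hh S u := fun S u =>
    mul_nonneg (div_nonneg hξ0 (hπ0 u).le) (prod_nonneg fun x _ => by linarith [h1 u x])
  have hh1 : ∀ S u, hh S u ≤ 1 := fun S u =>
    mul_le_one₀ ((div_le_one (hπ0 u)).mpr (hπξ u)) (prod_nonneg fun x _ => by linarith [h1 u x])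
      (prod_le_one (fun x _ => by linarith [h1 u x]) (fun x _ => by linarith [h0 u x]))
  refine ⟨p, fun S u => 1 + A * (1 - hh S u), ?_, ?_, ?_, ?_⟩
  · intro S
    exact mul_nonneg (prod_nonneg fun _ _ => hq0) (prod_nonneg fun _ _ => by linarith)
  · intro S u
    have := mul_nonneg hA (by linarith [hh1 S u] : 0 ≤ 1 - hh S u)
    linarith
  · intro S u
    have := mul_nonneg hA (hh0 S u)
    linarith
  · intro u v
    have s0 : ∑ S, p S = 1 := by
      have := hE (fun _ => 1)
      simpa using this
    have s1 : ∀ u, ∑ S, p S * hh S u = ξ := by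
      intro u
      have : ∀ S, p S * hh S u = ξ / π u * (p S * ∏ x ∈ S, (1 - M u x)) := by
        intro S; simp only [hhh]; ring
      simp_rw [this]
      rw [← mul_sum, hE]
      have e : ∏ x, (q * (1 - M u x) + (1 - q)) = π u := prod_congr rfl fun x _ => by ring
      rw [e, div_mul_cancel₀ _ (hπ0 u).ne']
    have s2 : ∑ S, p S * (hh S u * hh S v) = ξ ^ 2 * PiF M q u v := by
      have : ∀ S, p S * (hh S u * hh S v) =
          ξ / π u * (ξ / π v) * (p S * ∏ x ∈ S, ((1 - M u x) * (1 - M v x))) := by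
        intro S; simp only [hhh]; rw [prod_mul_distrib]; ring
      simp_rw [this]
      rw [← mul_sum, hE]
      have e : ∏ x, (q * ((1 - M u x) * (1 - M v x)) + (1 - q)) = PiF M q u v * (π u * π v) := by
        simp only [hπ, PiF]
        rw [← prod_mul_distrib, ← prod_mul_distrib]
        refine prod_congr rfl fun x _ => ?_
        have a1 := (hpos u x).ne'
        have a2 := (hpos v x).ne'
        field_simp
        ring
      rw [e]
      have a1 := (hπ0 u).ne'
      have a2 := (hπ0 v).ne'
      field_simp
    have ex : ∀ S, p S * ((1 + A * (1 - hh S u)) * (1 + A * (1 - hh S v))) =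
        (1 + A) ^ 2 * p S - A * (1 + A) * (p S * hh S u) - A * (1 + A) * (p S * hh S v)
          + A ^ 2 * (p S * (hh S u * hh S v)) := by intro S; ring
    simp_rw [ex]
    rw [sum_add_distrib, sum_sub_distrib, sum_sub_distrib, ← mul_sum, ← mul_sum, ← mul_sum,
      ← mul_sum, s0, s1, s1, s2]
    ring

end part5

section part6
variable {V : Type*} [Fintype V]

set_option maxHeartbeats 1000000 in
theorem main_thm (G : SimpleGraph V) [Nonempty V] (k : ℕ) (hk : 2 ≤ k)
    (hd : ∀ u, ∑ v, (if G.Adj u v then (0 : ℝ) else 1) ≤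
      (Fintype.card V : ℝ) / (100 * ((k + 2 : ℕ) : ℝ))) :
    fracCliqueDecomp G (k + 2) := by
  set n : ℝ := (Fintype.card V : ℝ) with hn
  set R : ℝ := ((k + 2 : ℕ) : ℝ) with hR
  have hR4 : 4 ≤ R := by
    rw [hR]; exact_mod_cast (by omega : 4 ≤ k + 2)
  have hR0 : 0 < R := by linarith
  have hn0 : 0 < n := by rw [hn]; exact_mod_cast Fintype.card_pos
  set d : ℝ := n / (100 * R) with hdd
  have hd1 : 1 ≤ d := by
    obtain ⟨u⟩ := ‹Nonempty V›
    refine le_trans ?_ (hd u)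
    have := single_le_sum (f := fun v => if G.Adj u v then (0 : ℝ) else 1)
      (fun v _ => by split_ifs <;> norm_num) (mem_univ u)
    simpa using this
  set t : ℝ := R / n with ht
  have ht0 : 0 < t := div_pos hR0 hn0
  have htd : t * d = 1 / 100 := by rw [ht, hdd]; field_simp
  have htn : t * n = R := by rw [ht]; field_simp
  have hdR : d * R = n / 100 := by rw [hdd]; field_simp
  have ht1 : t ≤ 1 / 100 := by nlinarith
  have hd4 : d ≤ n / 400 := by
    have : d * 4 ≤ d * R := mul_le_mul_of_nonneg_left hR4 (by linarith)
    linarith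
  set g : ℝ := 1.4 * d with hg
  have hg0 : 0 ≤ g := by rw [hg]; linarith
  have htg : t * g = 0.014 := by rw [hg]; linarith
  set e0 : ℝ := 0.00072 / R with he0
  have he00 : 0 < e0 := by positivity
  have he0R : e0 * R = 0.00072 := by rw [he0]; field_simp
  have he01 : e0 ≤ 0.00018 := by rw [he0, div_le_iff₀ hR0]; linarith
  have he0n : e0 * n = 0.072 * d := by rw [he0, hdd]; field_simp; norm_num
  obtain ⟨M, Ms, M0, M1, Mg, Mfix⟩ := kernel G (6.5325 * t) (3.35 * e0) d g (by positivity)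
    (by positivity) hg0 hd (by nlinarith) (by
      have e1 : 6.5325 * t * g ^ 2 = 6.5325 * (t * g) * g := by ring
      have e2 : 3.35 * e0 * n = 3.35 * (e0 * n) := by ring
      change d + 6.5325 * t * g ^ 2 + 3.35 * e0 * n ≤ g
      rw [e1, e2, htg, he0n, hg]
      linarith)
  set s : V → V → ℝ := fun u v => ∑ x, M u x * M v x with hs
  have s0 : ∀ u v, 0 ≤ s u v := fun u v => sum_nonneg fun x _ => mul_nonneg (M0 u x) (M0 v x)
  have sg : ∀ u v, s u v ≤ g := fun u v =>
    (sum_le_sum fun x _ => mul_le_of_le_one_right (M0 u x) (M1 v x)).trans (Mg u)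
  have ssym : ∀ u v, s u v = s v u := fun u v => sum_congr rfl fun x _ => mul_comm _ _
  have ts0 : ∀ u v, 0 ≤ t * s u v := fun u v => mul_nonneg ht0.le (s0 u v)
  have ts1 : ∀ u v, t * s u v ≤ 0.014 := fun u v => by
    rw [← htg]; exact mul_le_mul_of_nonneg_left (sg u v) ht0.le
  have ssum : ∀ u, ∑ v, s u v ≤ g ^ 2 := by
    intro u
    simp only [hs]
    rw [sum_comm]
    calc ∑ x, ∑ v, M u x * M v x = ∑ x, M u x * ∑ v, M x v := by
          refine sum_congr rfl fun x _ => ?_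
          rw [mul_sum]
          exact sum_congr rfl fun v _ => by rw [Ms v x]
      _ ≤ ∑ x, M u x * g := sum_le_sum fun x _ => mul_le_mul_of_nonneg_left (Mg x) (M0 u x)
      _ = (∑ x, M u x) * g := by rw [sum_mul]
      _ ≤ g * g := mul_le_mul_of_nonneg_right (Mg u) hg0
      _ = g ^ 2 := by ring
  set E : V → V → ℝ := fun u v => 1.95 * (t * s u v) + e0 with hE
  have E0 : ∀ u v, 0 ≤ E u v := fun u v => by simp only [hE]; linarith [ts0 u v]
  have E1 : ∀ u v, E u v ≤ 0.0275 := fun u v => by simp only [hE]; linarith [ts1 u v]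
  set q : ℝ := 6 * t with hq
  have hq0 : 0 ≤ q := by positivity
  have hq1 : q ≤ 0.06 := by rw [hq]; linarith
  obtain ⟨p, lam, hp0, hlam1, hlamA, hmix⟩ := mixture M q 0.7 0.916 M0 M1 hq0 (by linarith)
    (by norm_num) (by norm_num) (by
      intro u
      have := mul_le_mul_of_nonneg_left (Mg u) hq0
      have e : q * g = 6 * (t * g) := by rw [hq]; ring
      rw [e, htg] at this
      linarith)
  set κ : V → V → ℝ := fun u v => (0.41113744 / 1.12105744) * (PiF M q u v - 1) with hκ
  have κs : ∀ u v, κ u v = κ v u := fun u v => by simp only [hκ, PiF_symm M q u v]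
  have κlo : ∀ u v, 2.068 * (t * s u v) ≤ κ u v := by
    intro u v
    have h := PiF_ge M q M0 M1 hq0 (by linarith) u v
    have e : q * (1 - q) * ∑ x, M u x * M v x = 6 * (1 - q) * (t * s u v) := by
      simp only [hs, hq]; ring
    rw [e] at h
    have h2 : 6 * 0.94 * (t * s u v) ≤ 6 * (1 - q) * (t * s u v) :=
      mul_le_mul_of_nonneg_right (by linarith) (ts0 u v)
    have h3 : 5.64 * (t * s u v) ≤ PiF M q u v - 1 := by linarith
    have h4 := mul_le_mul_of_nonneg_left h3 (by norm_num : (0:ℝ) ≤ 0.41113744 / 1.12105744)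
    simp only [hκ]
    refine le_trans ?_ h4
    have h5 : 2.068 * (t * s u v) ≤ (0.41113744 / 1.12105744 * 5.64) * (t * s u v) :=
      mul_le_mul_of_nonneg_right (by norm_num) (ts0 u v)
    refine h5.trans (le_of_eq ?_)
    ring
  have κhi : ∀ u v, κ u v ≤ 2.551 * (t * s u v) := by
    intro u v
    have hq2 : 0 < 1 - q := by linarith
    have e : q / (1 - q) * ∑ x, M u x * M v x = 6 / (1 - q) * (t * s u v) := by
      simp only [hs, hq]; ring
    have hX : 6 / (1 - q) * (t * s u v) ≤ 6.383 * (t * s u v) := by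
      refine mul_le_mul_of_nonneg_right ?_ (ts0 u v)
      rw [div_le_iff₀ hq2]; linarith
    have hX0 : 0 ≤ 6 / (1 - q) * (t * s u v) := mul_nonneg (by positivity) (ts0 u v)
    have h := PiF_le M q M0 M1 hq0 (by linarith) u v (by rw [e]; linarith [ts1 u v])
    rw [e] at h
    have h3 : PiF M q u v - 1 ≤ 6.9538 * (t * s u v) := by
      have := ts1 u v
      have := ts0 u v
      nlinarith
    have h4 := mul_le_mul_of_nonneg_left h3 (by norm_num : (0:ℝ) ≤ 0.41113744 / 1.12105744)
    simp only [hκ]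
    refine h4.trans ?_
    rw [← mul_assoc]
    exact mul_le_mul_of_nonneg_right (by norm_num) (ts0 u v)
  have κ0 : ∀ u v, 0 ≤ κ u v := fun u v => by linarith [κlo u v, ts0 u v]
  have key : ∀ S, ∃ w : Finset V → ℝ, (∀ s, 0 ≤ w s) ∧ ∀ u v : V, G.Adj u v →
      ∑ s ∈ univ.filter (fun s : Finset V => G.IsNClique (k + 2) s ∧ u ∈ s ∧ v ∈ s), w s =
        lam S u * lam S v / (1 + κ u v) := by
    intro S
    have hgx : g = 0.014 * (n / R) := by rw [hg, hdd]; ring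
    have hnR : 0 ≤ n / R := by positivity
    have hL : n ≤ ∑ v, lam S v := by
      have : ∑ v : V, (1 : ℝ) ≤ ∑ v, lam S v := sum_le_sum fun v _ => hlam1 S v
      simpa using this
    refine gibbs G k (lam S) 1.7 1.04 (hlam1 S) (fun u => (hlamA S u).trans (by norm_num))
      (by norm_num) (fun u v => 1 + κ u v) (fun u v => 2.35 * E u v)
      (fun u v => by simp only [κs u v]) (fun u v => by simp only [hE, ssym u v])
      (fun u v => by linarith [E0 u v]) (fun u v => by linarith [E1 u v])
      (fun u v => by linarith [κ0 u v]) g (0.975 * n) 0.0262 (0.0262 / R) hg0 (by positivity)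
      ?_ (by positivity) ?_ ?_ (by norm_num) M E (fun u v => E u v / (1.03 * R))
      (fun u v => 1.863 * (s u v / n)) (0.0261 / R) e0 E0 ?_ ?_ M0 Mg ?_ ?_ ?_ ?_ ?_
      (by positivity) ?_ ?_ ?_ 0.0045 (by norm_num) ?_ (by linarith) ?_ ?_
    · -- n0
      change 0.975 * n ≤ n - R * (1.04 * 1.7 * g)
      have : R * (1.04 * 1.7 * g) = 1.04 * 1.7 * 1.4 * (d * R) := by rw [hg]; ring
      rw [this, hdR]; linarith
    · have : 0.0262 / R * ((1 - 0.0262) * (0.975 * n)) =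
        0.0262 * (1 - 0.0262) * 0.975 * (n / R) := by ring
      rw [this, hgx]
      rw [← mul_assoc]
      exact mul_le_mul_of_nonneg_right (by norm_num) hnR
    · change R * (0.0262 / R) ≤ 0.0262
      rw [mul_div_cancel₀ _ hR0.ne']
    · intro u v h
      have := Mfix u v
      rw [if_pos h] at this
      rw [this]
      simp only [hE, hs]
      apply le_of_eq; ring
    · intro u v h
      have := Mfix u v
      rw [if_neg h] at this
      rw [this]
    · intro u v
      have := E0 u v
      positivity
    · intro u v
      rw [div_le_one (by positivity)]
      linarith [E1 u v]
    · intro u v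
      have hx : 0 ≤ E u v / 1.03 := div_nonneg (E0 u v) (by norm_num)
      have hx1 : E u v / 1.03 ≤ 0.03 := by
        rw [div_le_iff₀ (by norm_num)]; linarith [E1 u v]
      have e1 : (1 + E u v / (1.03 * R)) ^ (k + 2) ≤ Real.exp (E u v / 1.03) := by
        calc (1 + E u v / (1.03 * R)) ^ (k + 2) ≤ (Real.exp (E u v / (1.03 * R))) ^ (k + 2) := by
              refine pow_le_pow_left₀ ?_ ?_ _
              · have := E0 u v
                positivity
              · have := Real.add_one_le_exp (E u v / (1.03 * R)); linarith
          _ = Real.exp (R * (E u v / (1.03 * R))) := by rw [← Real.exp_nat_mul]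
          _ = _ := by congr 1; field_simp
      have e2 := (abs_le.mp (Real.abs_exp_sub_one_sub_id_le (x := E u v / 1.03)
        (by rw [abs_of_nonneg hx]; linarith))).2
      have e3 : E u v = 1.03 * (E u v / 1.03) := by field_simp
      nlinarith
    · intro u v
      have hx : E u v / (1.03 * R) ≤ 1 := by
        rw [div_le_one (by positivity)]
        linarith [E1 u v]
      have := one_add_mul_le_pow (a := -(E u v / (1.03 * R))) (by linarith) (k + 2)
      have e1 : 1 + ((k + 2 : ℕ) : ℝ) * -(E u v / (1.03 * R)) = 1 - E u v / 1.03 := by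
        change 1 + R * _ = _
        field_simp
        ring
      have e2 : E u v / 1.03 ≤ E u v := by
        rw [div_le_iff₀ (by norm_num)]; linarith [E0 u v]
      rw [e1] at this
      have e3 : 1 - E u v / (1.03 * R) = 1 + -(E u v / (1.03 * R)) := by ring
      rw [e3]
      linarith
    · rw [div_le_one hR0]; linarith
    · have : 0.0261 / R * ((1 - 0.0262) * (0.975 * n)) =
        0.0261 * (1 - 0.0262) * 0.975 * (n / R) := by ring
      rw [this, hgx]
      rw [← mul_assoc]
      exact mul_le_mul_of_nonneg_right (by norm_num) hnR
    · intro u v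
      have e : 1.863 * (s u v / n) * ((1 - 0.0262) * (0.975 * n)) =
        1.863 * (1 - 0.0262) * 0.975 * s u v := by field_simp
      rw [e]
      exact mul_le_mul_of_nonneg_right (by norm_num) (s0 u v)
    · intro u v
      have hw0 : 0 < 1 / R := by positivity
      have hw1 : 1 / R ≤ 1 / 4 := one_div_le_one_div_of_le (by norm_num) hR4
      have e1 : E u v / (1.03 * R) = (1.95 * (s u v / n) + 0.00072 * (1 / R) ^ 2) / 1.03 := by
        simp only [hE, ht, he0]; field_simp
      have e2 : (0.0261 : ℝ) / R = 0.0261 * (1 / R) := by ring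
      rw [e1, e2]
      have hS : 0 ≤ s u v / n := div_nonneg (s0 u v) hn0.le
      set x := s u v / n
      set w := 1 / R
      have h1 : 0.98695 ≤ (1 - 0.0261 * w) ^ 2 := by nlinarith
      have h2 : 0 ≤ (1.95 * x + 0.00072 * w ^ 2) / 1.03 := by positivity
      have h3 := mul_le_mul_of_nonneg_left h1 h2
      refine le_trans ?_ h3
      have hw2 : 0 ≤ w ^ 2 := sq_nonneg _
      rw [div_mul_eq_mul_div, le_div_iff₀ (by norm_num)]
      nlinarith
    · intro u
      constructor
      · have e1 : ∀ v, lam S v - 1.7 * (if G.Adj u v then (0:ℝ) else 1) - 1.7 * κ u v ≤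
            if G.Adj u v then lam S v / (1 + κ u v) else 0 := by
          intro v
          have hl : lam S v ≤ 1.7 := (hlamA S v).trans (by norm_num)
          have hl1 := hlam1 S v
          have hκ0 := κ0 u v
          split_ifs
          · rw [le_div_iff₀ (by linarith)]
            nlinarith [mul_nonneg hκ0 hκ0, mul_nonneg (mul_nonneg hκ0 hκ0) (by linarith : 0 ≤ lam S v),
              mul_nonneg hκ0 (by linarith : (0:ℝ) ≤ 1.7 - lam S v)]
          · linarith
        have e2 := sum_le_sum fun v (_ : v ∈ univ) => e1 v
        rw [sum_sub_distrib, sum_sub_distrib, ← mul_sum, ← mul_sum, ← sum_filter] at e2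
        have e3 : ∑ v, κ u v ≤ 0.05 * d := by
          calc ∑ v, κ u v ≤ ∑ v, 2.551 * (t * s u v) := sum_le_sum fun v _ => κhi u v
            _ = 2.551 * t * ∑ v, s u v := by rw [mul_sum]; exact sum_congr rfl fun v _ => by ring
            _ ≤ 2.551 * t * g ^ 2 := mul_le_mul_of_nonneg_left (ssum u) (by positivity)
            _ = 2.551 * (t * g) * g := by ring
            _ ≤ _ := by rw [htg, hg]; linarith
        have e4 := hd u
        linarith
      · rw [sum_filter]
        refine sum_le_sum fun v _ => ?_
        have := hlam1 S v
        split_ifs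
        · exact div_le_self (by linarith) (by linarith [κ0 u v])
        · linarith
    · intro u v _
      have h1 := κhi u v
      have h2 := E1 u v
      have h3 := E0 u v
      have h4 := κ0 u v
      have h5 := ts0 u v
      have h6 : E u v = 1.95 * (t * s u v) + e0 := rfl
      have h7 : E u v * κ u v ≤ 0.0275 * κ u v := mul_le_mul_of_nonneg_right h2 h4
      have h8 : 0 ≤ (2.35 * E u v) * (E u v + κ u v + E u v * κ u v) := by positivity
      nlinarith
    · intro u v _
      have h1 := κlo u v
      have h2 := E1 u v
      have h4 := κ0 u v
      have h5 := ts0 u v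
      have h6 : E u v = 1.95 * (t * s u v) + e0 := rfl
      have h7 : E u v * κ u v ≤ 0.0275 * κ u v := mul_le_mul_of_nonneg_right h2 h4
      nlinarith
  choose w hw0 hw using key
  refine ⟨fun K => (∑ S, p S * w S K) / 1.12105744, fun K => div_nonneg
    (sum_nonneg fun S _ => mul_nonneg (hp0 S) (hw0 S K)) (by norm_num), ?_⟩
  intro u v huv
  rw [← sum_div, sum_comm]
  simp_rw [← mul_sum, fun S => hw S u v huv, mul_div_assoc']
  rw [← sum_div, hmix]
  have hpos : 0 < 1 + κ u v := by linarith [κ0 u v]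
  rw [div_div, div_eq_one_iff_eq (by positivity)]
  simp only [hκ]
  ring

end part6

theorem stmt6 {V : Type*} [Fintype V] (G : SimpleGraph V) [DecidableRel G.Adj]
    (r : ℕ) (hr : 4 ≤ r)
    (hdeg : ∀ v : V, (1 - 1 / (100 * (r : ℝ))) * Fintype.card V ≤ G.degree v) :
    fracCliqueDecomp G r := by
  rcases isEmpty_or_nonempty V with hV | hV
  · exact ⟨fun _ => 0, fun _ => le_rfl, fun u => hV.elim u⟩
  obtain ⟨k, rfl⟩ : ∃ k, r = k + 2 := ⟨r - 2, by omega⟩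
  refine main_thm G k (by omega) fun u => ?_
  have h1 : ∑ v, (if G.Adj u v then (0 : ℝ) else 1) + (G.degree u : ℝ) = Fintype.card V := by
    have h2 : (G.degree u : ℝ) = ∑ v, (if G.Adj u v then (1 : ℝ) else 0) := by
      rw [← G.card_neighborFinset_eq_degree, G.neighborFinset_eq_filter, sum_boole]
    rw [h2, ← sum_add_distrib]
    have : ∀ v, ((if G.Adj u v then (0 : ℝ) else 1) + if G.Adj u v then (1 : ℝ) else 0) = 1 := by
      intro v; split_ifs <;> norm_num
    simp_rw [this]
    simp
  have h3 := hdeg u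
  have h4 : (1 - 1 / (100 * ((k + 2 : ℕ) : ℝ))) * (Fintype.card V : ℝ) =
    Fintype.card V - Fintype.card V / (100 * ((k + 2 : ℕ) : ℝ)) := by ring
  rw [h4] at h3
  have h5 : ∑ v, (if G.Adj u v then (0 : ℝ) else 1) ≤
      (Fintype.card V : ℝ) / (100 * ((k + 2 : ℕ) : ℝ)) := by linarith
  convert h5
end

section
/- For each r ≥ 3, every graph G with minimum degree at least (1 − 1/(128r+252))·|V(G)| has a fractional K_r-decomposition. -/
open Finset
open scoped Classical

structure Cls {V : Type*} [Fintype V] (ε : ℝ) (a : V → ℝ) (q : V → V → ℝ) : Prop where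
  a0 : ∀ x, 0 ≤ a x
  a1 : ∑ x, a x = 1
  q0 : ∀ x y, 0 ≤ q x y
  qs : ∀ x y, q x y = q y x
  qd : ∀ x, q x x = 0
  qu : ∀ x y, q x y ≤ 1 + ε
  qr : ∀ x, ∑ y, a y * |1 - q x y| ≤ ε

theorem mean_abs {V : Type*} [Fintype V] {a : V → ℝ} (a0 : ∀ x, 0 ≤ a x) (a1 : ∑ x, a x = 1)
    (f : V → ℝ) (B : ℝ) (h : ∀ x, |f x| ≤ B) : |∑ x, a x * f x| ≤ B := by
  calc |∑ x, a x * f x| ≤ ∑ x, |a x * f x| := Finset.abs_sum_le_sum_abs _ _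
    _ ≤ ∑ x, a x * B := by
        apply Finset.sum_le_sum; intro x _
        rw [abs_mul, abs_of_nonneg (a0 x)]
        exact mul_le_mul_of_nonneg_left (h x) (a0 x)
    _ = B := by rw [← Finset.sum_mul, a1, one_mul]

theorem wmean_abs {V : Type*} [Fintype V] {a : V → ℝ} (a0 : ∀ x, 0 ≤ a x)
    (k f : V → ℝ) (B T : ℝ) (hB : 0 ≤ B) (h : ∀ x, |f x| ≤ B) (hk : ∑ x, a x * |k x| ≤ T) :
    |∑ x, a x * (k x * f x)| ≤ T * B := by
  calc |∑ x, a x * (k x * f x)| ≤ ∑ x, |a x * (k x * f x)| := Finset.abs_sum_le_sum_abs _ _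
    _ ≤ ∑ x, a x * |k x| * B := by
        apply Finset.sum_le_sum; intro x _
        rw [abs_mul, abs_mul, abs_of_nonneg (a0 x), mul_assoc]
        exact mul_le_mul_of_nonneg_left (mul_le_mul_of_nonneg_left (h x) (abs_nonneg _)) (a0 x)
    _ ≤ T * B := by rw [← Finset.sum_mul]; exact mul_le_mul_of_nonneg_right hk hB

section
variable {V : Type*} [Fintype V] {ε : ℝ} {a : V → ℝ} {q : V → V → ℝ}

theorem Cls.kern (H : Cls ε a q) (he : 0 ≤ ε) (he' : ε ≤ 1 / 636) (x y : V) :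
    ∑ z, a z * |1 - q x z * q y z| ≤ 201 / 100 * ε := by
  calc ∑ z, a z * |1 - q x z * q y z| ≤ ∑ z, (a z * |1 - q x z| + (1 + ε) * (a z * |1 - q y z|)) := by
        apply Finset.sum_le_sum; intro z _
        have h1 : |1 - q x z * q y z| ≤ |1 - q x z| + (1 + ε) * |1 - q y z| := by
          have : 1 - q x z * q y z = (1 - q x z) + q x z * (1 - q y z) := by ring
          rw [this]
          refine (abs_add_le _ _).trans ?_
          rw [abs_mul, abs_of_nonneg (H.q0 x z)]
          have := mul_le_mul_of_nonneg_right (H.qu x z) (abs_nonneg (1 - q y z))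
          linarith
        have := mul_le_mul_of_nonneg_left h1 (H.a0 z)
        linarith
    _ ≤ 201 / 100 * ε := by
        rw [Finset.sum_add_distrib, ← Finset.mul_sum]
        have h1 := H.qr x
        have h2 := mul_le_mul_of_nonneg_left (H.qr y) (by linarith : 0 ≤ 1 + ε)
        nlinarith

noncomputable def CC (a : V → ℝ) (q : V → V → ℝ) (x y : V) : ℝ := ∑ z, a z * (q x z * q y z)

noncomputable def LL (a : V → ℝ) (q : V → V → ℝ) (c : V → V → ℝ) (x y : V) : ℝ :=
  CC a q x y * c x y + ∑ z, a z * (q x z * q y z * (c x z + c y z))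

theorem CC_symm (x y : V) : CC a q x y = CC a q y x := by
  unfold CC; apply Finset.sum_congr rfl; intro z _; ring

theorem Cls.CCb (H : Cls ε a q) (he : 0 ≤ ε) (he' : ε ≤ 1 / 636) (x y : V) :
    |1 - CC a q x y| ≤ 201 / 100 * ε := by
  have : 1 - CC a q x y = ∑ z, a z * ((1 - q x z * q y z) * 1) := by
    have h1 : (1 : ℝ) - CC a q x y = ∑ z, a z - CC a q x y := by rw [H.a1]
    rw [h1, CC, ← Finset.sum_sub_distrib]
    apply Finset.sum_congr rfl; intro z _; ring
  rw [this]
  have := wmean_abs H.a0 (fun z => 1 - q x z * q y z) (fun _ => 1) 1 _ zero_le_one (by simp)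
    (H.kern he he' x y)
  simpa using this

/-- remainder bound -/
theorem Cls.rho (H : Cls ε a q) (he : 0 ≤ ε) (he' : ε ≤ 1 / 636) (c : V → V → ℝ) (N : ℝ)
    (hc : ∀ x y, |c x y| ≤ N) (x y : V) :
    |c x y - LL a q c x y + (∑ z, a z * c x z) + ∑ z, a z * c y z| ≤ 603 / 100 * ε * N := by
  have hN : 0 ≤ N := (abs_nonneg _).trans (hc x y)
  have e1 : c x y - LL a q c x y + (∑ z, a z * c x z) + ∑ z, a z * c y z =
      (1 - CC a q x y) * c x y + ∑ z, a z * ((1 - q x z * q y z) * (c x z + c y z)) := by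
    have : ∑ z, a z * ((1 - q x z * q y z) * (c x z + c y z)) =
      (∑ z, a z * c x z) + (∑ z, a z * c y z) - ∑ z, a z * (q x z * q y z * (c x z + c y z)) := by
      rw [← Finset.sum_add_distrib, ← Finset.sum_sub_distrib]
      apply Finset.sum_congr rfl; intro z _; ring
    rw [this, LL]; ring
  rw [e1]
  have h1 : |(1 - CC a q x y) * c x y| ≤ 201 / 100 * ε * N := by
    rw [abs_mul]
    exact mul_le_mul (H.CCb he he' x y) (hc x y) (abs_nonneg _) (by linarith)
  have h2 := wmean_abs H.a0 (fun z => 1 - q x z * q y z) (fun z => c x z + c y z) (2 * N) _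
    (by linarith) (fun z => (abs_add_le _ _).trans (by linarith [hc x z, hc y z])) (H.kern he he' x y)
  refine (abs_add_le _ _).trans ?_
  linarith

/-- averaging identity -/
theorem Cls.avg1 (H : Cls ε a q) (c R : V → V → ℝ) (g : V → ℝ)
    (hR : ∀ x y, c x y = R x y - g x - g y) (hg : ∀ x, g x = ∑ z, a z * c x z) (x : V) :
    2 * g x + ∑ y, a y * g y = ∑ y, a y * R x y := by
  have h1 : ∑ z, a z * c x z = ∑ y, a y * R x y - g x - ∑ y, a y * g y := by
    have : ∀ z, a z * c x z = a z * R x z - a z * g x - a z * g z := by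
      intro z; rw [hR]; ring
    simp_rw [this]
    rw [Finset.sum_sub_distrib, Finset.sum_sub_distrib, ← Finset.sum_mul, H.a1, one_mul]
  have := hg x
  linarith

theorem Cls.avg2 (H : Cls ε a q) (c R : V → V → ℝ) (g : V → ℝ)
    (hR : ∀ x y, c x y = R x y - g x - g y) (hg : ∀ x, g x = ∑ z, a z * c x z) :
    3 * ∑ y, a y * g y = ∑ x, a x * ∑ y, a y * R x y := by
  have h1 : ∀ x, a x * ∑ y, a y * R x y = 2 * (a x * g x) + a x * ∑ y, a y * g y := by
    intro x; rw [← H.avg1 c R g hR hg x]; ring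
  simp_rw [h1]
  rw [Finset.sum_add_distrib, ← Finset.mul_sum, ← Finset.sum_mul, H.a1]; ring

theorem Cls.apriori (H : Cls ε a q) (he : 0 ≤ ε) (he' : ε ≤ 1 / 636) (c : V → V → ℝ) (N D : ℝ)
    (hc : ∀ x y, |c x y| ≤ N) (hD : ∀ x y, |LL a q c x y| ≤ D) (x y : V) :
    |c x y| ≤ 7 / 3 * (D + 603 / 100 * ε * N) := by
  set g : V → ℝ := fun x => ∑ z, a z * c x z with hg
  set R : V → V → ℝ := fun x y => c x y + g x + g y with hR
  have hRb : ∀ x y, |R x y| ≤ D + 603 / 100 * ε * N := by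
    intro x y
    have h1 := H.rho he he' c N hc x y
    have h2 := hD x y
    have : R x y = (c x y - LL a q c x y + (∑ z, a z * c x z) + ∑ z, a z * c y z) + LL a q c x y := by
      simp only [hR, hg]; ring
    rw [this]
    exact (abs_add_le _ _).trans (by linarith)
  have hRm : ∀ x, |∑ y, a y * R x y| ≤ D + 603 / 100 * ε * N := fun x =>
    mean_abs H.a0 H.a1 _ _ (hRb x)
  have hRmm := mean_abs H.a0 H.a1 _ _ hRm
  have e1 := H.avg1 c R g (by intro x y; simp only [hR]; ring) (fun _ => rfl)
  have e2 := H.avg2 c R g (by intro x y; simp only [hR]; ring) (fun _ => rfl)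
  have hx := e1 x
  have hy := e1 y
  have b1 := hRm x
  have b2 := hRm y
  have b3 := hRb x y
  have hcx : c x y = R x y - g x - g y := by simp only [hR]; ring
  rw [abs_le] at *
  constructor <;> linarith [b1.1, b1.2, b2.1, b2.2, b3.1, b3.2, hRmm.1, hRmm.2]

theorem Cls.exN (c : V → V → ℝ) : ∃ N, 0 ≤ N ∧ (∀ x y, |c x y| ≤ N) ∧
    ∀ B, 0 ≤ B → (∀ x y, |c x y| ≤ B) → N ≤ B := by
  rcases isEmpty_or_nonempty V with h | h
  · exact ⟨0, le_rfl, fun x => (h.false x).elim, fun B hB _ => hB⟩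
  · obtain ⟨p, hp⟩ := Finite.exists_max (fun p : V × V => |c p.1 p.2|)
    exact ⟨|c p.1 p.2|, abs_nonneg _, fun x y => hp (x, y), fun B _ h => h _ _⟩

theorem Cls.bound (H : Cls ε a q) (he : 0 ≤ ε) (he' : ε ≤ 1 / 636) (c : V → V → ℝ) (D : ℝ)
    (hD0 : 0 ≤ D) (hD : ∀ x y, |LL a q c x y| ≤ D) (x y : V) :
    |c x y| ≤ 24 / 10 * D := by
  obtain ⟨N, hN0, hN, hmin⟩ := Cls.exN c
  have h1 := hmin (7 / 3 * (D + 603 / 100 * ε * N)) (by positivity) (H.apriori he he' c N D hN hD)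
  have h2 : ε * N ≤ 1 / 636 * N := mul_le_mul_of_nonneg_right he' hN0
  have := hN x y
  linarith

noncomputable def LLlin (a : V → ℝ) (q : V → V → ℝ) : (V → V → ℝ) →ₗ[ℝ] (V → V → ℝ) where
  toFun c := LL a q c
  map_add' c d := by
    funext x y
    simp only [LL, Pi.add_apply]
    have : ∑ z, a z * (q x z * q y z * (c x z + d x z + (c y z + d y z))) =
      (∑ z, a z * (q x z * q y z * (c x z + c y z))) + ∑ z, a z * (q x z * q y z * (d x z + d y z)) := by
      rw [← Finset.sum_add_distrib]; apply Finset.sum_congr rfl; intro z _; ring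
    rw [this]; ring
  map_smul' k c := by
    funext x y
    simp only [LL, Pi.smul_apply, smul_eq_mul, RingHom.id_apply]
    have : ∑ z, a z * (q x z * q y z * (k * c x z + k * c y z)) =
      k * (∑ z, a z * (q x z * q y z * (c x z + c y z))) := by
      rw [Finset.mul_sum]; apply Finset.sum_congr rfl; intro z _; ring
    rw [this]; ring

theorem Cls.solve (H : Cls ε a q) (he : 0 ≤ ε) (he' : ε ≤ 1 / 636) (d : V → V → ℝ) :
    ∃ c : V → V → ℝ, ∀ x y, LL a q c x y = d x y := by
  have hinj : Function.Injective (LLlin a q) := by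
    rw [injective_iff_map_eq_zero]
    intro c hc
    funext x y
    have := H.bound he he' c 0 le_rfl (by
      intro x y
      have : LL a q c x y = 0 := congrFun (congrFun hc x) y
      rw [this]; simp) x y
    simpa using this
  obtain ⟨c, hc⟩ := (LinearMap.injective_iff_surjective.1 hinj) d
  exact ⟨c, fun x y => congrFun (congrFun hc x) y⟩


theorem Cls.eta_abs (H : Cls ε a q) (he' : ε ≤ 1 / 636) (x y : V) : |1 - q x y| ≤ 1 := by
  rw [abs_le]; constructor <;> linarith [H.q0 x y, H.qu x y]

theorem Cls.struct (H : Cls ε a q) (he : 0 ≤ ε) (he' : ε ≤ 1 / 636) :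
    ∃ (c f : V → V → ℝ) (g : V → ℝ), (∀ x y, c x y = c y x) ∧
      (∀ x y, ∑ z, a z * (q x z * q y z * (1 + c x y + c x z + c y z)) = 1) ∧
      (∀ x y, c x y = f x y - g x - g y) ∧
      (∀ x y, f x y ≤ 32 * ε ^ 2) ∧ (∀ x, ∑ y, a y * |f x y| ≤ 31 * ε ^ 2) ∧
      (∀ x y, |f x y| ≤ 105 / 100 * ε) ∧ (∀ x, |g x| ≤ 70 / 100 * ε) := by
  obtain ⟨c, hc⟩ := H.solve he he' (fun x y => 1 - CC a q x y)
  have he2 : ε ^ 2 ≤ 1 / 636 * ε := by nlinarith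
  have hN : ∀ x y, |c x y| ≤ 24 / 10 * (201 / 100 * ε) := by
    refine H.bound he he' c _ (by linarith) ?_
    intro x y; rw [hc]; exact H.CCb he he' x y
  have hrho := H.rho he he' c _ hN
  set ga : V → ℝ := fun x => ∑ z, a z * c x z with hga
  set e : V → ℝ := fun x => ∑ z, a z * (1 - q x z) with hed
  set ip : V → V → ℝ := fun x y => ∑ z, a z * ((1 - q x z) * (1 - q y z)) with hip
  set ρ : V → V → ℝ := fun x y => c x y - LL a q c x y + ga x + ga y with hρ
  have hρb : ∀ x y, |ρ x y| ≤ 30 * ε ^ 2 := by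
    intro x y
    have := hrho x y
    refine this.trans ?_
    nlinarith [sq_nonneg ε]
  have hLL : ∀ x y, LL a q c x y = e x + e y - ip x y := by
    intro x y
    rw [hc]
    simp only [hed, hip, CC]
    rw [← H.a1, ← Finset.sum_sub_distrib, ← Finset.sum_add_distrib, ← Finset.sum_sub_distrib]
    rw [H.a1]
    apply Finset.sum_congr rfl; intro z _; ring
  have hipl : ∀ x y, -(2 * ε ^ 2) ≤ ip x y := by
    intro x y
    have h1 : ∑ z, (-(ε * (a z * |1 - q x z|)) - ε * (a z * |1 - q y z|)) ≤ ip x y := by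
      apply Finset.sum_le_sum; intro z _
      have hx := H.qu x z
      have hy := H.qu y z
      have : -(ε * |1 - q x z|) - ε * |1 - q y z| ≤ (1 - q x z) * (1 - q y z) := by
        rcases abs_cases (1 - q x z) with ⟨h, h'⟩ | ⟨h, h'⟩ <;>
        rcases abs_cases (1 - q y z) with ⟨k, k'⟩ | ⟨k, k'⟩ <;> rw [h, k] <;> nlinarith
      have := mul_le_mul_of_nonneg_left this (H.a0 z)
      linarith
    rw [Finset.sum_sub_distrib, Finset.sum_neg_distrib, ← Finset.mul_sum, ← Finset.mul_sum] at h1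
    nlinarith [H.qr x, H.qr y]
  have hipa : ∀ x y, |ip x y| ≤ ε := by
    intro x y
    have := wmean_abs H.a0 (fun z => 1 - q x z) (fun z => 1 - q y z) 1 _ zero_le_one
      (fun z => H.eta_abs he' y z) (H.qr x)
    linarith
  have hip1 : ∀ x, ∑ y, a y * |ip x y| ≤ ε ^ 2 := by
    intro x
    calc ∑ y, a y * |ip x y| ≤ ∑ y, ∑ z, a y * (a z * (|1 - q x z| * |1 - q y z|)) := by
          apply Finset.sum_le_sum; intro y _
          rw [← Finset.mul_sum]
          apply mul_le_mul_of_nonneg_left _ (H.a0 y)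
          refine (Finset.abs_sum_le_sum_abs _ _).trans (le_of_eq ?_)
          apply Finset.sum_congr rfl; intro z _
          rw [abs_mul, abs_mul, abs_of_nonneg (H.a0 z)]
      _ = ∑ z, a z * |1 - q x z| * ∑ y, a y * |1 - q z y| := by
          rw [Finset.sum_comm]
          apply Finset.sum_congr rfl; intro z _
          rw [Finset.mul_sum]
          apply Finset.sum_congr rfl; intro y _
          rw [H.qs z y]; ring
      _ ≤ ∑ z, a z * |1 - q x z| * ε := by
          apply Finset.sum_le_sum; intro z _
          exact mul_le_mul_of_nonneg_left (H.qr z) (mul_nonneg (H.a0 z) (abs_nonneg _))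
      _ ≤ ε ^ 2 := by
          rw [← Finset.sum_mul]; nlinarith [H.qr x]
  set f : V → V → ℝ := fun x y => ρ x y - ip x y with hf
  have hf1 : ∀ x, ∑ y, a y * |f x y| ≤ 31 * ε ^ 2 := by
    intro x
    calc ∑ y, a y * |f x y| ≤ ∑ y, (a y * (30 * ε ^ 2) + a y * |ip x y|) := by
          apply Finset.sum_le_sum; intro y _
          rw [← mul_add]
          apply mul_le_mul_of_nonneg_left _ (H.a0 y)
          exact (abs_sub _ _).trans (by linarith [hρb x y])
      _ ≤ 31 * ε ^ 2 := by
          rw [Finset.sum_add_distrib, ← Finset.sum_mul, H.a1]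
          linarith [hip1 x]
  have heb : ∀ x, |e x| ≤ ε := by
    intro x
    have := wmean_abs H.a0 (fun z => 1 - q x z) (fun z => 1) 1 _ zero_le_one
      (fun z => by simp) (H.qr x)
    simpa [hed] using this
  have hcf : ∀ x y, c x y = f x y - (ga x - e x) - (ga y - e y) := by
    intro x y
    simp only [hf, hρ]; rw [hLL]; ring
  refine ⟨c, f, fun x => ga x - e x, ?_, ?_, hcf, ?_, hf1, ?_, ?_⟩
  · intro x y
    have h1 := hc x y
    have h2 := hc y x
    simp only [LL] at h1 h2
    rw [CC_symm y x] at h2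
    have h3 : ∑ z, a z * (q y z * q x z * (c y z + c x z)) =
        ∑ z, a z * (q x z * q y z * (c x z + c y z)) := by
      apply Finset.sum_congr rfl; intro z _; ring
    rw [h3] at h2
    have hC := H.CCb he he' x y
    rw [abs_le] at hC
    have hpos : CC a q x y ≠ 0 := by
      have : 0 < CC a q x y := by linarith [hC.2]
      exact this.ne'
    apply mul_left_cancel₀ hpos
    linarith
  · intro x y
    have h1 := hc x y
    simp only [LL] at h1
    have : ∑ z, a z * (q x z * q y z * (1 + c x y + c x z + c y z)) =
      CC a q x y + CC a q x y * c x y + ∑ z, a z * (q x z * q y z * (c x z + c y z)) := by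
      rw [CC, Finset.sum_mul, ← Finset.sum_add_distrib, ← Finset.sum_add_distrib]
      apply Finset.sum_congr rfl; intro z _; ring
    rw [this]; linarith
  · intro x y
    have h1 := hρb x y
    rw [abs_le] at h1
    simp only [hf]; linarith [hipl x y]
  · intro x y
    simp only [hf]
    exact (abs_sub _ _).trans (by linarith [hρb x y, hipa x y])
  · intro x
    have e1 := H.avg1 c (fun x y => f x y + e x + e y) ga (by intro x y; rw [hcf]; ring)
      (fun _ => rfl)
    have e2 := H.avg2 c (fun x y => f x y + e x + e y) ga (by intro x y; rw [hcf]; ring)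
      (fun _ => rfl)
    have hs : ∀ x, ∑ y, a y * (f x y + e x + e y) = (∑ y, a y * f x y) + e x + ∑ y, a y * e y := by
      intro x
      simp_rw [mul_add]
      rw [Finset.sum_add_distrib, Finset.sum_add_distrib, ← Finset.sum_mul _ _ (e x), H.a1, one_mul]
    have hF : ∀ x, |∑ y, a y * f x y| ≤ 31 * ε ^ 2 := by
      intro x
      refine (Finset.abs_sum_le_sum_abs _ _).trans (le_trans (le_of_eq ?_) (hf1 x))
      apply Finset.sum_congr rfl; intro z _
      rw [abs_mul, abs_of_nonneg (H.a0 z)]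
    have hFF := mean_abs H.a0 H.a1 _ _ hF
    have hem := mean_abs H.a0 H.a1 _ _ heb
    have e1x := e1 x
    simp only [hs] at e1x e2
    have hss : ∑ x, a x * ((∑ y, a y * f x y) + e x + ∑ y, a y * e y) =
      (∑ x, a x * ∑ y, a y * f x y) + 2 * ∑ y, a y * e y := by
      simp_rw [mul_add]
      rw [Finset.sum_add_distrib, Finset.sum_add_distrib, ← Finset.sum_mul _ _ (∑ y, a y * e y), H.a1]
      ring
    rw [hss] at e2
    have hFx := hF x
    have hex := heb x
    simp only [abs_le] at hFF hem hFx hex ⊢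
    constructor <;> linarith [hFF.1, hFF.2, hem.1, hem.2, hFx.1, hFx.2, hex.1, hex.2]

theorem Cls.step (H : Cls ε a q) (he : 0 ≤ ε) (he' : ε ≤ 1 / 636) (ε' : ℝ)
    (hε' : ε + 128 * ε ^ 2 ≤ ε') :
    ∃ t : V → V → V → ℝ, (∀ x y, ∑ v, t v x y = a x * a y * q x y) ∧
      (∀ v x y, t v x y = t v y x) ∧ (∀ v x y, t v x y = t x v y) ∧ (∀ v y, t v v y = 0) ∧
      ∀ v, ∃ (k : ℝ) (a' : V → ℝ) (q' : V → V → ℝ), 0 ≤ k ∧ Cls ε' a' q' ∧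
        ∀ x y, t v x y = k * (a' x * a' y * q' x y) := by
  obtain ⟨c, f, g, cs, csum, cf, f32, f31, fb, gb⟩ := H.struct he he'
  have he2 : ε ^ 2 ≤ 1 / 636 * ε := by nlinarith
  have he20 : 0 ≤ ε ^ 2 := sq_nonneg ε
  refine ⟨fun v x y => a v * a x * a y * (q v x * q v y * q x y) * (1 + c x y + c v x + c v y),
    ?_, ?_, ?_, ?_, ?_⟩
  · intro x y
    have : ∀ v, a v * a x * a y * (q v x * q v y * q x y) * (1 + c x y + c v x + c v y) =
      a x * a y * q x y * (a v * (q x v * q y v * (1 + c x y + c x v + c y v))) := by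
      intro v; rw [H.qs x v, H.qs y v, cs x v, cs y v]; ring
    simp_rw [this]
    rw [← Finset.mul_sum, csum, mul_one]
  · intro v x y; beta_reduce; rw [H.qs y x, cs y x]; ring
  · intro v x y; beta_reduce; rw [H.qs x v, cs x v]; ring
  · intro v y; beta_reduce; rw [H.qd]; ring
  · intro v
    set α : V → ℝ := fun x => -2 * g x - g v + f v x with hα
    have hαb : ∀ x, |α x| ≤ 315 / 100 * ε := by
      intro x
      have h1 := gb x
      have h2 := gb v
      have h3 := fb v x
      simp only [abs_le] at h1 h2 h3 ⊢
      simp only [hα]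
      constructor <;> linarith [h1.1, h1.2, h2.1, h2.2, h3.1, h3.2]
    have hαl : ∀ x, -(315 / 100 * ε) ≤ α x := fun x => (abs_le.1 (hαb x)).1
    have hαu : ∀ x, α x ≤ 315 / 100 * ε := fun x => (abs_le.1 (hαb x)).2
    have hBpos : ∀ x, 0 < 1 + α x := fun x => by linarith [hαl x]
    have hcc : ∀ x y, 1 + c x y + c v x + c v y = 1 + α x + α y + f x y := by
      intro x y; simp only [hα, cf]; ring
    have hccpos : ∀ x y, 0 ≤ 1 + c x y + c v x + c v y := by
      intro x y; rw [hcc]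
      have := abs_le.1 (fb x y)
      linarith [hαl x, hαl y, this.1]
    have hBB : ∀ x y, 99 / 100 ≤ (1 + α x) * (1 + α y) := by
      intro x y
      nlinarith [hαl x, hαl y]
    set A : ℝ := ∑ x, a x * (q v x * (1 + α x)) with hA
    have hAl : 1 - 43 / 10 * ε ≤ A := by
      have h1 : A = 1 - (∑ x, a x * (1 - q v x)) + ∑ x, a x * (q v x * α x) := by
        have h0 : 1 - (∑ x, a x * (1 - q v x)) = ∑ x, a x - (∑ x, a x * (1 - q v x)) := by
          rw [H.a1]
        rw [hA, h0, ← Finset.sum_sub_distrib, ← Finset.sum_add_distrib]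
        apply Finset.sum_congr rfl; intro z _; ring
      have h2 := wmean_abs H.a0 (fun z => 1 - q v z) (fun z => 1) 1 _ zero_le_one
        (fun z => by simp) (H.qr v)
      have h3 := mean_abs H.a0 H.a1 (fun x => q v x * α x) ((1 + ε) * (315 / 100 * ε)) (by
        intro x; rw [abs_mul, abs_of_nonneg (H.q0 v x)]
        exact mul_le_mul (H.qu v x) (hαb x) (abs_nonneg _) (by linarith))
      simp only [mul_one] at h2
      rw [abs_le] at h2 h3
      rw [h1]
      nlinarith [h2.2, h3.1]
    have hApos : 0 < A := by linarith
    have hq'0 : ∀ x y, 0 ≤ q x y * (1 + c x y + c v x + c v y) / ((1 + α x) * (1 + α y)) := by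
      intro x y
      exact div_nonneg (mul_nonneg (H.q0 _ _) (hccpos x y)) (mul_pos (hBpos x) (hBpos y)).le
    have hq'e : ∀ x y, q x y * (1 + c x y + c v x + c v y) / ((1 + α x) * (1 + α y)) =
        q x y + q x y * ((f x y - α x * α y) / ((1 + α x) * (1 + α y))) := by
      intro x y
      have h1 := (hBpos x).ne'
      have h2 := (hBpos y).ne'
      rw [hcc]
      field_simp
      ring
    have hαα : ∀ x y, |α x * α y| ≤ 10 * ε ^ 2 := by
      intro x y
      rw [abs_mul]
      have := mul_le_mul (hαb x) (hαb y) (abs_nonneg _) (by linarith)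
      nlinarith
    refine ⟨a v * A ^ 2, fun x => a x * (q v x * (1 + α x)) / A,
      fun x y => q x y * (1 + c x y + c v x + c v y) / ((1 + α x) * (1 + α y)),
      mul_nonneg (H.a0 v) (sq_nonneg _), ⟨?_, ?_, hq'0, ?_, ?_, ?_, ?_⟩, ?_⟩
    · intro x
      exact div_nonneg (mul_nonneg (H.a0 x) (mul_nonneg (H.q0 _ _) (hBpos x).le)) hApos.le
    · rw [← Finset.sum_div]; exact div_self hApos.ne'
    · intro x y; rw [H.qs y x, cs y x]
      rw [mul_comm (1 + α y), add_right_comm _ (c v y)]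
    · intro x; rw [H.qd]; simp
    · intro x y
      rw [hq'e]
      have h1 : (f x y - α x * α y) / ((1 + α x) * (1 + α y)) ≤ 43 * ε ^ 2 := by
        rw [div_le_iff₀ (mul_pos (hBpos x) (hBpos y))]
        have h2 := hBB x y
        have h3 := (abs_le.1 (hαα x y)).1
        have h4 := f32 x y
        nlinarith
      have h5 : q x y * ((f x y - α x * α y) / ((1 + α x) * (1 + α y))) ≤ (1 + ε) * (43 * ε ^ 2) :=
        (mul_le_mul_of_nonneg_left h1 (H.q0 x y)).trans
          (mul_le_mul_of_nonneg_right (H.qu x y) (by positivity))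
      have h6 := H.qu x y
      nlinarith
    · intro x
      have hb : ∀ y, a y * (q v y * (1 + α y)) / A ≤ (1 + 10 * ε) * a y := by
        intro y
        rw [div_le_iff₀ hApos]
        have h1 : q v y * (1 + α y) ≤ (1 + ε) * (1 + 315 / 100 * ε) :=
          mul_le_mul (H.qu v y) (by linarith [hαu y]) (hBpos y).le (by linarith)
        have h2 : (1 + ε) * (1 + 315 / 100 * ε) ≤ (1 + 10 * ε) * A := by
          have : (1 + 10 * ε) * (1 - 43 / 10 * ε) ≤ (1 + 10 * ε) * A :=
            mul_le_mul_of_nonneg_left hAl (by linarith)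
          nlinarith
        have := mul_le_mul_of_nonneg_left (h1.trans h2) (H.a0 y)
        linarith
      have hd : ∀ y, |1 - q x y * (1 + c x y + c v x + c v y) / ((1 + α x) * (1 + α y))| ≤
          |1 - q x y| + (102 / 100) * (|f x y| + 10 * ε ^ 2) := by
        intro y
        rw [hq'e]
        have h1 : |(f x y - α x * α y) / ((1 + α x) * (1 + α y))| ≤
            100 / 99 * (|f x y| + 10 * ε ^ 2) := by
          rw [abs_div, abs_of_pos (mul_pos (hBpos x) (hBpos y)),
            div_le_iff₀ (mul_pos (hBpos x) (hBpos y))]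
          have h2 := hBB x y
          have h3 := abs_sub (f x y) (α x * α y)
          have h4 := hαα x y
          have h5 := abs_nonneg (f x y)
          nlinarith
        have h2 : 1 - (q x y + q x y * ((f x y - α x * α y) / ((1 + α x) * (1 + α y)))) =
          (1 - q x y) - q x y * ((f x y - α x * α y) / ((1 + α x) * (1 + α y))) := by ring
        rw [h2]
        refine (abs_sub _ _).trans ?_
        rw [abs_mul, abs_of_nonneg (H.q0 x y)]
        have h3 := mul_le_mul (H.qu x y) h1 (abs_nonneg _) (by linarith)
        have h5 := abs_nonneg (f x y)
        nlinarith
      calc ∑ y, a y * (q v y * (1 + α y)) / A *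
            |1 - q x y * (1 + c x y + c v x + c v y) / ((1 + α x) * (1 + α y))|
          ≤ ∑ y, (1 + 10 * ε) * (a y * |1 - q x y| + (102 / 100) * (a y * |f x y|) +
              a y * (102 / 10 * ε ^ 2)) := by
            apply Finset.sum_le_sum; intro y _
            have h1 := mul_le_mul (hb y) (hd y) (abs_nonneg _)
              (mul_nonneg (by linarith) (H.a0 y))
            linarith
        _ = (1 + 10 * ε) * ((∑ y, a y * |1 - q x y|) + (102 / 100) * (∑ y, a y * |f x y|) +
              (102 / 10 * ε ^ 2)) := by
            rw [← Finset.mul_sum, Finset.sum_add_distrib, Finset.sum_add_distrib,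
              ← Finset.mul_sum, ← Finset.sum_mul, H.a1, one_mul]
        _ ≤ (1 + 10 * ε) * (ε + 42 * ε ^ 2) := by
            apply mul_le_mul_of_nonneg_left _ (by linarith)
            linarith [H.qr x, f31 x]
        _ ≤ ε' := by nlinarith
    · intro x y
      have h1 := (hBpos x).ne'
      have h2 := (hBpos y).ne'
      have h3 := hApos.ne'
      simp only
      generalize A = A at *
      field_simp

end

section
variable {V : Type*} [Fintype V]

def Dec (r : ℕ) (h : V → V → ℝ) : Prop :=
  ∃ w : Finset V → ℝ, (∀ s, 0 ≤ w s) ∧ (∀ s, w s ≠ 0 → s.card = r) ∧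
    ∀ x y, x ≠ y → ∑ s, (if x ∈ s ∧ y ∈ s then w s else 0) = h x y

theorem Dec.smul {r : ℕ} {h h' : V → V → ℝ} (H : Dec r h) (k : ℝ) (hk : 0 ≤ k)
    (e : ∀ x y, h' x y = k * h x y) : Dec r h' := by
  obtain ⟨w, w0, wc, ws⟩ := H
  refine ⟨fun s => k * w s, fun s => mul_nonneg hk (w0 s), fun s hs => wc s (right_ne_zero_of_mul hs), ?_⟩
  intro x y hxy
  rw [e, ← ws x y hxy, Finset.mul_sum]
  apply Finset.sum_congr rfl; intro s _
  split_ifs <;> simp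

theorem Dec.two (h : V → V → ℝ) (h0 : ∀ x y, 0 ≤ h x y) (hs : ∀ x y, h x y = h y x) : Dec 2 h := by
  refine ⟨fun s => if s.card = 2 then (1 / 2) * ∑ x ∈ s, ∑ y ∈ s, (if x = y then 0 else h x y) else 0,
    ?_, ?_, ?_⟩
  · intro s
    beta_reduce
    split_ifs
    · apply mul_nonneg (by norm_num)
      refine Finset.sum_nonneg fun x _ => Finset.sum_nonneg fun y _ => ?_
      split_ifs
      · exact le_rfl
      · exact h0 _ _
    · exact le_rfl
  · intro s hs'
    by_contra hcon
    simp [hcon] at hs'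
  · intro x y hxy
    rw [Finset.sum_eq_single ({x, y} : Finset V)]
    · simp only [Finset.card_pair hxy, if_true, Finset.sum_pair hxy, hxy, hxy.symm, if_false]
      simp [hs y x]
      ring
    · intro s _ hne
      by_cases h1 : x ∈ s ∧ y ∈ s
      · by_cases h2 : s.card = 2
        · exfalso; apply hne
          symm
          apply Finset.eq_of_subset_of_card_le
          · intro z hz
            simp at hz
            rcases hz with rfl | rfl
            · exact h1.1
            · exact h1.2
          · rw [h2, Finset.card_pair hxy]
        · simp [h2]
      · rw [if_neg h1]
    · intro hn; exact absurd (Finset.mem_univ _) hn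

theorem reidx (v : V) (F : Finset V → ℝ) :
    ∑ s : Finset V, (if v ∈ s then F (s.erase v) else 0) = ∑ s, (if v ∈ s then 0 else F s) := by
  rw [← Finset.sum_filter]
  have : ∀ s : Finset V, (if v ∈ s then 0 else F s) = if v ∉ s then F s else 0 := by
    intro s; split_ifs <;> simp_all
  simp_rw [this]
  rw [← Finset.sum_filter]
  refine Finset.sum_bij' (fun s _ => s.erase v) (fun s _ => insert v s) ?_ ?_ ?_ ?_ ?_
  · intro s _; simp
  · intro s _; simp
  · intro s hs; simp at hs; exact Finset.insert_erase hs
  · intro s hs; simp at hs; exact Finset.erase_insert hs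
  · intro s _; rfl

theorem Dec.succ {r : ℕ} (hr : 2 ≤ r) (t : V → V → V → ℝ) (S : V → V → ℝ)
    (hS : ∀ x y, ∑ v, t v x y = S x y) (t1 : ∀ v x y, t v x y = t v y x)
    (t2 : ∀ v x y, t v x y = t x v y) (t3 : ∀ v y, t v v y = 0)
    (hd : ∀ v, Dec r (t v)) : Dec (r + 1) (fun x y => (1 + 2 / ((r : ℝ) - 1)) * S x y) := by
  choose W W0 Wc Ws using hd
  have hr1 : (r : ℝ) - 1 ≠ 0 := by
    have : (2 : ℝ) ≤ r := by exact_mod_cast hr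
    intro h; linarith
  -- vanishing
  have Wz : ∀ v x s, v ≠ x → v ∈ s → x ∈ s → W v s = 0 := by
    intro v x s hvx hv hx
    have h1 := Ws v v x hvx
    rw [t3] at h1
    rw [Finset.sum_eq_zero_iff_of_nonneg] at h1
    · have := h1 s (Finset.mem_univ _)
      simpa [hv, hx] using this
    · intro s _; split_ifs
      · exact W0 v s
      · exact le_rfl
  -- degree sums
  have Wd : ∀ x y, x ≠ y → ∑ s, (if y ∈ s then W x s else 0) = S x y / ((r : ℝ) - 1) := by
    intro x y hxy
    rw [eq_div_iff hr1, Finset.sum_mul]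
    have h1 : ∀ s : Finset V, (if y ∈ s then W x s else 0) * ((r : ℝ) - 1) =
        ∑ z ∈ univ.erase y, (if y ∈ s ∧ z ∈ s then W x s else 0) := by
      intro s
      by_cases hy : y ∈ s
      · by_cases hw : W x s = 0
        · simp [hw]
        · have hc := Wc x s hw
          simp only [hy, if_true, true_and]
          rw [← Finset.sum_filter, Finset.sum_const]
          have : (univ.erase y).filter (fun z => z ∈ s) = s.erase y := by
            ext z; simp
          rw [this, Finset.card_erase_of_mem hy, hc, nsmul_eq_mul, Nat.cast_sub (by omega)]
          push_cast; ring
      · simp [hy]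
    simp_rw [h1]
    rw [Finset.sum_comm]
    have h2 : ∀ z ∈ univ.erase y, ∑ s, (if y ∈ s ∧ z ∈ s then W x s else 0) = t x y z := by
      intro z hz
      exact Ws x y z (Finset.ne_of_mem_erase hz).symm
    rw [Finset.sum_congr rfl h2, ← hS x y]
    have h3 : ∀ z, t x y z = t z x y := by intro z; rw [t1, t2]
    simp_rw [h3]
    rw [← Finset.add_sum_erase univ (fun v => t v x y) (Finset.mem_univ y)]
    rw [t1 y x y, t3, zero_add]
  refine ⟨fun s => ∑ v, (if v ∈ s then W v (s.erase v) else 0), ?_, ?_, ?_⟩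
  · intro s
    refine Finset.sum_nonneg fun v _ => ?_
    split_ifs
    · exact W0 _ _
    · exact le_rfl
  · intro s hs
    obtain ⟨v, _, hv⟩ := Finset.exists_ne_zero_of_sum_ne_zero hs
    by_cases hvs : v ∈ s
    · simp only [hvs, if_true] at hv
      have := Wc v _ hv
      rw [Finset.card_erase_of_mem hvs] at this
      have := Finset.card_pos.2 ⟨v, hvs⟩
      omega
    · simp [hvs] at hv
  · intro x y hxy
    have h1 : ∀ s : Finset V, (if x ∈ s ∧ y ∈ s then ∑ v, (if v ∈ s then W v (s.erase v) else 0) else 0)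
        = ∑ v, (if v ∈ s then (if (x = v ∨ x ∈ s.erase v) ∧ (y = v ∨ y ∈ s.erase v)
            then W v (s.erase v) else 0) else 0) := by
      intro s
      by_cases h : x ∈ s ∧ y ∈ s
      · rw [if_pos h]
        apply Finset.sum_congr rfl; intro v _
        have : (x = v ∨ x ∈ s.erase v) ∧ (y = v ∨ y ∈ s.erase v) := by
          simp only [Finset.mem_erase]; tauto
        rw [if_pos this]
      · rw [if_neg h]
        symm
        apply Finset.sum_eq_zero; intro v _
        split_ifs with h2 h3
        · exfalso; apply h
          simp only [Finset.mem_erase] at h3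
          constructor
          · rcases h3.1 with h4 | h4
            · rwa [h4]
            · exact h4.2
          · rcases h3.2 with h4 | h4
            · rwa [h4]
            · exact h4.2
        · rfl
        · rfl
    simp_rw [h1]
    rw [Finset.sum_comm]
    have h2 : ∀ v, ∑ s : Finset V, (if v ∈ s then (if (x = v ∨ x ∈ s.erase v) ∧ (y = v ∨ y ∈ s.erase v)
            then W v (s.erase v) else 0) else 0) =
        t v x y + (if v = x then S x y / ((r : ℝ) - 1) else 0)
          + (if v = y then S x y / ((r : ℝ) - 1) else 0) := by
      intro v
      rw [reidx v (fun s => if (x = v ∨ x ∈ s) ∧ (y = v ∨ y ∈ s) then W v s else 0)]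
      by_cases hvx : v = x
      · subst hvx
        rw [t3, if_pos rfl, if_neg hxy, zero_add, add_zero, ← Wd v y hxy]
        apply Finset.sum_congr rfl; intro s _
        by_cases hv : v ∈ s
        · by_cases hy : y ∈ s
          · simp [hv, hy, Wz v y s hxy hv hy]
          · simp [hv, hy]
        · simp [hv, hxy.symm]
      · by_cases hvy : v = y
        · subst hvy
          have hS' : S x v = S v x := by
            rw [← hS, ← hS]; exact Finset.sum_congr rfl fun z _ => t1 _ _ _
          rw [t1, t3, if_pos rfl, if_neg hvx, zero_add, zero_add, hS', ← Wd v x hvx]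
          apply Finset.sum_congr rfl; intro s _
          by_cases hv : v ∈ s
          · by_cases hx : x ∈ s
            · simp [hv, hx, Wz v x s hvx hv hx]
            · simp [hv, hx]
          · simp [hv, hxy]
        · rw [if_neg hvx, if_neg hvy, add_zero, add_zero, ← Ws v x y hxy]
          apply Finset.sum_congr rfl; intro s _
          have e1 : x ≠ v := fun h => hvx h.symm
          have e2 : y ≠ v := fun h => hvy h.symm
          by_cases hv : v ∈ s
          · by_cases hx : x ∈ s
            · simp [hv, Wz v x s hvx hv hx]
            · simp [hv, hx]
          · simp [hv, e1, e2]
    simp_rw [h2]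
    rw [Finset.sum_add_distrib, Finset.sum_add_distrib, hS]
    simp
    field_simp
    ring

theorem Cls.dec (r : ℕ) (hr : 2 ≤ r) : ∀ (ε : ℝ) (a : V → ℝ) (q : V → V → ℝ),
    0 ≤ ε → ε ≤ 1 / (128 * (r : ℝ) + 252) → Cls ε a q → Dec r (fun x y => a x * a y * q x y) := by
  induction r, hr using Nat.le_induction with
  | base =>
    intro ε a q _ _ H
    apply Dec.two
    · intro x y; exact mul_nonneg (mul_nonneg (H.a0 x) (H.a0 y)) (H.q0 x y)
    · intro x y; rw [H.qs y x]; ring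
  | succ r hr ih =>
    intro ε a q he0 he H
    have hr2 : (2 : ℝ) ≤ r := by exact_mod_cast hr
    push_cast at he
    have hM : 0 < 128 * (r : ℝ) + 252 := by linarith
    have he' : ε ≤ 1 / 636 := he.trans (one_div_le_one_div_of_le (by norm_num) (by linarith))
    have hk : ε + 128 * ε ^ 2 ≤ 1 / (128 * (r : ℝ) + 252) := by
      rw [le_div_iff₀ (by linarith)] at he ⊢
      have hx : ε * (128 * (r : ℝ) + 252) ≤ 1 - 128 * ε := by linarith
      have : (1 + 128 * ε) * (ε * (128 * (r : ℝ) + 252)) ≤ (1 + 128 * ε) * (1 - 128 * ε) :=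
        mul_le_mul_of_nonneg_left hx (by linarith)
      nlinarith [sq_nonneg ε]
    obtain ⟨t, ts, t1, t2, t3, tv⟩ := H.step he0 he' _ hk
    have hd : ∀ v, Dec r (t v) := by
      intro v
      obtain ⟨k, a', q', hk0, H', e⟩ := tv v
      exact (ih _ a' q' (by positivity) le_rfl H').smul k hk0 e
    have := Dec.succ hr t _ ts t1 t2 t3 hd
    have hpos : 0 < 1 + 2 / ((r : ℝ) - 1) := by
      have : 0 < (r : ℝ) - 1 := by linarith
      positivity
    refine this.smul (1 + 2 / ((r : ℝ) - 1))⁻¹ (by positivity) ?_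
    intro x y
    rw [← mul_assoc, inv_mul_cancel₀ hpos.ne', one_mul]

end

theorem stmt7 {V : Type*} [Fintype V] (G : SimpleGraph V) [DecidableRel G.Adj]
    (r : ℕ) (hr : 3 ≤ r)
    (hdeg : ∀ v : V, (1 - 1 / (128 * (r : ℝ) + 252)) * Fintype.card V ≤ G.degree v) :
    fracCliqueDecomp G r := by
  rcases isEmpty_or_nonempty V with hV | hV
  · exact ⟨fun _ => 0, fun _ => le_rfl, fun u => (hV.false u).elim⟩
  have hn : (0 : ℝ) < Fintype.card V := by exact_mod_cast Fintype.card_pos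
  set n : ℝ := (Fintype.card V : ℝ) with hnd
  set M : ℝ := 128 * (r : ℝ) + 252 with hM
  have hMpos : 0 < M := by positivity
  have H : Cls (1 / M) (fun _ : V => 1 / n) (fun x y => if G.Adj x y then 1 else 0) := by
    refine ⟨fun _ => by positivity, ?_, ?_, ?_, ?_, ?_, ?_⟩
    · rw [Finset.sum_const, Finset.card_univ, nsmul_eq_mul]; field_simp; rfl
    · intro x y; beta_reduce; split_ifs <;> norm_num
    · intro x y; simp [G.adj_comm]
    · intro x; simp
    · intro x y
      have : 0 < 1 / M := by positivity
      beta_reduce; split_ifs <;> linarith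
    · intro x
      have h1 : ∀ y, 1 / n * |1 - (if G.Adj x y then (1 : ℝ) else 0)| =
          1 / n * (1 - (if G.Adj x y then (1 : ℝ) else 0)) := by
        intro y; split_ifs <;> simp
      simp_rw [h1]
      rw [← Finset.mul_sum, Finset.sum_sub_distrib]
      have h2 : ∑ y, (if G.Adj x y then (1 : ℝ) else 0) = G.degree x := by
        rw [Finset.sum_boole, ← G.card_neighborFinset_eq_degree, G.neighborFinset_eq_filter]
      rw [h2, Finset.sum_const, Finset.card_univ, nsmul_eq_mul, mul_one]
      have h3 := hdeg x
      rw [one_div_mul_eq_div, div_le_iff₀ hn]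
      linarith
  have hD := (Cls.dec r (by omega) (1 / M) _ _ (by positivity) le_rfl H).smul (n ^ 2) (sq_nonneg n)
    (h' := fun x y => if G.Adj x y then 1 else 0) (by
      intro x y; field_simp)
  obtain ⟨w, w0, wc, ws⟩ := hD
  refine ⟨w, w0, ?_⟩
  have wz : ∀ s, w s ≠ 0 → G.IsNClique r s := by
    intro s hs
    refine ⟨?_, wc s hs⟩
    intro x hx y hy hxy
    by_contra hna
    have h1 := ws x y hxy
    beta_reduce at h1
    rw [if_neg hna, Finset.sum_eq_zero_iff_of_nonneg] at h1
    · have := h1 s (Finset.mem_univ _)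
      rw [if_pos ⟨by simpa using hx, by simpa using hy⟩] at this
      exact hs this
    · intro s _; split_ifs
      · exact w0 s
      · exact le_rfl
  intro u v huv
  have h1 := ws u v huv.ne
  beta_reduce at h1
  rw [if_pos huv] at h1
  rw [← h1, Finset.sum_filter]
  apply Finset.sum_congr rfl; intro s _
  by_cases hw : w s = 0
  · simp [hw]
  · simp [wz s hw]
end

section
/- Let r ≥ 3, k ≥ (3r+2)/2, and let G be a graph on 4k vertices containing a spanning copy of the complete k-partite graph W_k with all parts of size 4. Then G has a fractional K_r-decomposition. -/
open Finset
open scoped Classical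

lemma aux_count {α : Type*} [DecidableEq α] (A B : Finset α) (h : A ⊆ B) (n : ℕ) (hn : A.card ≤ n) :
    ((powersetCard n B).filter (fun s => A ⊆ s)).card = (B.card - A.card).choose (n - A.card) := by
  rw [← card_sdiff_of_subset h, ← card_powersetCard]
  refine card_bij' (fun s _ => s \ A) (fun s _ => s ∪ A) ?_ ?_ ?_ ?_
  · intro s hs
    simp only [mem_filter, mem_powersetCard] at hs ⊢
    refine ⟨sdiff_subset_sdiff hs.1.1 (le_refl _), ?_⟩
    rw [card_sdiff_of_subset hs.2, hs.1.2]
  · intro s hs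
    simp only [mem_filter, mem_powersetCard] at hs ⊢
    refine ⟨⟨union_subset (hs.1.trans sdiff_subset) h, ?_⟩, subset_union_right⟩
    rw [card_union_of_disjoint, hs.2]
    · omega
    · exact disjoint_of_subset_left hs.1 sdiff_disjoint
  · intro s hs
    simp only [mem_filter, mem_powersetCard] at hs
    exact sdiff_union_of_subset hs.2
  · intro s hs
    simp only [mem_powersetCard] at hs
    rw [union_sdiff_right]
    exact sdiff_eq_self_of_disjoint (disjoint_of_subset_left hs.1 sdiff_disjoint)

lemma aux_big {V Ω : Type*} [Fintype V] [Fintype Ω] (G : SimpleGraph V) (r : ℕ) (hr : 2 ≤ r)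
    (p : Ω → ℝ) (C : Ω → Finset V) (c : ℝ) (hc : 0 < c) (hp : ∀ o, 0 ≤ p o)
    (hcl : ∀ o, p o ≠ 0 → G.IsClique (C o : Set V) ∧ r ≤ (C o).card)
    (hsum : ∀ u v, G.Adj u v → ∑ o, p o * (if u ∈ C o ∧ v ∈ C o then 1 else 0) = c) :
    fracCliqueDecomp G r := by
  refine ⟨fun s => ∑ o, (if s ⊆ C o then p o / c / ((C o).card - 2).choose (r - 2) else 0), ?_, ?_⟩
  · intro s
    refine sum_nonneg fun o _ => ?_
    split_ifs
    · have := hp o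
      positivity
    · exact le_rfl
  · intro u v huv
    rw [sum_comm]
    have key : ∀ o, ∑ s ∈ univ.filter (fun s : Finset V => G.IsNClique r s ∧ u ∈ s ∧ v ∈ s),
        (if s ⊆ C o then p o / c / ((C o).card - 2).choose (r - 2) else 0)
        = p o * (if u ∈ C o ∧ v ∈ C o then 1 else 0) / c := by
      intro o
      by_cases h0 : p o = 0
      · simp [h0]
      obtain ⟨h1, h2⟩ := hcl o h0
      rw [← sum_filter, sum_const, filter_filter]
      split_ifs with h
      · have : (univ.filter (fun s : Finset V => (G.IsNClique r s ∧ u ∈ s ∧ v ∈ s) ∧ s ⊆ C o))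
          = (powersetCard r (C o)).filter (fun s => {u, v} ⊆ s) := by
          ext s
          simp only [mem_filter, mem_univ, true_and, mem_powersetCard, insert_subset_iff,
            singleton_subset_iff, SimpleGraph.isNClique_iff]
          constructor
          · rintro ⟨⟨⟨_, a⟩, b⟩, d⟩
            exact ⟨⟨d, a⟩, b⟩
          · rintro ⟨⟨d, a⟩, b⟩
            exact ⟨⟨⟨h1.subset (by exact_mod_cast d), a⟩, b⟩, d⟩
        rw [this, aux_count, card_pair huv.ne, nsmul_eq_mul]
        · have : (0:ℝ) < ((C o).card - 2).choose (r - 2) := by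
            exact_mod_cast Nat.choose_pos (by omega)
          field_simp
        · simp [insert_subset_iff, h]
        · rw [card_pair huv.ne]; exact hr
      · rw [filter_false_of_mem]
        · simp
        · rintro s - ⟨⟨_, a, b⟩, d⟩
          exact h ⟨d a, d b⟩
    rw [sum_congr rfl (fun o _ => key o), ← sum_div, hsum u v huv, div_self hc.ne']

lemma aux_one {k : ℕ} {S : Type*} [Fintype S] (a : Fin k → S → ℝ) (ha : ∀ i, ∑ s, a i s = 1)
    (i : Fin k) (g : S → ℝ) :
    ∑ f : Fin k → S, (∏ l, a l (f l)) * g (f i) = ∑ s, a i s * g s := by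
  have : ∀ f : Fin k → S, (∏ l, a l (f l)) * g (f i) =
      ∏ l, (a l (f l) * (if l = i then g (f l) else 1)) := by
    intro f
    rw [prod_mul_distrib]
    congr 1
    simp
  rw [sum_congr rfl (fun f _ => this f),
    ← Fintype.prod_sum (fun l s => a l s * (if l = i then g s else 1))]
  rw [Fintype.prod_eq_single i]
  · simp
  · intro l hl
    simp [hl, ha]

lemma aux_two {k : ℕ} {S : Type*} [Fintype S] (a : Fin k → S → ℝ) (ha : ∀ i, ∑ s, a i s = 1)
    (i j : Fin k) (hij : i ≠ j) (g h : S → ℝ) :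
    ∑ f : Fin k → S, (∏ l, a l (f l)) * (g (f i) * h (f j))
      = (∑ s, a i s * g s) * ∑ s, a j s * h s := by
  have : ∀ f : Fin k → S, (∏ l, a l (f l)) * (g (f i) * h (f j)) =
      ∏ l, (a l (f l) * ((if l = i then g (f l) else 1) * (if l = j then h (f l) else 1))) := by
    intro f
    rw [prod_mul_distrib, prod_mul_distrib]
    congr 1
    simp
  rw [sum_congr rfl (fun f _ => this f),
    ← Fintype.prod_sum (fun l s => a l s * ((if l = i then g s else 1) * (if l = j then h s else 1)))]
  rw [Fintype.prod_eq_mul i j hij]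
  · simp [hij, hij.symm]
  · intro l hl
    simp [hl.1, hl.2, ha]

lemma aux_lam (k n : ℕ) (hn : 2 ≤ n) (hnk : n ≤ k) :
    ∃ L : Finset (Fin k) → ℝ, (∀ I, 0 ≤ L I) ∧ (∀ I, L I ≠ 0 → I.card ≤ n) ∧ ∑ I, L I = 1 ∧
      (∀ i, ∑ I, L I * (if i ∈ I then 1 else 0) = ((n:ℝ) - 1) / (k - 1)) ∧
      (∀ i j, i ≠ j → ∑ I, L I * ((if i ∈ I then 1 else 0) * (if j ∈ I then 1 else 0))
        = (((n:ℝ) - 1) / (k - 1)) ^ 2) := by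
  obtain ⟨n, rfl⟩ : ∃ m, n = m + 2 := ⟨n - 2, by omega⟩
  obtain ⟨k, rfl⟩ : ∃ m, k = m + 2 := ⟨k - 2, by omega⟩
  have hnk' : (n:ℝ) ≤ k := by exact_mod_cast (by omega : n ≤ k)
  set π : ℝ := (k + 2) * (n + 1) / ((k + 1) * (n + 2)) with hπ
  have hπ0 : 0 ≤ π := by positivity
  have hπ1 : π ≤ 1 := by
    rw [hπ, div_le_one (by positivity)]
    nlinarith
  have hN : (0:ℝ) < (k+2).choose (n+2) := by exact_mod_cast Nat.choose_pos (by omega)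
  have e1 : ((k+2:ℕ):ℝ) * (k+1).choose (n+1) = (k+2).choose (n+2) * ((n+2:ℕ):ℝ) := by
    exact_mod_cast Nat.add_one_mul_choose_eq (k+1) (n+1)
  have e2 : ((k+1:ℕ):ℝ) * k.choose n = (k+1).choose (n+1) * ((n+1:ℕ):ℝ) := by
    exact_mod_cast Nat.add_one_mul_choose_eq k n
  push_cast at e1 e2
  have gen : ∀ g : Finset (Fin (k+2)) → ℝ, ∑ I, ((if I = ∅ then 1 - π else 0) +
      (if I.card = n + 2 then π / (k+2).choose (n+2) else 0)) * g I = (1 - π) * g ∅ +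
        π / (k+2).choose (n+2) * ∑ I ∈ powersetCard (n+2) univ, g I := by
    intro g
    simp only [add_mul, sum_add_distrib, ite_mul, zero_mul, sum_ite_eq', mem_univ, if_true]
    congr 1
    rw [← sum_filter, mul_sum]
    apply sum_congr _ (fun _ _ => rfl)
    ext; simp [mem_powersetCard]
  refine ⟨fun I => (if I = ∅ then 1 - π else 0) +
    (if I.card = n + 2 then π / (k+2).choose (n+2) else 0), ?_, ?_, ?_, ?_, ?_⟩
  · intro I
    have : 0 ≤ 1 - π := by linarith
    dsimp only
    split_ifs <;> positivity
  · intro I h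
    by_contra h'
    apply h
    have h1 : I ≠ ∅ := by rintro rfl; simp at h'
    have h2 : I.card ≠ n + 2 := by omega
    simp [h1, h2]
  · have := gen (fun _ => 1)
    simp only [mul_one] at this
    rw [this]
    simp
    field_simp
    ring
  · intro i
    rw [gen (fun I => if i ∈ I then 1 else 0)]
    have := aux_count {i} (univ : Finset (Fin (k+2))) (subset_univ _) (n+2) (by simp)
    simp only [singleton_subset_iff, card_singleton, card_univ, Fintype.card_fin] at this
    rw [sum_boole, this]
    simp
    have e1' : ((k+1).choose (n+1) : ℝ) = (k+2).choose (n+2) * (n+2) / (k+2) := by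
      field_simp; linarith
    have hk2 : (k:ℝ) + 2 - 1 = k + 1 := by ring
    rw [hk2]
    rw [e1', hπ]
    field_simp
    ring
  · intro i j hij
    rw [gen (fun I => (if i ∈ I then 1 else 0) * (if j ∈ I then 1 else 0))]
    have := aux_count {i, j} (univ : Finset (Fin (k+2))) (subset_univ _) (n+2)
      (by rw [card_pair hij]; omega)
    simp only [insert_subset_iff, singleton_subset_iff, card_pair hij, card_univ,
      Fintype.card_fin] at this
    simp only [← ite_and, mul_ite, mul_one, mul_zero, and_comm] at this ⊢
    rw [sum_boole, this]
    simp
    have e1' : ((k+1).choose (n+1) : ℝ) = (k+2).choose (n+2) * (n+2) / (k+2) := by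
      field_simp; linarith
    have e2' : (k.choose n : ℝ) = (k+1).choose (n+1) * (n+1) / (k+1) := by
      field_simp; linarith
    have hk2 : (k:ℝ) + 2 - 1 = k + 1 := by ring
    rw [hk2]
    rw [e2', e1', hπ]
    field_simp
    ring

lemma aux_atoms {V : Type*} [Fintype V] (G : SimpleGraph V) (T : Finset V) {n : ℕ}
    (S : Fin n → Finset V) (c : Fin n → ℝ) (hc : ∀ j, 0 ≤ c j)
    (hS : ∀ j, c j ≠ 0 → S j ⊆ T ∧ G.IsClique (S j : Set V))
    (h0 : ∑ j, c j * (if S j = ∅ then 1 else 0) ≤ 1 / 3)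
    (h1 : ∑ j, c j = 1) (h2 : ∀ u ∈ T, ∑ j, c j * (if u ∈ S j then 1 else 0) = 1 / 4)
    (h3 : ∀ u ∈ T, ∀ v ∈ T, G.Adj u v →
        ∑ j, c j * (if u ∈ S j ∧ v ∈ S j then 1 else 0) = 1 / 16) :
    ∃ μ : Finset V → ℝ, (∀ s, 0 ≤ μ s) ∧ (∀ s, μ s ≠ 0 → s ⊆ T ∧ G.IsClique (s : Set V)) ∧
      μ ∅ ≤ 1 / 3 ∧ ∑ s, μ s = 1 ∧ (∀ u ∈ T, ∑ s, μ s * (if u ∈ s then 1 else 0) = 1 / 4) ∧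
      (∀ u ∈ T, ∀ v ∈ T, G.Adj u v →
        ∑ s, μ s * (if u ∈ s ∧ v ∈ s then 1 else 0) = 1 / 16) := by
  have gen : ∀ g : Finset V → ℝ, ∑ s, (∑ j, c j * (if S j = s then 1 else 0)) * g s
      = ∑ j, c j * g (S j) := by
    intro g
    simp only [sum_mul]
    rw [sum_comm]
    refine sum_congr rfl fun j _ => ?_
    simp
  refine ⟨fun s => ∑ j, c j * (if S j = s then 1 else 0), ?_, ?_, h0, ?_, ?_, ?_⟩
  · intro s
    refine sum_nonneg fun j _ => mul_nonneg (hc j) ?_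
    split_ifs <;> norm_num
  · intro s hs
    obtain ⟨j, -, hj⟩ := exists_ne_zero_of_sum_ne_zero hs
    have h4 : S j = s := by
      by_contra h
      simp [h] at hj
    rw [← h4]
    exact hS j (left_ne_zero_of_mul hj)
  · have := gen (fun _ => 1)
    simp only [mul_one] at this ⊢
    rw [this, h1]
  · intro u hu
    rw [gen (fun s => if u ∈ s then 1 else 0), h2 u hu]
  · intro u hu v hv huv
    rw [gen (fun s => if u ∈ s ∧ v ∈ s then 1 else 0), h3 u hu v hv huv]

lemma aux_local {V : Type*} [Fintype V] (G : SimpleGraph V) (T : Finset V) (hT : T.card = 4) :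
    ∃ μ : Finset V → ℝ, (∀ s, 0 ≤ μ s) ∧ (∀ s, μ s ≠ 0 → s ⊆ T ∧ G.IsClique (s : Set V)) ∧
      μ ∅ ≤ 1 / 3 ∧ ∑ s, μ s = 1 ∧ (∀ u ∈ T, ∑ s, μ s * (if u ∈ s then 1 else 0) = 1 / 4) ∧
      (∀ u ∈ T, ∀ v ∈ T, G.Adj u v →
        ∑ s, μ s * (if u ∈ s ∧ v ∈ s then 1 else 0) = 1 / 16) := by
  obtain ⟨a, b, c, d, hab, hac, had, hbc, hbd, hcd, rfl⟩ := card_eq_four.1 hT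
  have hab' := hab.symm
  have hac' := hac.symm
  have had' := had.symm
  have hbc' := hbc.symm
  have hbd' := hbd.symm
  have hcd' := hcd.symm
  by_cases hK : G.Adj a b ∧ G.Adj a c ∧ G.Adj a d ∧ G.Adj b c ∧ G.Adj b d ∧ G.Adj c d
  · obtain ⟨kab, kac, kad, kbc, kbd, kcd⟩ := hK
    refine aux_atoms G _ ![∅, {a}, {b}, {c}, {d}, {a, b, c}, {a, b, d}, {a, c, d}, {b, c, d}]
      ![1/4, 5/32, 5/32, 5/32, 5/32, 1/32, 1/32, 1/32, 1/32] ?_ ?_ ?_ ?_ ?_ ?_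
    · intro j
      fin_cases j <;> norm_num
    · intro j _
      fin_cases j <;>
        simp [insert_subset_iff, SimpleGraph.isClique_insert, kab, kac, kad, kbc, kbd, kcd]
    · simp [Fin.sum_univ_succ]
      norm_num
    · simp [Fin.sum_univ_succ]
      norm_num
    · intro u hu
      simp only [mem_insert, mem_singleton] at hu
      rcases hu with rfl | rfl | rfl | rfl <;>
      · simp [Fin.sum_univ_succ, *]
        norm_num
    · intro u hu v hv huv
      simp only [mem_insert, mem_singleton] at hu hv
      have := huv.ne
      rcases hu with rfl | rfl | rfl | rfl <;> rcases hv with rfl | rfl | rfl | rfl <;>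
        first
        | exact absurd rfl this
        | (simp [Fin.sum_univ_succ, *]; done)
        | (simp [Fin.sum_univ_succ, *]; norm_num)
  · have hx : ∃ x : V → V → ℝ, (∀ u v, 0 ≤ x u v) ∧ (∀ u v, x u v ≤ 1/16) ∧
        (∀ u v, x u v ≠ 0 → G.Adj u v) ∧ (∀ u v, G.Adj u v → x u v = 1/16) := by
      refine ⟨fun u v => if G.Adj u v then 1/16 else 0, ?_, ?_, ?_, ?_⟩
      · intro u v; dsimp only; split_ifs <;> norm_num
      · intro u v; dsimp only; split_ifs <;> norm_num
      · intro u v h; by_contra h'; simp [h'] at h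
      · intro u v h; simp [h]
    obtain ⟨x, x0, x1, x2, x3⟩ := hx
    have hs : x a b + x a c + x a d + x b c + x b d + x c d ≤ 1/3 := by
      by_contra hlt
      apply hK
      have := x1 a b
      have := x1 a c
      have := x1 a d
      have := x1 b c
      have := x1 b d
      have := x1 c d
      refine ⟨x2 _ _ ?_, x2 _ _ ?_, x2 _ _ ?_, x2 _ _ ?_, x2 _ _ ?_, x2 _ _ ?_⟩ <;>
      · intro h0
        apply hlt
        linarith
    refine aux_atoms G _ ![∅, {a}, {b}, {c}, {d}, {a, b}, {a, c}, {a, d}, {b, c}, {b, d}, {c, d}]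
      ![x a b + x a c + x a d + x b c + x b d + x c d,
        1/4 - x a b - x a c - x a d, 1/4 - x a b - x b c - x b d,
        1/4 - x a c - x b c - x c d, 1/4 - x a d - x b d - x c d,
        x a b, x a c, x a d, x b c, x b d, x c d] ?_ ?_ ?_ ?_ ?_ ?_
    · have := x1 a b
      have := x1 a c
      have := x1 a d
      have := x1 b c
      have := x1 b d
      have := x1 c d
      have := x0 a b
      have := x0 a c
      have := x0 a d
      have := x0 b c
      have := x0 b d
      have := x0 c d
      intro j
      fin_cases j <;> simp <;> linarith
    · intro j hj
      fin_cases j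
      · simp
      · simp
      · simp
      · simp
      · simp
      all_goals
        have := x2 _ _ hj
        simp [insert_subset_iff, SimpleGraph.isClique_insert, this]
    · simpa [Fin.sum_univ_succ] using hs
    · simp [Fin.sum_univ_succ]
      ring
    · intro u hu
      simp only [mem_insert, mem_singleton] at hu
      clear hK hs x0 x1 x2 x3
      rcases hu with rfl | rfl | rfl | rfl <;>
      · simp [Fin.sum_univ_succ, *]
        ring
    · intro u hu v hv huv
      simp only [mem_insert, mem_singleton] at hu hv
      have h4 := huv.ne
      have h5 := x3 _ _ huv
      have h6 := x3 _ _ huv.symm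
      clear hK hs x0 x1 x2 x3
      rcases hu with rfl | rfl | rfl | rfl <;> rcases hv with rfl | rfl | rfl | rfl <;>
        first
        | exact absurd rfl h4
        | (simp [Fin.sum_univ_succ, hab, hac, had, hbc, hbd, hcd, hab', hac', had', hbc', hbd',
            hcd', h5, h6]; done)

theorem stmt11 {V : Type*} [Fintype V] (G : SimpleGraph V) (r k : ℕ)
    (hr : 3 ≤ r) (hk : 3 * r + 2 ≤ 2 * k) (hcard : Fintype.card V = 4 * k)
    (P : V → Fin k)
    (hsize : ∀ i : Fin k, (univ.filter (fun v : V => P v = i)).card = 4)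
    (hadj : ∀ u v : V, P u ≠ P v → G.Adj u v) :
    fracCliqueDecomp G r := by
  choose μ hμ0 hμs hμe hμ1 hμv hμp using fun i => aux_local G _ (hsize i)
  obtain ⟨L, hL0, hLc, hL1, hLi, hLij⟩ := aux_lam k (k - r) (by omega) (by omega)
  set θ : ℝ := (((k - r : ℕ) : ℝ) - 1) / (k - 1) with hθ
  have hkr : (3 * r + 2 : ℝ) ≤ 2 * k := by exact_mod_cast hk
  have hr' : (3:ℝ) ≤ r := by exact_mod_cast hr
  have hθ3 : 1 / 3 ≤ θ := by
    rw [hθ, Nat.cast_sub (by omega), div_le_div_iff₀ (by norm_num) (by linarith)]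
    linarith
  have hθ0 : 0 < θ := by linarith
  let N : Fin k → Finset V → ℝ := fun i s => if s = ∅ then 0 else μ i s / (1 - μ i ∅)
  let M : Fin k → Finset V → ℝ := fun i s => (μ i s - (1 - θ) * N i s) / θ
  have hη : ∀ i, 0 < 1 - μ i ∅ := fun i => by have := hμe i; linarith
  have hN0 : ∀ i s, 0 ≤ N i s := by
    intro i s
    have := hη i
    have := hμ0 i s
    simp only [N]
    split_ifs <;> positivity
  have hM0 : ∀ i s, 0 ≤ M i s := by
    intro i s
    have h1 := hη i
    have h2 := hμ0 i s
    have h3 := hμe i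
    simp only [M, N]
    apply div_nonneg _ hθ0.le
    split_ifs
    · linarith
    · rw [sub_nonneg, ← mul_div_assoc, div_le_iff₀ h1]
      nlinarith
  have hMN : ∀ i s, θ * M i s + (1 - θ) * N i s = μ i s := by
    intro i s
    simp only [M]
    field_simp
    ring
  have hNs : ∀ i s, N i s ≠ 0 → s ≠ ∅ ∧ μ i s ≠ 0 := by
    intro i s h
    simp only [N] at h
    constructor
    · rintro rfl; simp at h
    · intro h'; simp [h'] at h
  have hMs : ∀ i s, M i s ≠ 0 → μ i s ≠ 0 := by
    intro i s h h'
    simp [M, N, h'] at h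
  have hN1 : ∀ i, ∑ s, N i s = 1 := by
    intro i
    have h1 := hη i
    have h2 := hμ1 i
    rw [← add_sum_erase _ _ (mem_univ ∅)] at h2
    rw [← add_sum_erase _ _ (mem_univ ∅)]
    have : ∑ s ∈ univ.erase ∅, N i s = ∑ s ∈ univ.erase ∅, μ i s / (1 - μ i ∅) := by
      apply sum_congr rfl
      intro s hs
      simp [N, (mem_erase.1 hs).1]
    rw [this, ← sum_div]
    simp only [N, if_true, zero_add]
    rw [div_eq_one_iff_eq h1.ne']
    linarith
  have hM1 : ∀ i, ∑ s, M i s = 1 := by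
    intro i
    simp only [M]
    rw [← sum_div, sum_sub_distrib, ← mul_sum, hN1, hμ1]
    field_simp
    ring
  let A : Finset (Fin k) → Fin k → Finset V → ℝ := fun I i s => if i ∈ I then M i s else N i s
  have hA1 : ∀ I i, ∑ s, A I i s = 1 := by
    intro I i
    simp only [A]
    split_ifs
    · exact hM1 i
    · exact hN1 i
  have hA0 : ∀ I i s, 0 ≤ A I i s := by
    intro I i s
    simp only [A]
    split_ifs
    · exact hM0 i s
    · exact hN0 i s
  have hAs : ∀ I i s, A I i s ≠ 0 → μ i s ≠ 0 := by
    intro I i s h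
    simp only [A] at h
    split_ifs at h
    · exact hMs i s h
    · exact (hNs i s h).2
  have hAg : ∀ I i (g : Finset V → ℝ), ∑ s, A I i s * g s =
      ∑ s, N i s * g s + (∑ s, M i s * g s - ∑ s, N i s * g s) * (if i ∈ I then 1 else 0) := by
    intro I i g
    simp only [A]
    split_ifs <;> ring
  have hmix : ∀ i (g : Finset V → ℝ), θ * ∑ s, M i s * g s + (1 - θ) * ∑ s, N i s * g s
      = ∑ s, μ i s * g s := by
    intro i g
    rw [mul_sum, mul_sum, ← sum_add_distrib]
    apply sum_congr rfl
    intro s _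
    rw [← hMN i s]; ring
  refine aux_big (Ω := Finset (Fin k) × (Fin k → Finset V)) G r (by omega)
    (fun o => L o.1 * ∏ l, A o.1 l (o.2 l)) (fun o => univ.filter (fun v => v ∈ o.2 (P v)))
    (1/16) (by norm_num) ?_ ?_ ?_
  · rintro ⟨I, f⟩
    exact mul_nonneg (hL0 I) (prod_nonneg fun l _ => hA0 I l _)
  · rintro ⟨I, f⟩ h
    dsimp only at h ⊢
    have hLI := hLc I (left_ne_zero_of_mul h)
    have hf : ∀ l, A I l (f l) ≠ 0 := fun l => (prod_ne_zero_iff.1 (right_ne_zero_of_mul h)) l (mem_univ l)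
    have hfs := fun l => hμs l (f l) (hAs I l _ (hf l))
    constructor
    · intro u hu v hv huv
      simp only [coe_filter, mem_univ, true_and, Set.mem_setOf_eq] at hu hv
      by_cases hP : P u = P v
      · exact (hfs (P v)).2 (by rw [← hP]; exact_mod_cast hu) (by exact_mod_cast hv) huv
      · exact hadj u v hP
    · have h1 : Iᶜ ⊆ (univ.filter (fun v => v ∈ f (P v))).image P := by
        intro i hi
        rw [mem_compl] at hi
        have h2 := hf i
        simp only [A, if_neg hi] at h2
        obtain ⟨v, hv⟩ := nonempty_iff_ne_empty.2 (hNs i _ h2).1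
        have h3 := (hfs i).1 hv
        simp only [mem_filter, mem_univ, true_and] at h3
        rw [mem_image]
        exact ⟨v, by simp [h3, hv], h3⟩
      have h2 := (card_le_card h1).trans card_image_le
      rw [card_compl, Fintype.card_fin] at h2
      omega
  · intro u v huv
    rw [Fintype.sum_prod_type]
    simp only [mem_filter, mem_univ, true_and]
    have step : ∀ I, ∑ f : Fin k → Finset V, L I * (∏ l, A I l (f l)) *
        (if u ∈ f (P u) ∧ v ∈ f (P v) then 1 else 0) = L I * ∑ f : Fin k → Finset V,
        (∏ l, A I l (f l)) * (if u ∈ f (P u) ∧ v ∈ f (P v) then 1 else 0) := by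
      intro I
      rw [mul_sum]
      exact sum_congr rfl fun f _ => by ring
    rw [sum_congr rfl fun I _ => step I]
    by_cases hP : P u = P v
    · rw [hP]
      have : ∀ I, ∑ f : Fin k → Finset V,
        (∏ l, A I l (f l)) * (if u ∈ f (P v) ∧ v ∈ f (P v) then 1 else 0) = _ := fun I =>
          aux_one (A I) (hA1 I) (P v) (fun s => if u ∈ s ∧ v ∈ s then (1:ℝ) else 0)
      simp only [this, hAg]
      simp only [mul_add, sum_add_distrib, mul_left_comm (L _), ← sum_mul, ← mul_sum, hL1, hLi]
      rw [← hμp (P v) u (by simp [hP]) v (by simp) huv, ← hmix]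
      ring
    · have : ∀ I, ∑ f : Fin k → Finset V,
        (∏ l, A I l (f l)) * (if u ∈ f (P u) ∧ v ∈ f (P v) then 1 else 0) = _ := fun I => by
          refine Eq.trans ?_ (aux_two (A I) (hA1 I) (P u) (P v) hP
            (fun s => if u ∈ s then (1:ℝ) else 0) (fun s => if v ∈ s then (1:ℝ) else 0))
          refine sum_congr rfl fun f _ => ?_
          congr 1
          by_cases h1 : u ∈ f (P u) <;> by_cases h2 : v ∈ f (P v) <;> simp [h1, h2]
      simp only [this, hAg]
      have hu := hmix (P u) (fun s => if u ∈ s then 1 else 0)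
      have hv := hmix (P v) (fun s => if v ∈ s then 1 else 0)
      rw [hμv (P u) u (by simp)] at hu
      rw [hμv (P v) v (by simp)] at hv
      generalize (∑ s, M (P u) s * if u ∈ s then (1:ℝ) else 0) = a at *
      generalize (∑ s, N (P u) s * if u ∈ s then (1:ℝ) else 0) = b at *
      generalize (∑ s, M (P v) s * if v ∈ s then (1:ℝ) else 0) = c at *
      generalize (∑ s, N (P v) s * if v ∈ s then (1:ℝ) else 0) = d at *
      have : ∀ I, L I * ((b + (a - b) * if P u ∈ I then 1 else 0) * (d + (c - d) * if P v ∈ I then 1 else 0))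
        = (b * d) * L I + (a - b) * d * (L I * if P u ∈ I then 1 else 0)
          + b * (c - d) * (L I * if P v ∈ I then 1 else 0)
          + (a - b) * (c - d) * (L I * ((if P u ∈ I then 1 else 0) * (if P v ∈ I then 1 else 0))) := by
        intro I; ring
      simp only [this, sum_add_distrib, ← mul_sum, hL1, hLi, hLij _ _ hP]
      have : (1/16:ℝ) = (θ * a + (1 - θ) * b) * (θ * c + (1 - θ) * d) := by rw [hu, hv]; norm_num
      rw [this]; ring
end
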